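/- L² bound of the Ritz projection error by the maximum norm of the data (estimate (5.8) of the paper): Let Ω ⊂ ℝ³ be a convex polyhedron, c > 0, and r ≥ 1 an integer. There exists a constant C (depending only on Ω, c and r) such that for every h > 0, every tetrahedral partition 𝔗 of Ω with mesh size h and quasi-uniformity constant c, every Lipschitz function u : closure(Ω) → ℝ vanishing on ∂Ω, and every u_h ∈ S̊_h satisfying ∫_Ω ∇(u − u_h)·∇χ dx = 0 for all χ ∈ S̊_h, one has (∫_Ω |u − u_h|² dx)^{1/2} ≤ C sup_{x ∈ Ω} |u(x)|. -/

import Mathlib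

open MeasureTheory Metric Set
open scoped RealInnerProductSpace ENNReal NNReal

noncomputable section

/-- Three-dimensional Euclidean space. -/
abbrev E3 : Type := EuclideanSpace ℝ (Fin 3)

/-- A convex polyhedron: a bounded convex open set which is the interior of the
convex hull of a finite set of points. -/
def IsConvexPolyhedron (Ω : Set E3) : Prop :=
  IsOpen Ω ∧ Bornology.IsBounded Ω ∧ Convex ℝ Ω ∧
    ∃ S : Finset E3, Ω = interior (convexHull ℝ (S : Set E3))

/-- The closed tetrahedron with vertices `v 0, v 1, v 2, v 3`. -/
def tet (v : Fin 4 → E3) : Set E3 := convexHull ℝ (Set.range v)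

/-- A quasi-uniform conforming tetrahedral partition of `Ω` with mesh size `h`
and quasi-uniformity constant `c`, recorded by the vertex tuples of its tetrahedra. -/
def IsTetPartition (Ω : Set E3) (T : Finset (Fin 4 → E3)) (h c : ℝ) : Prop :=
  (∀ v ∈ T, AffineIndependent ℝ v) ∧
  (⋃ v ∈ T, tet v) = closure Ω ∧
  (∀ v ∈ T, ∀ w ∈ T, tet v ≠ tet w → interior (tet v) ∩ interior (tet w) = ∅) ∧
  (∀ v ∈ T, ∀ w ∈ T, tet v ≠ tet w →
    tet v ∩ tet w = ∅ ∨ tet v ∩ tet w = convexHull ℝ (Set.range v ∩ Set.range w)) ∧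
  (∀ v ∈ T, Metric.diam (tet v) ≤ h) ∧
  (∀ v ∈ T, ∃ x : E3, Metric.closedBall x (c * h) ⊆ tet v)

/-- The finite element space `S_h` of continuous piecewise polynomials of degree `≤ r`. -/
def MemSh (Ω : Set E3) (T : Finset (Fin 4 → E3)) (r : ℕ) (u : E3 → ℝ) : Prop :=
  ContinuousOn u (closure Ω) ∧
  ∀ v ∈ T, ∃ p : MvPolynomial (Fin 3) ℝ,
    p.totalDegree ≤ r ∧ ∀ x ∈ tet v, u x = MvPolynomial.eval (fun i => x i) p

/-- The subspace `S̊_h` of finite element functions vanishing on the boundary. -/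
def MemSh0 (Ω : Set E3) (T : Finset (Fin 4 → E3)) (r : ℕ) (u : E3 → ℝ) : Prop :=
  MemSh Ω T r u ∧ ∀ x ∈ frontier Ω, u x = 0

/-- The Laplacian, as the trace of the Hessian. -/
def lap (v : E3 → ℝ) (x : E3) : ℝ :=
  ∑ i : Fin 3,
    fderiv ℝ (fun y => fderiv ℝ v y (EuclideanSpace.single i 1)) x (EuclideanSpace.single i 1)

/-- The `L^p(A)` norm. -/
def LpN (A : Set E3) (p : ℝ) (w : E3 → ℝ) : ℝ := (∫ x in A, |w x| ^ p) ^ (1 / p)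

/-- The `W^{1,p}(A)` norm. -/
def W1pN (A : Set E3) (p : ℝ) (w : E3 → ℝ) : ℝ :=
  (∫ x in A, (|w x| ^ p + ‖gradient w x‖ ^ p)) ^ (1 / p)

/-- The `W^{2,p}(A)` norm. -/
def W2pN (A : Set E3) (p : ℝ) (w : E3 → ℝ) : ℝ :=
  (∫ x in A, (|w x| ^ p + ‖gradient w x‖ ^ p + ‖iteratedFDeriv ℝ 2 w x‖ ^ p)) ^ (1 / p)

set_option linter.unusedSectionVars false
set_option linter.unusedVariables false
set_option linter.unusedSimpArgs false
set_option linter.style.longLine false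

/-! ### Gradient calculus -/

lemma grad_inner (v : E3 → ℝ) (x t : E3) : ⟪gradient v x, t⟫ = fderiv ℝ v x t :=
  inner_gradient_left

lemma grad_ext {v : E3 → ℝ} {x a : E3} (h : ∀ t, fderiv ℝ v x t = ⟪a, t⟫) : gradient v x = a := by
  refine ext_inner_right ℝ fun t => ?_
  rw [grad_inner, h]

lemma grad_add {v w : E3 → ℝ} {x : E3} (hv : DifferentiableAt ℝ v x) (hw : DifferentiableAt ℝ w x) :
    gradient (fun y => v y + w y) x = gradient v x + gradient w x := by
  apply grad_ext; intro t
  rw [fderiv_fun_add hv hw, inner_add_left, grad_inner, grad_inner]; rfl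

lemma grad_sub {v w : E3 → ℝ} {x : E3} (hv : DifferentiableAt ℝ v x) (hw : DifferentiableAt ℝ w x) :
    gradient (fun y => v y - w y) x = gradient v x - gradient w x := by
  apply grad_ext; intro t
  rw [fderiv_fun_sub hv hw, inner_sub_left, grad_inner, grad_inner]; rfl

lemma grad_sum {ι : Type*} {s : Finset ι} {v : ι → E3 → ℝ} {x : E3}
    (hv : ∀ i ∈ s, DifferentiableAt ℝ (v i) x) :
    gradient (fun y => ∑ i ∈ s, v i y) x = ∑ i ∈ s, gradient (v i) x := by
  apply grad_ext; intro t
  rw [fderiv_fun_sum hv, sum_inner]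
  simp [grad_inner]

lemma grad_smul {v : E3 → ℝ} {x : E3} (c : ℝ) (hv : DifferentiableAt ℝ v x) :
    gradient (fun y => c * v y) x = c • gradient v x := by
  apply grad_ext; intro t
  rw [fderiv_const_mul hv, inner_smul_left, grad_inner]; simp

lemma grad_mul {v w : E3 → ℝ} {x : E3} (hv : DifferentiableAt ℝ v x) (hw : DifferentiableAt ℝ w x) :
    gradient (fun y => v y * w y) x = v x • gradient w x + w x • gradient v x := by
  apply grad_ext; intro t
  rw [fderiv_fun_mul hv hw, inner_add_left, inner_smul_left, inner_smul_left, grad_inner, grad_inner]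
  simp

lemma grad_inner_const (a x : E3) : gradient (fun y : E3 => ⟪a, y⟫) x = a := by
  apply grad_ext; intro t
  exact congrArg (fun L : E3 →L[ℝ] ℝ => L t) (innerSL ℝ a).fderiv

/-- Lipschitz real functions on `E3`. -/
def Lip (v : E3 → ℝ) : Prop := ∃ K : ℝ≥0, LipschitzWith K v

lemma Lip.ae {v : E3 → ℝ} (h : Lip v) : ∀ᵐ x : E3, DifferentiableAt ℝ v x := by
  obtain ⟨K, hK⟩ := h; exact hK.ae_differentiableAt

lemma Lip.cont {v : E3 → ℝ} (h : Lip v) : Continuous v := by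
  obtain ⟨K, hK⟩ := h; exact hK.continuous

lemma norm_grad (v : E3 → ℝ) (x : E3) : ‖gradient v x‖ = ‖fderiv ℝ v x‖ := by
  rw [gradient, LinearIsometryEquiv.norm_map]

lemma Lip.grad_le {v : E3 → ℝ} (h : Lip v) : ∃ K : ℝ, 0 ≤ K ∧ ∀ x, ‖gradient v x‖ ≤ K := by
  obtain ⟨K, hK⟩ := h
  exact ⟨K, K.2, fun x => by rw [norm_grad]; exact norm_fderiv_le_of_lipschitz ℝ hK⟩

lemma lip_of_le {v : E3 → ℝ} (K : ℝ) (h : ∀ x y, |v x - v y| ≤ K * ‖x - y‖) : Lip v := by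
  refine ⟨K.toNNReal, LipschitzWith.of_dist_le_mul fun x y => ?_⟩
  rw [Real.dist_eq, dist_eq_norm]
  exact (h x y).trans (mul_le_mul_of_nonneg_right (Real.le_coe_toNNReal K) (norm_nonneg _))

lemma Lip.le {v : E3 → ℝ} (h : Lip v) : ∃ K : ℝ, 0 ≤ K ∧ ∀ x y, |v x - v y| ≤ K * ‖x - y‖ := by
  obtain ⟨K, hK⟩ := h
  refine ⟨K, K.2, fun x y => ?_⟩
  have := hK.dist_le_mul x y
  rwa [Real.dist_eq, dist_eq_norm] at this

lemma Lip.add {v w : E3 → ℝ} (hv : Lip v) (hw : Lip w) : Lip (fun x => v x + w x) := by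
  obtain ⟨K, hK⟩ := hv; obtain ⟨L, hL⟩ := hw; exact ⟨_, hK.add hL⟩

lemma Lip.sub {v w : E3 → ℝ} (hv : Lip v) (hw : Lip w) : Lip (fun x => v x - w x) := by
  obtain ⟨K, hK⟩ := hv; obtain ⟨L, hL⟩ := hw; exact ⟨_, hK.sub hL⟩

lemma lip_const (c : ℝ) : Lip (fun _ => c) := ⟨0, LipschitzWith.const c⟩

lemma lip_inner (a : E3) : Lip (fun x => ⟪a, x⟫) := by
  refine lip_of_le ‖a‖ fun x y => ?_
  rw [← inner_sub_right]; exact abs_real_inner_le_norm _ _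

lemma Lip.sum {ι : Type*} {s : Finset ι} {v : ι → E3 → ℝ} (hv : ∀ i ∈ s, Lip (v i)) :
    Lip (fun x => ∑ i ∈ s, v i x) := by
  classical
  induction s using Finset.induction_on with
  | empty => simpa using lip_const 0
  | insert a s ha ih =>
    simp only [Finset.sum_insert ha]
    exact (hv a (Finset.mem_insert_self _ _)).add (ih fun i hi => hv i (Finset.mem_insert_of_mem hi))

lemma Lip.const_mul {v : E3 → ℝ} (c : ℝ) (hv : Lip v) : Lip (fun x => c * v x) := by
  obtain ⟨K, hK, h⟩ := hv.le
  refine lip_of_le (|c| * K) fun x y => ?_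
  rw [← mul_sub, abs_mul, mul_assoc]; exact mul_le_mul_of_nonneg_left (h x y) (abs_nonneg _)

lemma Lip.comp_le {v : E3 → ℝ} (hv : Lip v) (A : E3 → E3) (hA : ∀ x y, ‖A x - A y‖ ≤ ‖x - y‖) :
    Lip (fun x => v (A x)) := by
  obtain ⟨K, hK, h⟩ := hv.le
  exact lip_of_le K fun x y => (h _ _).trans (mul_le_mul_of_nonneg_left (hA x y) hK)

lemma Lip.mul_bdd {v w : E3 → ℝ} (hv : Lip v) (hw : Lip w) {A B : ℝ} (hA : ∀ x, |v x| ≤ A)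
    (hB : ∀ x, |w x| ≤ B) : Lip (fun x => v x * w x) := by
  obtain ⟨K, hK, h⟩ := hv.le
  obtain ⟨L, hL, h'⟩ := hw.le
  refine lip_of_le (A * L + K * B) fun x y => ?_
  have e : v x * w x - v y * w y = v x * (w x - w y) + (v x - v y) * w y := by ring
  rw [e]
  refine (abs_add_le _ _).trans ?_
  rw [abs_mul, abs_mul]
  have h1 := mul_le_mul (hA x) (h' x y) (abs_nonneg _) ((abs_nonneg _).trans (hA x))
  have h2 := mul_le_mul (h x y) (hB y) (abs_nonneg _) (by positivity)
  nlinarith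

lemma grad_measurable (v : E3 → ℝ) : Measurable (gradient v) := by
  have : gradient v = fun x => (InnerProductSpace.toDual ℝ E3).symm (fderiv ℝ v x) := rfl
  rw [this]
  exact (LinearIsometryEquiv.continuous _).measurable.comp (measurable_fderiv ℝ v)

/-- Bounded measurable functions vanishing off a ball. -/
def Nice {F : Type*} [NormedAddCommGroup F] [MeasurableSpace F] (a : E3 → F) : Prop :=
  Measurable a ∧ (∃ C : ℝ, ∀ x, ‖a x‖ ≤ C) ∧ ∃ R : ℝ, ∀ x, R < ‖x‖ → a x = 0

/-- Bounded measurable functions. -/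
def BM {F : Type*} [NormedAddCommGroup F] [MeasurableSpace F] (a : E3 → F) : Prop :=
  Measurable a ∧ (∃ C : ℝ, ∀ x, ‖a x‖ ≤ C)

lemma Nice.bm {F : Type*} [NormedAddCommGroup F] [MeasurableSpace F] {a : E3 → F} (h : Nice a) :
    BM a := ⟨h.1, h.2.1⟩

section nice
variable {F : Type*} [NormedAddCommGroup F] [MeasurableSpace F] [BorelSpace F]
  [SecondCountableTopology F]

lemma Nice.integrable {a : E3 → F} (h : Nice a) : Integrable a := by
  obtain ⟨hm, ⟨C, hC⟩, R, hR⟩ := h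
  have h1 : IntegrableOn a (closedBall 0 R) := by
    apply Measure.integrableOn_of_bounded (M := C) (isCompact_closedBall 0 R).measure_lt_top.ne
      hm.aestronglyMeasurable
    exact Filter.Eventually.of_forall hC
  rw [integrableOn_iff_integrable_of_support_subset] at h1
  · exact h1
  · intro x hx
    by_contra hh
    apply hx; apply hR; simpa using hh

lemma BM.of_bdd {a : E3 → F} (C : ℝ) (hm : Measurable a) (hC : ∀ x, ‖a x‖ ≤ C) : BM a :=
  ⟨hm, C, hC⟩

lemma Nice.add {a b : E3 → F} (ha : Nice a) (hb : Nice b) : Nice (fun x => a x + b x) := by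
  obtain ⟨hm, ⟨C, hC⟩, R, hR⟩ := ha
  obtain ⟨hm', ⟨C', hC'⟩, R', hR'⟩ := hb
  refine ⟨hm.add hm', ⟨C + C', fun x => (norm_add_le _ _).trans (add_le_add (hC x) (hC' x))⟩,
    max R R', fun x hx => ?_⟩
  simp [hR x ((le_max_left _ _).trans_lt hx), hR' x ((le_max_right _ _).trans_lt hx)]

lemma Nice.neg {a : E3 → F} (ha : Nice a) : Nice (fun x => - a x) := by
  obtain ⟨hm, ⟨C, hC⟩, R, hR⟩ := ha
  exact ⟨hm.neg, ⟨C, fun x => by rw [norm_neg]; exact hC x⟩, R, fun x hx => by simp [hR x hx]⟩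

lemma Nice.sub {a b : E3 → F} (ha : Nice a) (hb : Nice b) : Nice (fun x => a x - b x) := by
  simpa only [sub_eq_add_neg] using ha.add hb.neg

lemma BM.add {a b : E3 → F} (ha : BM a) (hb : BM b) : BM (fun x => a x + b x) := by
  obtain ⟨hm, ⟨C, hC⟩⟩ := ha
  obtain ⟨hm', ⟨C', hC'⟩⟩ := hb
  exact ⟨hm.add hm', ⟨C + C', fun x => (norm_add_le _ _).trans (add_le_add (hC x) (hC' x))⟩⟩

lemma bm_const (c : F) : BM (fun _ : E3 => c) := ⟨measurable_const, ‖c‖, fun _ => le_rfl⟩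

lemma BM.neg {a : E3 → F} (ha : BM a) : BM (fun x => - a x) := by
  obtain ⟨hm, ⟨C, hC⟩⟩ := ha
  exact ⟨hm.neg, ⟨C, fun x => by rw [norm_neg]; exact hC x⟩⟩

lemma BM.sub {a b : E3 → F} (ha : BM a) (hb : BM b) : BM (fun x => a x - b x) := by
  simpa only [sub_eq_add_neg] using ha.add hb.neg

lemma Nice.sum {ι : Type*} {s : Finset ι} {a : ι → E3 → F} (ha : ∀ i ∈ s, Nice (a i)) :
    Nice (fun x => ∑ i ∈ s, a i x) := by
  classical
  induction s using Finset.induction_on with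
  | empty => exact ⟨by simp, ⟨0, by simp⟩, 0, by simp⟩
  | insert i s hi ih =>
    simp only [Finset.sum_insert hi]
    exact (ha i (Finset.mem_insert_self _ _)).add (ih fun i hi => ha i (Finset.mem_insert_of_mem hi))

lemma Nice.comp {a : E3 → F} (ha : Nice a) {A : E3 → E3} (hA : Measurable A) (M : ℝ)
    (hM : ∀ x, ‖x‖ ≤ ‖A x‖ + M) : Nice (fun x => a (A x)) := by
  obtain ⟨hm, ⟨C, hC⟩, R, hR⟩ := ha
  exact ⟨hm.comp hA, ⟨C, fun x => hC _⟩, R + M, fun x hx => hR _ (by linarith [hM x])⟩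

lemma Nice.trans {a : E3 → F} (ha : Nice a) (t : E3) : Nice (fun x => a (x + t)) :=
  ha.comp (measurable_add_const t) ‖t‖ fun x => by
    have := norm_sub_le (x + t) t; simpa using this

lemma Nice.congr_ball {a : E3 → F} (ha : BM a) (R : ℝ) (hR : ∀ x, R < ‖x‖ → a x = 0) : Nice a :=
  ⟨ha.1, ha.2, R, hR⟩

lemma BM.comp {a : E3 → F} (ha : BM a) {A : E3 → E3} (hA : Measurable A) : BM (fun x => a (A x)) := by
  obtain ⟨hm, ⟨C, hC⟩⟩ := ha
  exact ⟨hm.comp hA, ⟨C, fun x => hC _⟩⟩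

end nice

lemma Nice.mul {a b : E3 → ℝ} (ha : Nice a) (hb : BM b) : Nice (fun x => a x * b x) := by
  obtain ⟨hm, ⟨C, hC⟩, R, hR⟩ := ha
  obtain ⟨hm', ⟨C', hC'⟩⟩ := hb
  refine ⟨hm.mul hm', ⟨C * C', fun x => ?_⟩, R, fun x hx => by simp [hR x hx]⟩
  rw [norm_mul]
  exact mul_le_mul (hC x) (hC' x) (norm_nonneg _) ((norm_nonneg _).trans (hC x))

lemma Nice.mul' {a b : E3 → ℝ} (hb : BM b) (ha : Nice a) : Nice (fun x => b x * a x) := by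
  simpa only [mul_comm] using ha.mul hb

lemma BM.mul {a b : E3 → ℝ} (ha : BM a) (hb : BM b) : BM (fun x => a x * b x) := by
  obtain ⟨hm, ⟨C, hC⟩⟩ := ha
  obtain ⟨hm', ⟨C', hC'⟩⟩ := hb
  refine ⟨hm.mul hm', ⟨C * C', fun x => ?_⟩⟩
  rw [norm_mul]
  exact mul_le_mul (hC x) (hC' x) (norm_nonneg _) ((norm_nonneg _).trans (hC x))

lemma Nice.sq {a : E3 → ℝ} (ha : Nice a) : Nice (fun x => a x ^ 2) := by
  simpa only [pow_two] using ha.mul ha.bm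

lemma BM.sq {a : E3 → ℝ} (ha : BM a) : BM (fun x => a x ^ 2) := by
  simpa only [pow_two] using ha.mul ha

lemma Nice.smul {a : E3 → ℝ} {b : E3 → E3} (ha : Nice a) (hb : BM b) : Nice (fun x => a x • b x) := by
  obtain ⟨hm, ⟨C, hC⟩, R, hR⟩ := ha
  obtain ⟨hm', ⟨C', hC'⟩⟩ := hb
  refine ⟨hm.smul hm', ⟨C * C', fun x => ?_⟩, R, fun x hx => by simp [hR x hx]⟩
  rw [norm_smul]
  exact mul_le_mul (hC x) (hC' x) (norm_nonneg _) ((norm_nonneg _).trans (hC x))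

lemma Nice.smul' {a : E3 → ℝ} {b : E3 → E3} (ha : BM a) (hb : Nice b) : Nice (fun x => a x • b x) := by
  obtain ⟨hm, ⟨C, hC⟩⟩ := ha
  obtain ⟨hm', ⟨C', hC'⟩, R, hR⟩ := hb
  refine ⟨hm.smul hm', ⟨C * C', fun x => ?_⟩, R, fun x hx => by simp [hR x hx]⟩
  rw [norm_smul]
  exact mul_le_mul (hC x) (hC' x) (norm_nonneg _) ((norm_nonneg _).trans (hC x))

lemma Nice.inner {a b : E3 → E3} (ha : Nice a) (hb : BM b) : Nice (fun x => ⟪a x, b x⟫) := by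
  obtain ⟨hm, ⟨C, hC⟩, R, hR⟩ := ha
  obtain ⟨hm', ⟨C', hC'⟩⟩ := hb
  refine ⟨hm.inner hm', ⟨C * C', fun x => ?_⟩, R, fun x hx => by simp [hR x hx]⟩
  exact (norm_inner_le_norm _ _).trans
    (mul_le_mul (hC x) (hC' x) (norm_nonneg _) ((norm_nonneg _).trans (hC x)))

lemma Nice.norm {a : E3 → E3} (ha : Nice a) : Nice (fun x => ‖a x‖) := by
  obtain ⟨hm, ⟨C, hC⟩, R, hR⟩ := ha
  exact ⟨hm.norm, ⟨C, fun x => by rw [norm_norm]; exact hC x⟩, R, fun x hx => by simp [hR x hx]⟩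

lemma BM.norm {a : E3 → E3} (ha : BM a) : BM (fun x => ‖a x‖) := by
  obtain ⟨hm, ⟨C, hC⟩⟩ := ha
  exact ⟨hm.norm, ⟨C, fun x => by rw [norm_norm]; exact hC x⟩⟩

/-- Lipschitz functions vanishing off a ball. -/
def LC (v : E3 → ℝ) : Prop := Lip v ∧ ∃ R : ℝ, ∀ x, R < ‖x‖ → v x = 0

lemma LC.nice {v : E3 → ℝ} (h : LC v) : Nice v := by
  obtain ⟨hl, R, hR⟩ := h
  obtain ⟨C, hC⟩ := (isCompact_closedBall (0 : E3) R).exists_bound_of_continuousOn hl.cont.continuousOn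
  refine ⟨hl.cont.measurable, ⟨max C 0, fun x => ?_⟩, R, hR⟩
  by_cases hx : ‖x‖ ≤ R
  · exact (hC x (by simpa using hx)).trans (le_max_left _ _)
  · rw [hR x (not_le.1 hx)]; simp

lemma LC.grad_zero {v : E3 → ℝ} {R : ℝ} (h : ∀ x, R < ‖x‖ → v x = 0) {x : E3} (hx : R < ‖x‖) :
    gradient v x = 0 := by
  have : v =ᶠ[nhds x] fun _ => 0 := by
    have ho : IsOpen {y : E3 | R < ‖y‖} := isOpen_lt continuous_const continuous_norm
    filter_upwards [ho.mem_nhds hx] with y hy using h y hy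
  rw [this.gradient_eq, gradient_fun_const]

lemma Lip.grad_bm {v : E3 → ℝ} (h : Lip v) : BM (gradient v) := by
  obtain ⟨K, _, hK⟩ := h.grad_le
  exact ⟨grad_measurable v, K, hK⟩

lemma LC.grad {v : E3 → ℝ} (h : LC v) : Nice (gradient v) := by
  obtain ⟨hl, R, hR⟩ := h
  exact ⟨grad_measurable v, hl.grad_bm.2, R, fun x hx => LC.grad_zero hR hx⟩

lemma LC.cs {v : E3 → ℝ} (h : LC v) : HasCompactSupport v := by
  obtain ⟨hl, R, hR⟩ := h
  refine HasCompactSupport.intro (isCompact_closedBall (0 : E3) R) fun x hx => hR x ?_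
  simpa using hx

lemma LC.add {v w : E3 → ℝ} (hv : LC v) (hw : LC w) : LC (fun x => v x + w x) :=
  ⟨hv.1.add hw.1, (hv.nice.add hw.nice).2.2⟩

lemma LC.sub {v w : E3 → ℝ} (hv : LC v) (hw : LC w) : LC (fun x => v x - w x) :=
  ⟨hv.1.sub hw.1, (hv.nice.sub hw.nice).2.2⟩

lemma LC.const_mul {v : E3 → ℝ} (c : ℝ) (hv : LC v) : LC (fun x => c * v x) :=
  ⟨hv.1.const_mul c, by obtain ⟨R, hR⟩ := hv.2; exact ⟨R, fun x hx => by simp [hR x hx]⟩⟩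

lemma LC.sum {ι : Type*} {s : Finset ι} {v : ι → E3 → ℝ} (hv : ∀ i ∈ s, LC (v i)) :
    LC (fun x => ∑ i ∈ s, v i x) :=
  ⟨Lip.sum fun i hi => (hv i hi).1, (Nice.sum fun i hi => (hv i hi).nice).2.2⟩

lemma LC.mul {v w : E3 → ℝ} (hv : LC v) (hw : Lip w) (hb : ∃ B, ∀ x, |w x| ≤ B) :
    LC (fun x => v x * w x) := by
  obtain ⟨B, hB⟩ := hb
  obtain ⟨A, hA⟩ := hv.nice.2.1
  obtain ⟨R, hR⟩ := hv.2
  exact ⟨hv.1.mul_bdd hw hA hB, R, fun x hx => by simp [hR x hx]⟩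

lemma LC.bdd {v : E3 → ℝ} (hv : LC v) : ∃ B, ∀ x, |v x| ≤ B := hv.nice.2.1

lemma LC.trans {v : E3 → ℝ} (hv : LC v) (t : E3) : LC (fun x => v (x + t)) :=
  ⟨hv.1.comp_le _ fun x y => by simp, (hv.nice.trans t).2.2⟩

/-- Integration by parts. -/
lemma ibp {f g : E3 → ℝ} (hf : Lip f) (hg : LC g) (e : E3) :
    ∫ x, ⟪gradient f x, e⟫ * g x = - ∫ x, ⟪gradient g x, e⟫ * f x := by
  obtain ⟨K, hK⟩ := hf
  obtain ⟨L, hL⟩ := hg.1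
  have := hK.integral_lineDeriv_mul_eq (μ := volume) hL hg.cs e
  rw [← integral_neg]
  have h1 : ∫ x, ⟪gradient f x, e⟫ * g x = ∫ x, lineDeriv ℝ f x e * g x := by
    apply integral_congr_ae
    filter_upwards [hK.ae_differentiableAt] with x hx
    rw [grad_inner, hx.lineDeriv_eq_fderiv]
  rw [h1, this]
  apply integral_congr_ae
  filter_upwards [hL.ae_differentiableAt (μ := volume)] with x hx
  rw [grad_inner, hx.lineDeriv_eq_fderiv]; simp

lemma int_grad_zero {g : E3 → ℝ} (hg : LC g) (e : E3) : ∫ x, ⟪gradient g x, e⟫ = 0 := by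
  have := ibp (lip_const 1) hg e
  simp only [gradient_fun_const, inner_zero_left, zero_mul, integral_zero, mul_one] at this
  linarith

/-- The Dirichlet form. -/
def DD (v w : E3 → ℝ) : ℝ := ∫ x, ⟪gradient v x, gradient w x⟫

lemma LC.ii {v w : E3 → ℝ} (hv : LC v) (hw : Lip w) :
    Integrable (fun x => ⟪gradient v x, gradient w x⟫) := (hv.grad.inner hw.grad_bm).integrable

lemma DD_comm (v w : E3 → ℝ) : DD v w = DD w v := by
  unfold DD; congr 1; ext x; exact real_inner_comm _ _

lemma DD_self (v : E3 → ℝ) : DD v v = ∫ x, ‖gradient v x‖ ^ 2 := by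
  unfold DD; congr 1; ext x; exact real_inner_self_eq_norm_sq _

lemma DD_self_nonneg (v : E3 → ℝ) : 0 ≤ DD v v := by
  rw [DD_self]; exact integral_nonneg fun x => by positivity

lemma DD_add_right {u v w : E3 → ℝ} (hu : LC u) (hv : LC v) (hw : LC w) :
    DD u (fun x => v x + w x) = DD u v + DD u w := by
  unfold DD
  rw [← integral_add (hu.ii hv.1) (hu.ii hw.1)]
  apply integral_congr_ae
  filter_upwards [hv.1.ae, hw.1.ae] with x h1 h2
  rw [grad_add h1 h2, inner_add_right]

lemma DD_sub_right {u v w : E3 → ℝ} (hu : LC u) (hv : LC v) (hw : LC w) :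
    DD u (fun x => v x - w x) = DD u v - DD u w := by
  unfold DD
  rw [← integral_sub (hu.ii hv.1) (hu.ii hw.1)]
  apply integral_congr_ae
  filter_upwards [hv.1.ae, hw.1.ae] with x h1 h2
  rw [grad_sub h1 h2, inner_sub_right]

lemma DD_smul_right {u v : E3 → ℝ} (c : ℝ) (hv : LC v) :
    DD u (fun x => c * v x) = c * DD u v := by
  unfold DD
  rw [← integral_const_mul]
  apply integral_congr_ae
  filter_upwards [hv.1.ae] with x h1
  rw [grad_smul c h1, inner_smul_right]

/-- Poincare inequality. -/
lemma poincare {v : E3 → ℝ} (hv : LC v) {R : ℝ} (hR : ∀ x, R < ‖x‖ → v x = 0) :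
    ∫ x, v x ^ 2 ≤ 4 * R ^ 2 * DD v v := by
  set e : E3 := EuclideanSpace.single 0 1 with he
  have hen : ‖e‖ = 1 := by simp [e]
  have hvv : LC (fun x => v x * v x) := hv.mul hv.1 hv.bdd
  have key := ibp (lip_inner e) hvv e
  simp only [grad_inner_const, real_inner_self_eq_norm_sq, hen, one_pow, one_mul] at key
  have hle : - ∫ x, ⟪gradient (fun y => v y * v y) x, e⟫ * ⟪e, x⟫
      ≤ ∫ x, (1 / 2 * v x ^ 2 + 2 * R ^ 2 * ‖gradient v x‖ ^ 2) := by
    rw [← integral_neg]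
    have hI : Nice (fun x => 1 / 2 * v x ^ 2 + 2 * R ^ 2 * ‖gradient v x‖ ^ 2) :=
      (Nice.mul' (bm_const _) hv.nice.sq).add (Nice.mul' (bm_const _) hv.grad.norm.sq)
    have hpt : ∀ᵐ x : E3, |-(⟪gradient (fun y => v y * v y) x, e⟫ * ⟪e, x⟫)|
        ≤ 1 / 2 * v x ^ 2 + 2 * R ^ 2 * ‖gradient v x‖ ^ 2 := by
      filter_upwards [hv.1.ae] with x hx
      rw [grad_mul hx hx]
      by_cases hxR : R < ‖x‖
      · rw [hR x hxR]; simp; positivity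
      · push Not at hxR
        rw [← two_smul ℝ, inner_smul_left, inner_smul_left, abs_neg, abs_mul, abs_mul, abs_mul]
        have h1 : |⟪gradient v x, e⟫| ≤ ‖gradient v x‖ := by
          simpa [hen] using abs_real_inner_le_norm (gradient v x) e
        have h2 : |⟪e, x⟫| ≤ R := (by simpa [hen] using abs_real_inner_le_norm e x : |⟪e, x⟫| ≤ ‖x‖).trans hxR
        have h3 : |⟪gradient v x, e⟫| * |⟪e, x⟫| ≤ ‖gradient v x‖ * R :=
          mul_le_mul h1 h2 (abs_nonneg _) (norm_nonneg _)
        simp only [conj_trivial, abs_two]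
        have h4 := mul_le_mul_of_nonneg_left h3 (abs_nonneg (v x))
        rw [← sq_abs (v x)]
        nlinarith [sq_nonneg (|v x| - 2 * (‖gradient v x‖ * R))]
    refine integral_mono_ae ?_ hI.integrable ?_
    · refine Integrable.mono' hI.integrable ?_ hpt
      refine (Measurable.mul ?_ ?_).neg.aestronglyMeasurable
      · exact (grad_measurable _).inner measurable_const
      · exact (measurable_const.inner measurable_id)
    · filter_upwards [hpt] with x hx using (le_abs_self _).trans hx
  rw [integral_add (Nice.mul' (bm_const _) hv.nice.sq).integrable
    (Nice.mul' (bm_const _) hv.grad.norm.sq).integrable, integral_const_mul, integral_const_mul,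
    ← DD_self] at hle
  have : ∫ x, v x ^ 2 = ∫ x, v x * v x := by simp only [pow_two]
  linarith

/-- Squared difference quotient bound, nice weights. -/
lemma trans_sq {v : E3 → ℝ} (hv : Lip v) {W W' : E3 → ℝ} (hW : Nice W) (hW' : Nice W') (t : E3)
    (h0 : ∀ x, 0 ≤ W x) (h0' : ∀ x, 0 ≤ W' x)
    (hWW : ∀ x, ∀ s : ℝ, 0 ≤ s → s ≤ 1 → W (x - s • t) ≤ W' x) :
    ∫ x, W x * (v (x + t) - v x) ^ 2 ≤ ∫ x, W' x * ⟪gradient v x, t⟫ ^ 2 := by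
  obtain ⟨K, hK, hle⟩ := hv.le
  have hvm := hv.cont.measurable
  have hd : ∀ a b : E3, BM (fun x => v (x + a) - v (x + b)) := fun a b =>
    BM.of_bdd (K * ‖a - b‖) ((hvm.comp (measurable_add_const a)).sub (hvm.comp (measurable_add_const b)))
      fun x => by simpa using hle (x + a) (x + b)
  have hstep : ∀ n : ℕ, ∫ x, W x * (v (x + t) - v x) ^ 2
      ≤ ∫ x, W' x * (((n : ℝ) + 1) * (v (x + ((n : ℝ) + 1)⁻¹ • t) - v x)) ^ 2 := by
    intro n
    set N : ℝ := (n : ℝ) + 1 with hN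
    have hNpos : 0 < N := by positivity
    let p : ℕ → E3 := fun k => ((k : ℝ) / N) • t
    have h1 : ∀ x, W x * (v (x + t) - v x) ^ 2 ≤
        N * ∑ k ∈ Finset.range (n + 1), W x * (v (x + p (k + 1)) - v (x + p k)) ^ 2 := by
      intro x
      have ht : v (x + t) - v x = ∑ k ∈ Finset.range (n + 1), (v (x + p (k + 1)) - v (x + p k)) := by
        rw [Finset.sum_range_sub (fun k => v (x + p k))]
        have e1 : p (n + 1) = t := by
          simp only [p]; push_cast; rw [← hN, div_self hNpos.ne', one_smul]
        have e2 : p 0 = 0 := by simp [p]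
        rw [e1, e2, add_zero]
      have h2 := sq_sum_le_card_mul_sum_sq (s := Finset.range (n + 1))
        (f := fun k => v (x + p (k + 1)) - v (x + p k))
      rw [← ht, Finset.card_range] at h2
      rw [← Finset.mul_sum]
      push_cast at h2
      nlinarith [mul_le_mul_of_nonneg_left h2 (h0 x)]
    have hI : ∀ k, Nice (fun x => W x * (v (x + p (k + 1)) - v (x + p k)) ^ 2) := fun k =>
      hW.mul (hd _ _).sq
    have hd0 : ∀ a : E3, BM (fun x => v (x + a) - v x) := fun a => by simpa using hd a 0
    have hI' : Nice (fun x => W' x * (v (x + N⁻¹ • t) - v x) ^ 2) := hW'.mul (hd0 _).sq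
    have h3 : ∀ k ∈ Finset.range (n + 1), ∫ x, W x * (v (x + p (k + 1)) - v (x + p k)) ^ 2 ≤
        ∫ x, W' x * (v (x + N⁻¹ • t) - v x) ^ 2 := by
      intro k hk
      rw [← integral_add_right_eq_self (fun x => W x * (v (x + p (k + 1)) - v (x + p k)) ^ 2) (- p k)]
      refine integral_mono ((hI k).trans _).integrable hI'.integrable fun x => ?_
      have e1 : x + -p k + p (k + 1) = x + N⁻¹ • t := by
        simp only [p]; push_cast
        rw [add_assoc, ← neg_smul, ← add_smul]; congr 2; field_simp; ring
      have e2 : x + -p k + p k = x := by simp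
      simp only [e1, e2]
      refine mul_le_mul_of_nonneg_right ?_ (sq_nonneg _)
      have := hWW x ((k : ℝ) / N) (by positivity) (by
        rw [div_le_one hNpos, hN]
        have : k < n + 1 := Finset.mem_range.1 hk
        exact_mod_cast this.le)
      simpa [p, sub_eq_add_neg] using this
    calc ∫ x, W x * (v (x + t) - v x) ^ 2
        ≤ ∫ x, N * ∑ k ∈ Finset.range (n + 1), W x * (v (x + p (k + 1)) - v (x + p k)) ^ 2 :=
          integral_mono (hW.mul (hd0 _).sq).integrable
            (Nice.mul' (bm_const _) (Nice.sum fun k _ => hI k)).integrable h1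
      _ = N * ∑ k ∈ Finset.range (n + 1), ∫ x, W x * (v (x + p (k + 1)) - v (x + p k)) ^ 2 := by
          rw [integral_const_mul, integral_finsetSum _ fun k _ => (hI k).integrable]
      _ ≤ N * ∑ k ∈ Finset.range (n + 1), ∫ x, W' x * (v (x + N⁻¹ • t) - v x) ^ 2 :=
          mul_le_mul_of_nonneg_left (Finset.sum_le_sum h3) hNpos.le
      _ = ∫ x, W' x * (N * (v (x + N⁻¹ • t) - v x)) ^ 2 := by
          rw [Finset.sum_const, Finset.card_range, nsmul_eq_mul, ← integral_const_mul,
            ← integral_const_mul]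
          congr 1; ext x; push_cast; rw [← hN]; ring
  refine ge_of_tendsto' (x := Filter.atTop) ?_ hstep
  refine tendsto_integral_of_dominated_convergence (fun x => W' x * (K * ‖t‖) ^ 2) ?_ ?_ ?_ ?_
  · intro n
    have : Measurable (fun x => v (x + ((n : ℝ) + 1)⁻¹ • t)) := hvm.comp (measurable_add_const _)
    exact (hW'.1.mul ((measurable_const.mul (this.sub hvm)).pow_const 2)).aestronglyMeasurable
  · exact (hW'.mul (bm_const _)).integrable
  · intro n; refine Filter.Eventually.of_forall fun x => ?_
    rw [norm_mul, Real.norm_eq_abs, abs_of_nonneg (h0' x), norm_pow]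
    refine mul_le_mul_of_nonneg_left (pow_le_pow_left₀ (norm_nonneg _) ?_ 2) (h0' x)
    have := hle (x + ((n : ℝ) + 1)⁻¹ • t) x
    rw [add_sub_cancel_left, norm_smul, Real.norm_eq_abs,
      abs_of_nonneg (by positivity : (0 : ℝ) ≤ ((n : ℝ) + 1)⁻¹)] at this
    rw [Real.norm_eq_abs, abs_mul, abs_of_nonneg (by positivity : (0 : ℝ) ≤ (n : ℝ) + 1)]
    calc _ ≤ ((n : ℝ) + 1) * (K * (((n : ℝ) + 1)⁻¹ * ‖t‖)) := mul_le_mul_of_nonneg_left this (by positivity)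
      _ = K * ‖t‖ := by field_simp
  · filter_upwards [hv.ae] with x hx
    refine Filter.Tendsto.const_mul _ (Filter.Tendsto.pow ?_ 2)
    rw [grad_inner]
    have := hx.hasFDerivAt.lim t (c := fun n : ℕ => (n : ℝ) + 1) (l := Filter.atTop) (by
      simp only [Real.norm_eq_abs]
      refine Filter.tendsto_abs_atTop_atTop.comp ?_
      exact Filter.tendsto_atTop_add_const_right _ _ tendsto_natCast_atTop_atTop)
    simpa using this

/-- Squared difference quotient bound, compactly supported functions. -/
lemma trans_sq_LC {v : E3 → ℝ} (hv : LC v) {W W' : E3 → ℝ} (hW : BM W) (hW' : BM W') (t : E3)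
    (h0 : ∀ x, 0 ≤ W x) (h0' : ∀ x, 0 ≤ W' x)
    (hWW : ∀ x, ∀ s : ℝ, 0 ≤ s → s ≤ 1 → W (x - s • t) ≤ W' x) :
    ∫ x, W x * (v (x + t) - v x) ^ 2 ≤ ‖t‖ ^ 2 * ∫ x, W' x * ‖gradient v x‖ ^ 2 := by
  obtain ⟨R, hR⟩ := hv.2
  let χ : ℝ → E3 → ℝ := fun r => (closedBall (0 : E3) r).indicator (fun _ => 1)
  have hχ : ∀ r, Nice (χ r) := fun r => ⟨measurable_const.indicator measurableSet_closedBall,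
    ⟨1, fun x => by by_cases h : x ∈ closedBall (0 : E3) r <;> simp [χ, h]⟩, r, fun x hx => by
      have : x ∉ closedBall (0 : E3) r := by simpa using hx
      simp [χ, this]⟩
  have hχ0 : ∀ r x, 0 ≤ χ r x := fun r x => indicator_nonneg (fun _ _ => zero_le_one) x
  have hχ1 : ∀ r x, χ r x ≤ 1 := fun r x => by
    by_cases h : x ∈ closedBall (0 : E3) r <;> simp [χ, h]
  have h1 : ∫ x, W x * (v (x + t) - v x) ^ 2 =
      ∫ x, (χ (R + ‖t‖) x * W x) * (v (x + t) - v x) ^ 2 := by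
    congr 1; ext x
    by_cases h : x ∈ closedBall (0 : E3) (R + ‖t‖)
    · simp [χ, h]
    · have hx : R + ‖t‖ < ‖x‖ := by simpa using h
      have e1 := hR x (by linarith [norm_nonneg t])
      have e2 := hR (x + t) (by
        have := norm_sub_le (x + t) t
        rw [add_sub_cancel_right] at this; linarith)
      simp [e1, e2]
  rw [h1]
  refine (trans_sq hv.1 ((hχ (R + ‖t‖)).mul hW) ((hχ (R + ‖t‖ + ‖t‖)).mul hW') t
    (fun x => mul_nonneg (hχ0 _ _) (h0 _)) (fun x => mul_nonneg (hχ0 _ _) (h0' _)) ?_).trans ?_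
  · intro x s hs0 hs1
    by_cases h : x ∈ closedBall (0 : E3) (R + ‖t‖ + ‖t‖)
    · have : χ (R + ‖t‖ + ‖t‖) x = 1 := by simp [χ, h]
      rw [this, one_mul]
      exact (mul_le_of_le_one_left (h0 _) (hχ1 _ _)).trans (hWW x s hs0 hs1)
    · have hx : R + ‖t‖ + ‖t‖ < ‖x‖ := by simpa using h
      have : x - s • t ∉ closedBall (0 : E3) (R + ‖t‖) := by
        have h3 : ‖s • t‖ ≤ ‖t‖ := by
          rw [norm_smul, Real.norm_eq_abs, abs_of_nonneg hs0]
          exact mul_le_of_le_one_left (norm_nonneg _) hs1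
        have := norm_sub_norm_le x (s • t)
        simp; linarith
      have : χ (R + ‖t‖) (x - s • t) = 0 := by simp [χ, this]
      rw [this, zero_mul]; exact mul_nonneg (hχ0 _ _) (h0' _)
  · rw [← integral_const_mul]
    refine integral_mono (((hχ _).mul hW').mul
      ((hv.grad.inner (bm_const t)).bm.sq)).integrable
      (Nice.mul' (bm_const _) (Nice.mul' hW' hv.grad.norm.sq)).integrable fun x => ?_
    have h2 : ⟪gradient v x, t⟫ ^ 2 ≤ ‖t‖ ^ 2 * ‖gradient v x‖ ^ 2 := by
      rw [← mul_pow, mul_comm, ← sq_abs]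
      exact pow_le_pow_left₀ (abs_nonneg _) (abs_real_inner_le_norm _ _) 2
    have h3 : χ (R + ‖t‖ + ‖t‖) x * W' x ≤ W' x := mul_le_of_le_one_left (h0' _) (hχ1 _ _)
    calc _ ≤ W' x * (‖t‖ ^ 2 * ‖gradient v x‖ ^ 2) :=
          mul_le_mul h3 h2 (sq_nonneg _) (h0' _)
      _ = _ := by ring

/-! ### Functions vanishing off the domain -/

/-- Bounded open convex sets. -/
def Dom (Ω : Set E3) : Prop := IsOpen Ω ∧ Bornology.IsBounded Ω ∧ Convex ℝ Ω

/-- Lipschitz functions vanishing off `Ω`. -/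
def Lip0 (Ω : Set E3) (v : E3 → ℝ) : Prop := Lip v ∧ ∀ x, x ∉ Ω → v x = 0

lemma Dom.ball {Ω : Set E3} (h : Dom Ω) : ∃ R : ℝ, 0 < R ∧ ∀ x ∈ closure Ω, ‖x‖ ≤ R := by
  obtain ⟨R, hR⟩ := h.2.1.closure.subset_closedBall 0
  exact ⟨max R 1, by positivity, fun x hx => by
    have := hR hx; simp at this; exact this.trans (le_max_left _ _)⟩

lemma Lip0.lc {Ω : Set E3} (hΩ : Dom Ω) {v : E3 → ℝ} (h : Lip0 Ω v) : LC v := by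
  obtain ⟨R, _, hR⟩ := hΩ.ball
  exact ⟨h.1, R, fun x hx => h.2 x fun hx' => absurd (hR x (subset_closure hx')) (not_le.2 hx)⟩

lemma segment_frontier {Ω : Set E3} {x y : E3} (hx : x ∈ Ω) (hy : y ∉ Ω) :
    ∃ z ∈ frontier Ω, ‖x - z‖ ≤ ‖x - y‖ := by
  have h1 : IsPreconnected (segment ℝ x y) := (convex_segment x y).isPreconnected
  by_contra hcon
  push Not at hcon
  have hz : ∀ z ∈ segment ℝ x y, z ∉ frontier Ω := by
    intro z hz hzf
    refine absurd (hcon z hzf) (not_lt.2 ?_)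
    obtain ⟨a, b, ha, hb, hab, rfl⟩ := hz
    have : x - (a • x + b • y) = b • (x - y) := by
      have : a = 1 - b := by linarith
      subst this; module
    rw [this, norm_smul, Real.norm_eq_abs, abs_of_nonneg hb]
    exact mul_le_of_le_one_left (norm_nonneg _) (by linarith)
  have h2 := h1.subset_or_subset (u := interior Ω) (v := (closure Ω)ᶜ) isOpen_interior
    isClosed_closure.isOpen_compl ?_ ?_
  · rcases h2 with h | h
    · exact hy (interior_subset (h (right_mem_segment ℝ x y)))
    · exact h (left_mem_segment ℝ x y) (subset_closure hx)
  · exact disjoint_left.2 fun z hz1 hz2 => hz2 (subset_closure (interior_subset hz1))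
  · intro z hz'
    by_cases h : z ∈ interior Ω
    · exact Or.inl h
    · exact Or.inr fun hcl => hz z hz' ⟨hcl, h⟩

lemma lip0_ext {Ω : Set E3} {u : E3 → ℝ} {K : ℝ} (hK : 0 ≤ K)
    (hu : ∀ x ∈ closure Ω, ∀ y ∈ closure Ω, |u x - u y| ≤ K * ‖x - y‖)
    (h0 : ∀ x ∈ frontier Ω, u x = 0) : Lip0 Ω (Ω.indicator u) := by
  refine ⟨lip_of_le K ?_, fun x hx => indicator_of_notMem hx _⟩
  have key : ∀ x ∈ Ω, ∀ y ∉ Ω, |u x| ≤ K * ‖x - y‖ := by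
    intro x hx y hy
    obtain ⟨z, hz, hzn⟩ := segment_frontier hx hy
    have := hu x (subset_closure hx) z (frontier_subset_closure hz)
    rw [h0 z hz, sub_zero] at this
    exact this.trans (mul_le_mul_of_nonneg_left hzn hK)
  intro x y
  by_cases hx : x ∈ Ω <;> by_cases hy : y ∈ Ω
  · simp only [indicator_of_mem hx, indicator_of_mem hy]
    exact hu x (subset_closure hx) y (subset_closure hy)
  · simp only [indicator_of_mem hx, indicator_of_notMem hy, sub_zero]
    exact key x hx y hy
  · simp only [indicator_of_notMem hx, indicator_of_mem hy, zero_sub, abs_neg]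
    rw [norm_sub_rev]; exact key y hy x hx
  · simp only [indicator_of_notMem hx, indicator_of_notMem hy, sub_zero, abs_zero]
    positivity

lemma Lip0.mul_on {Ω : Set E3} (hΩ : Dom Ω) {v w : E3 → ℝ} (hv : Lip0 Ω v) {K : ℝ} (hK : 0 ≤ K)
    (hw : ∀ x ∈ closure Ω, ∀ y ∈ closure Ω, |w x - w y| ≤ K * ‖x - y‖) :
    Lip0 Ω (fun x => v x * w x) := by
  rcases Ω.eq_empty_or_nonempty with he | ⟨x0, hx0⟩
  · have : ∀ x, v x = 0 := fun x => hv.2 x (by simp [he])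
    simp only [this, zero_mul]; exact ⟨lip_const 0, fun _ _ => rfl⟩
  obtain ⟨R, hR0, hR⟩ := hΩ.ball
  have hB : ∀ x ∈ closure Ω, |w x| ≤ |w x0| + K * (2 * R) := by
    intro x hx
    have h1 := hw x hx x0 (subset_closure hx0)
    have h2 : ‖x - x0‖ ≤ 2 * R := (norm_sub_le _ _).trans (by
      linarith [hR x hx, hR x0 (subset_closure hx0)])
    have h3 : |w x| ≤ |w x0| + |w x - w x0| := by
      have := abs_add_le (w x0) (w x - w x0); simpa using this
    nlinarith
  obtain ⟨A, hA⟩ := (hv.lc hΩ).bdd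
  obtain ⟨L, hL0, hL⟩ := hv.1.le
  have hA0 : 0 ≤ A := (abs_nonneg _).trans (hA 0)
  set B := |w x0| + K * (2 * R)
  have hB0 : 0 ≤ B := by positivity
  have := lip0_ext (Ω := Ω) (u := fun x => v x * w x) (K := A * K + L * B) (by positivity) ?_ ?_
  · convert this using 1
    ext x
    by_cases hx : x ∈ Ω
    · simp [hx]
    · simp [hx, hv.2 x hx]
  · intro x hx y hy
    have e : v x * w x - v y * w y = v x * (w x - w y) + (v x - v y) * w y := by ring
    rw [e]
    refine (abs_add_le _ _).trans ?_
    rw [abs_mul, abs_mul]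
    have h1 := mul_le_mul (hA x) (hw x hx y hy) (abs_nonneg _) hA0
    have h2 := mul_le_mul (hL x y) (hB y hy) (abs_nonneg _) (by positivity)
    nlinarith
  · intro x hx
    have : x ∉ Ω := fun h => by
      rw [hΩ.1.frontier_eq] at hx; exact hx.2 h
    simp [hv.2 x this]

lemma Lip0.add {Ω : Set E3} {v w : E3 → ℝ} (hv : Lip0 Ω v) (hw : Lip0 Ω w) :
    Lip0 Ω (fun x => v x + w x) :=
  ⟨hv.1.add hw.1, fun x hx => by simp [hv.2 x hx, hw.2 x hx]⟩

lemma Lip0.sub {Ω : Set E3} {v w : E3 → ℝ} (hv : Lip0 Ω v) (hw : Lip0 Ω w) :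
    Lip0 Ω (fun x => v x - w x) :=
  ⟨hv.1.sub hw.1, fun x hx => by simp [hv.2 x hx, hw.2 x hx]⟩

lemma Lip0.const_mul {Ω : Set E3} {v : E3 → ℝ} (c : ℝ) (hv : Lip0 Ω v) :
    Lip0 Ω (fun x => c * v x) :=
  ⟨hv.1.const_mul c, fun x hx => by simp [hv.2 x hx]⟩

lemma Dom.ae_frontier {Ω : Set E3} (h : Dom Ω) : ∀ᵐ x : E3, x ∉ frontier Ω := by
  have := h.2.2.addHaar_frontier volume
  exact measure_eq_zero_iff_ae_notMem.1 this

lemma grad_zero_off {Ω : Set E3} {v : E3 → ℝ} (hv : ∀ x, x ∉ Ω → v x = 0) {x : E3}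
    (hx : x ∉ closure Ω) : gradient v x = 0 := by
  have : v =ᶠ[nhds x] fun _ => 0 := by
    filter_upwards [isClosed_closure.isOpen_compl.mem_nhds hx] with y hy
    exact hv y fun h => hy (subset_closure h)
  rw [this.gradient_eq, gradient_fun_const]

lemma Dom.ae_grad {Ω : Set E3} (h : Dom Ω) {v : E3 → ℝ} (hv : ∀ x, x ∉ Ω → v x = 0) :
    ∀ᵐ x : E3, x ∉ Ω → gradient v x = 0 := by
  filter_upwards [h.ae_frontier] with x hx hxΩ
  apply grad_zero_off hv
  intro hcl
  exact hx (by rw [h.1.frontier_eq]; exact ⟨hcl, hxΩ⟩)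

lemma Dom.meas {Ω : Set E3} (h : Dom Ω) : MeasurableSet Ω := h.1.measurableSet

lemma setint_eq {Ω : Set E3} (hm : MeasurableSet Ω) {a : E3 → ℝ} (ha : ∀ᵐ x : E3, x ∉ Ω → a x = 0) :
    ∫ x in Ω, a x = ∫ x, a x := by
  rw [← integral_indicator hm]
  apply integral_congr_ae
  filter_upwards [ha] with x hx
  by_cases h : x ∈ Ω
  · simp [h]
  · simp [h, hx h]

lemma Dom.DD_eq {Ω : Set E3} (h : Dom Ω) {v w : E3 → ℝ} (hv : ∀ x, x ∉ Ω → v x = 0) :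
    DD v w = ∫ x in Ω, ⟪gradient v x, gradient w x⟫ := by
  rw [setint_eq h.meas]; rfl
  filter_upwards [h.ae_grad hv] with x hx hxΩ
  rw [hx hxΩ, inner_zero_left]

/-- Approximate solutions in a linear class of functions. -/
lemma approx_sol (V : (E3 → ℝ) → Prop) {R : ℝ} (hR : 0 < R)
    (hV : ∀ v, V v → Lip v ∧ ∀ x, R < ‖x‖ → v x = 0) (h0 : V (fun _ => 0))
    (hadd : ∀ v w s, V v → V w → V (fun x => v x + s * w x)) {f : E3 → ℝ} (hf : Nice f)
    {ε : ℝ} (hε : 0 < ε) :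
    ∃ φ, V φ ∧ DD φ φ ≤ 16 * R ^ 2 * (∫ x, f x ^ 2) + 8 * ε ^ 2 ∧
      ∀ χ, V χ → |DD φ χ - ∫ x, f x * χ x| ≤ ε * (1 + DD χ χ) := by
  have hLC : ∀ v, V v → LC v := fun v hv => ⟨(hV v hv).1, R, (hV v hv).2⟩
  set F := ∫ x, f x ^ 2 with hF
  have hF0 : 0 ≤ F := integral_nonneg fun x => by positivity
  let J : (E3 → ℝ) → ℝ := fun v => 1 / 2 * DD v v - ∫ x, f x * v x
  have hJ : ∀ v, V v → DD v v / 4 - 4 * R ^ 2 * F ≤ J v := by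
    intro v hv
    have hv' := hLC v hv
    have hp := poincare hv' (hV v hv).2
    have : ∫ x, f x * v x ≤ ∫ x, (4 * R ^ 2 * f x ^ 2 + (1 / (16 * R ^ 2)) * v x ^ 2) := by
      refine integral_mono (hf.mul hv'.nice.bm).integrable
        ((Nice.mul' (bm_const _) hf.sq).add (Nice.mul' (bm_const _) hv'.nice.sq)).integrable fun x => ?_
      have : 0 ≤ (2 * R * f x - 1 / (4 * R) * v x) ^ 2 := sq_nonneg _
      have e : (2 * R * f x - 1 / (4 * R) * v x) ^ 2 =
        4 * R ^ 2 * f x ^ 2 + 1 / (16 * R ^ 2) * v x ^ 2 - f x * v x := by field_simp; ring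
      simp only; linarith
    rw [integral_add (Nice.mul' (bm_const _) hf.sq).integrable
      (Nice.mul' (bm_const _) hv'.nice.sq).integrable, integral_const_mul, integral_const_mul] at this
    have h2 : 1 / (16 * R ^ 2) * ∫ x, v x ^ 2 ≤ DD v v / 4 := by
      calc _ ≤ 1 / (16 * R ^ 2) * (4 * R ^ 2 * DD v v) := mul_le_mul_of_nonneg_left hp (by positivity)
        _ = _ := by field_simp; ring
    simp only [J]; linarith
  let S : Set ℝ := {y | ∃ v, V v ∧ J v = y}
  have hSb : BddBelow S := ⟨-(4 * R ^ 2 * F), by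
    rintro y ⟨v, hv, rfl⟩; have := hJ v hv; have := DD_self_nonneg v; linarith⟩
  have hJ0 : J (fun _ => 0) = 0 := by simp [J, DD, gradient_fun_const]
  have hSn : S.Nonempty := ⟨_, _, h0, rfl⟩
  obtain ⟨y, ⟨φ, hφ, rfl⟩, hy⟩ := exists_lt_of_csInf_lt hSn
    (show sInf S < sInf S + 2 * ε ^ 2 by have : 0 < ε ^ 2 := by positivity
                                         linarith)
  have hφ' := hLC φ hφ
  have hinf : sInf S ≤ 0 := hJ0 ▸ csInf_le hSb ⟨_, h0, rfl⟩
  refine ⟨φ, hφ, ?_, ?_⟩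
  · have := hJ φ hφ; nlinarith
  · intro χ hχ
    have hχ' := hLC χ hχ
    have hexp : ∀ s : ℝ, J (fun x => φ x + s * χ x) =
        J φ + s * (DD φ χ - ∫ x, f x * χ x) + s ^ 2 / 2 * DD χ χ := by
      intro s
      have hs := hχ'.const_mul s
      have e1 : DD (fun x => φ x + s * χ x) (fun x => φ x + s * χ x)
          = DD φ φ + 2 * s * DD φ χ + s ^ 2 * DD χ χ := by
        rw [DD_add_right (hφ'.add hs) hφ' hs, DD_comm _ φ, DD_add_right hφ' hφ' hs,
          DD_smul_right s hχ', DD_comm _ (fun x => s * χ x), DD_add_right hs hφ' hs,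
          DD_smul_right s hχ', DD_comm (fun x => s * χ x) φ, DD_comm (fun x => s * χ x) χ,
          DD_smul_right s hχ', DD_smul_right s hχ']
        ring
      have e2 : ∫ x, f x * (φ x + s * χ x) = (∫ x, f x * φ x) + s * ∫ x, f x * χ x := by
        rw [← integral_const_mul, ← integral_add (hf.mul hφ'.nice.bm).integrable
          (Nice.mul' (bm_const s) (hf.mul hχ'.nice.bm)).integrable]
        congr 1; ext x; ring
      simp only [J]; rw [e1, e2]; ring
    have hs : ∀ s : ℝ, -(2 * ε ^ 2) ≤ s * (DD φ χ - ∫ x, f x * χ x) + s ^ 2 / 2 * DD χ χ := by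
      intro s
      have h1 := csInf_le hSb ⟨_, hadd φ χ s hφ hχ, rfl⟩
      rw [hexp s] at h1
      linarith
    have h1 := hs (2 * ε)
    have h2 := hs (-(2 * ε))
    rw [abs_le]
    constructor
    · by_contra hcon; push Not at hcon; nlinarith
    · by_contra hcon; push Not at hcon; nlinarith

/-! ### Half-space representation -/

/-- Half-space representation of a polyhedron with unit inner normals. -/
def HRep (Ω : Set E3) {N : ℕ} (n : Fin N → E3) (a : Fin N → ℝ) : Prop :=
  (∀ i, ‖n i‖ = 1) ∧ Function.Injective n ∧ Ω = {x | ∀ i, 0 < ⟪n i, x⟫ + a i}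

lemma exists_hrep {Ω : Set E3} (hΩ : IsConvexPolyhedron Ω) (hne : Ω.Nonempty) :
    ∃ (N : ℕ) (n : Fin N → E3) (a : Fin N → ℝ), HRep Ω n a := by
  obtain ⟨hO, -, -, S, hS⟩ := hΩ
  obtain ⟨x0, hx0⟩ := hne
  set K : Set E3 := convexHull ℝ (S : Set E3) with hK
  have hKc : IsCompact K := S.finite_toSet.isCompact_convexHull (𝕜 := ℝ)
  have hΩK : Ω ⊆ K := hS ▸ interior_subset
  obtain ⟨ρ, hρ, hball⟩ := Metric.isOpen_iff.1 hO x0 hx0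
  let Q : Set E3 := {y | ∀ s ∈ S, ⟪y, s - x0⟫ ≤ 1}
  have hQK : ∀ y ∈ Q, ∀ x ∈ K, ⟪y, x - x0⟫ ≤ 1 := by
    intro y hy x hx
    have hc : Convex ℝ {x : E3 | ⟪y, x⟫ ≤ 1 + ⟪y, x0⟫} :=
      convex_halfSpace_le (innerSL ℝ y).isLinear _
    have : K ⊆ {x : E3 | ⟪y, x⟫ ≤ 1 + ⟪y, x0⟫} := convexHull_min (fun s hs => by
      have := hy s hs; rw [inner_sub_right] at this; simp only [mem_ofPred_eq]; linarith) hc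
    have := this hx
    rw [inner_sub_right]; simp only [mem_ofPred_eq] at this; linarith
  have hQb : ∀ y ∈ Q, ‖y‖ ≤ 2 / ρ := by
    intro y hy
    by_cases hy0 : y = 0
    · subst hy0; simp; positivity
    have hyn : 0 < ‖y‖ := norm_pos_iff.2 hy0
    have : x0 + (ρ / 2 / ‖y‖) • y ∈ K := hΩK (hball (by
      rw [mem_ball, dist_eq_norm, add_sub_cancel_left, norm_smul, Real.norm_eq_abs,
        abs_of_pos (by positivity)]
      field_simp; linarith))
    have h := hQK y hy _ this
    rw [add_sub_cancel_left, inner_smul_right, real_inner_self_eq_norm_sq] at h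
    rw [le_div_iff₀ hρ]
    have e : ρ / 2 / ‖y‖ * ‖y‖ ^ 2 = ρ * ‖y‖ / 2 := by field_simp
    rw [e] at h; linarith
  have hQconv : Convex ℝ Q := by
    intro y hy z hz s t hs ht hst p hp
    have h1 := hy p hp; have h2 := hz p hp
    rw [inner_add_left, inner_smul_left, inner_smul_left]
    simp only [conj_trivial]; nlinarith
  have hQcl : IsClosed Q := by
    have : Q = ⋂ s ∈ S, {y | ⟪y, s - x0⟫ ≤ 1} := by ext y; simp [Q]
    rw [this]
    exact isClosed_biInter fun s _ => isClosed_le (by fun_prop) continuous_const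
  have hQc : IsCompact Q := by
    refine Metric.isCompact_of_isClosed_isBounded hQcl ?_
    exact (isBounded_closedBall (x := (0 : E3)) (r := 2 / ρ)).subset fun y hy => by
      simpa using hQb y hy
  have h0Q : (0 : E3) ∈ Q := fun s _ => by simp
  have hmem : ∀ x, (∀ y ∈ Q, ⟪y, x - x0⟫ ≤ 1) → x ∈ K := by
    intro x hx
    by_contra hxK
    obtain ⟨f, u, hf1, hf2⟩ := geometric_hahn_banach_closed_point (convex_convexHull ℝ (S : Set E3))
      hKc.isClosed hxK
    set w := (InnerProductSpace.toDual ℝ E3).symm f with hw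
    have hfw : ∀ z, f z = ⟪w, z⟫ := fun z => by
      rw [hw]; exact (InnerProductSpace.toDual_symm_apply (y := f)).symm
    have hx0' : f x0 < u := hf1 x0 (hΩK hx0)
    have hb : 0 < u - f x0 := by linarith
    have := hx ((u - f x0)⁻¹ • w) (fun s hs => by
      rw [inner_smul_left, inner_sub_right, ← hfw, ← hfw]
      have := hf1 s (subset_convexHull ℝ _ hs)
      simp only [conj_trivial]
      rw [inv_mul_le_one₀ hb]; linarith)
    rw [inner_smul_left, inner_sub_right, ← hfw, ← hfw] at this
    simp only [conj_trivial] at this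
    rw [inv_mul_le_one₀ hb] at this
    linarith
  -- extreme points
  let E : Set E3 := Q.extremePoints ℝ
  have hEfin : E.Finite := by
    classical
    let A : E3 → Finset E3 := fun y => S.filter fun s => ⟪y, s - x0⟫ = 1
    refine Set.Finite.of_finite_image (f := A) ((S.powerset.finite_toSet).subset ?_) ?_
    · rintro _ ⟨y, _, rfl⟩; exact Finset.mem_coe.2 (Finset.mem_powerset.2 (Finset.filter_subset _ _))
    · intro y hy z hz hyz
      by_contra hne
      have hyQ : y ∈ Q := hy.1
      have : ∃ δ : ℝ, 0 < δ ∧ y + δ • (y - z) ∈ Q ∧ y - δ • (y - z) ∈ Q := by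
        have hpos : ∀ s ∈ S, ∃ δ : ℝ, 0 < δ ∧ ∀ δ', 0 ≤ δ' → δ' ≤ δ →
            ⟪y, s - x0⟫ + δ' * ⟪y - z, s - x0⟫ ≤ 1 ∧ ⟪y, s - x0⟫ - δ' * ⟪y - z, s - x0⟫ ≤ 1 := by
          intro s hs
          by_cases h : ⟪y, s - x0⟫ = 1
          · have : s ∈ A z := by rw [← hyz]; simp [A, hs, h]
            have hz1 : ⟪z, s - x0⟫ = 1 := (Finset.mem_filter.1 this).2
            refine ⟨1, one_pos, fun δ' _ _ => ?_⟩
            rw [inner_sub_left, h, hz1]; simp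
          · have hlt : ⟪y, s - x0⟫ < 1 := lt_of_le_of_ne (hyQ s hs) h
            set m := ⟪y - z, s - x0⟫
            refine ⟨(1 - ⟪y, s - x0⟫) / (|m| + 1), by
              apply div_pos (by linarith); positivity, fun δ' h0 hle => ?_⟩
            rw [le_div_iff₀ (by positivity)] at hle
            have h1 := mul_le_mul_of_nonneg_left (le_abs_self m) h0
            have h2 := mul_le_mul_of_nonneg_left (neg_abs_le m) h0
            constructor <;> nlinarith
        choose! δ hδ hδ' using hpos
        rcases S.eq_empty_or_nonempty with he | hne'
        · refine ⟨1, one_pos, ?_, ?_⟩ <;> intro s hs <;> simp [he] at hs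
        obtain ⟨s0, hs0, hmin⟩ := S.exists_min_image δ hne'
        refine ⟨δ s0, hδ s0 hs0, fun s hs => ?_, fun s hs => ?_⟩
        · have := (hδ' s hs (δ s0) (hδ s0 hs0).le (hmin s hs)).1
          rwa [inner_add_left, inner_smul_left]
        · have := (hδ' s hs (δ s0) (hδ s0 hs0).le (hmin s hs)).2
          rwa [inner_sub_left, inner_smul_left]
      obtain ⟨δ, hδ, h1, h2⟩ := this
      have h3 := hy.2 h1 h2 ⟨1 / 2, 1 / 2, by norm_num, by norm_num, by norm_num, by module⟩
      have h4 : δ • (y - z) = 0 := by simpa using h3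
      rcases smul_eq_zero.1 h4 with h5 | h5
      · exact hδ.ne' h5
      · exact hne (sub_eq_zero.1 h5)
  have hKM : ∀ x, (∀ y ∈ E, ⟪y, x - x0⟫ ≤ 1) → x ∈ K := by
    intro x hx
    apply hmem
    intro y hy
    have hc : Convex ℝ {y : E3 | ⟪y, x - x0⟫ ≤ 1} := by
      intro p hp q hq s t hs ht hst
      simp only [mem_ofPred_eq] at hp hq ⊢
      rw [inner_add_left, inner_smul_left, inner_smul_left]
      simp only [conj_trivial]; nlinarith
    have hcl : IsClosed {y : E3 | ⟪y, x - x0⟫ ≤ 1} := isClosed_le (by fun_prop) continuous_const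
    have : closure (convexHull ℝ E) ⊆ {y : E3 | ⟪y, x - x0⟫ ≤ 1} :=
      closure_minimal (convexHull_min hx hc) hcl
    rw [closure_convexHull_extremePoints hQc hQconv] at this
    exact this hy
  have hE'fin : (E \ {0}).Finite := hEfin.subset sdiff_subset
  let L := hE'fin.toFinset
  let eqv := L.equivFin
  let y : Fin L.card → E3 := fun i => (eqv.symm i : E3)
  have hyE : ∀ i, y i ∈ E ∧ y i ≠ 0 := fun i => by
    have := (eqv.symm i).2
    simp only [L, Set.Finite.mem_toFinset] at this
    exact ⟨this.1, this.2⟩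
  have hyn : ∀ i, 0 < ‖y i‖ := fun i => norm_pos_iff.2 (hyE i).2
  have hycov : ∀ z ∈ E, z ≠ 0 → ∃ i, y i = z := fun z hz hz0 =>
    ⟨eqv ⟨z, by simp [L, hz, hz0]⟩, by simp [y]⟩
  have hyinj : Function.Injective y := fun i j hij => by
    exact eqv.symm.injective (Subtype.ext hij)
  refine ⟨L.card, fun i => -(‖y i‖⁻¹ • y i), fun i => ‖y i‖⁻¹ * (1 + ⟪y i, x0⟫), ?_, ?_, ?_⟩
  · intro i; rw [norm_neg, norm_smul, norm_inv, norm_norm, inv_mul_cancel₀ (hyn i).ne']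
  · intro i j hij
    simp only [neg_inj] at hij
    have key : ∀ i j, ‖y i‖⁻¹ • y i = ‖y j‖⁻¹ • y j → ‖y i‖ < ‖y j‖ → False := by
      intro i j hij hlt
      have e : y i = (‖y i‖ / ‖y j‖) • y j := by
        rw [div_eq_mul_inv, mul_smul, ← hij, smul_smul, mul_inv_cancel₀ (hyn i).ne', one_smul]
      have h1 : ‖y i‖ / ‖y j‖ < 1 := (div_lt_one (hyn j)).2 hlt
      have h2 : 0 < ‖y i‖ / ‖y j‖ := div_pos (hyn i) (hyn j)
      have := (hyE i).1.2 h0Q (hyE j).1.1 ⟨1 - ‖y i‖ / ‖y j‖, ‖y i‖ / ‖y j‖, by linarith, h2, by ring,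
        by rw [smul_zero, zero_add, ← e]⟩
      exact (hyE i).2 this.symm
    rcases lt_trichotomy ‖y i‖ ‖y j‖ with h | h | h
    · exact (key i j hij h).elim
    · rw [h] at hij
      exact hyinj (smul_right_injective _ (inv_ne_zero (hyn j).ne') hij)
    · exact (key j i hij.symm h).elim
  · have hiff : ∀ x i, 0 < ⟪-(‖y i‖⁻¹ • y i), x⟫ + ‖y i‖⁻¹ * (1 + ⟪y i, x0⟫) ↔ ⟪y i, x - x0⟫ < 1 := by
      intro x i
      have e : ⟪-(‖y i‖⁻¹ • y i), x⟫ + ‖y i‖⁻¹ * (1 + ⟪y i, x0⟫) = ‖y i‖⁻¹ * (1 - ⟪y i, x - x0⟫) := by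
        rw [inner_neg_left, inner_smul_left, inner_sub_right]; simp only [conj_trivial]; ring
      rw [e]
      have := inv_pos.2 (hyn i)
      constructor
      · intro h; have := pos_of_mul_pos_right h this.le; linarith
      · intro h; exact mul_pos this (by linarith)
    have hset : {x : E3 | ∀ i, 0 < ⟪-(‖y i‖⁻¹ • y i), x⟫ + ‖y i‖⁻¹ * (1 + ⟪y i, x0⟫)} =
        {x : E3 | ∀ i, ⟪y i, x - x0⟫ < 1} := by
      ext x; simp only [mem_ofPred_eq, hiff]
    rw [hset]
    apply Subset.antisymm
    · intro x hx i
      obtain ⟨r, hr, hrb⟩ := Metric.isOpen_iff.1 hO x hx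
      have : x + (r / 2 / ‖y i‖) • y i ∈ K := hΩK (hrb (by
        have := hyn i
        rw [mem_ball, dist_eq_norm, add_sub_cancel_left, norm_smul, Real.norm_eq_abs,
          abs_of_pos (by positivity)]
        field_simp; linarith))
      have h := hQK _ (hyE i).1.1 _ this
      have e : x + (r / 2 / ‖y i‖) • y i - x0 = (x - x0) + (r / 2 / ‖y i‖) • y i := by abel
      rw [e, inner_add_right, inner_smul_right, real_inner_self_eq_norm_sq] at h
      have : 0 < r / 2 / ‖y i‖ * ‖y i‖ ^ 2 := by have := hyn i; positivity
      linarith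
    · rw [hS]
      refine interior_maximal ?_ ?_
      · intro x hx
        apply hKM
        intro z hz
        by_cases hz0 : z = 0
        · subst hz0; simp
        · obtain ⟨i, rfl⟩ := hycov z hz hz0
          exact (hx i).le
      · have : {x : E3 | ∀ i, ⟪y i, x - x0⟫ < 1} = ⋂ i, {x | ⟪y i, x - x0⟫ < 1} := by ext; simp
        rw [this]
        exact isOpen_iInter_of_finite fun i => isOpen_lt (by fun_prop) continuous_const

/-! ### Geometry of the polyhedron -/

/-- A polyhedral domain with chosen half-space representation. -/
structure Geo (Ω : Set E3) where
  N : ℕ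
  n : Fin N → E3
  a : Fin N → ℝ
  two : 2 ≤ N
  dom : Dom Ω
  ne : Ω.Nonempty
  rep : HRep Ω n a

lemma exists_geo {Ω : Set E3} (hΩ : IsConvexPolyhedron Ω) (hne : Ω.Nonempty) : Nonempty (Geo Ω) := by
  obtain ⟨N, n, a, h⟩ := exists_hrep hΩ hne
  have hdom : Dom Ω := ⟨hΩ.1, hΩ.2.1, hΩ.2.2.1⟩
  refine ⟨⟨N, n, a, ?_, hdom, hne, h⟩⟩
  by_contra hN
  push Not at hN
  obtain ⟨x0, hx0⟩ := hne
  obtain ⟨w, hw, hwi⟩ : ∃ w : E3, ‖w‖ = 1 ∧ ∀ i, 0 ≤ ⟪n i, w⟫ := by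
    rcases Nat.eq_zero_or_pos N with h0 | h0
    · subst h0
      exact ⟨EuclideanSpace.single 0 1, by simp, fun i => i.elim0⟩
    · refine ⟨n ⟨0, h0⟩, h.1 _, fun i => ?_⟩
      have : i = ⟨0, h0⟩ := by ext; have := i.2; simp; omega
      rw [this]; exact real_inner_self_nonneg
  obtain ⟨R, hR0, hR⟩ := hdom.ball
  have hmem : x0 + (2 * R + 1) • w ∈ Ω := by
    rw [h.2.2] at hx0 ⊢
    intro i
    have := hx0 i
    rw [inner_add_right, inner_smul_right]
    have := mul_nonneg (by linarith : (0 : ℝ) ≤ 2 * R + 1) (hwi i)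
    linarith
  have h1 := hR _ (subset_closure hmem)
  have h2 := hR _ (subset_closure hx0)
  have h3 : ‖(2 * R + 1) • w‖ ≤ ‖x0 + (2 * R + 1) • w‖ + ‖x0‖ := by
    have := norm_sub_le (x0 + (2 * R + 1) • w) x0
    simpa using this
  rw [norm_smul, hw, Real.norm_eq_abs, abs_of_pos (by linarith)] at h3
  linarith

namespace Geo
variable {Ω : Set E3} (G : Geo Ω)

/-- The affine defining functions. -/
def l (i : Fin G.N) (x : E3) : ℝ := ⟪G.n i, x⟫ + G.a i

/-- Pairs of distinct faces. -/
abbrev Pr : Type := {p : Fin G.N × Fin G.N // p.1 ≠ p.2}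

/-- Signed distance-like function. -/
def d (x : E3) : ℝ := ⨅ i, G.l i x

/-- Distance to edges-like function. -/
def q (x : E3) : ℝ := ⨅ p : G.Pr, (G.l p.1.1 x + G.l p.1.2 x)

/-- The weight. -/
def P (h : ℝ) (x : E3) : ℝ := |G.q x| + |G.d x| + h

instance : Nonempty (Fin G.N) := ⟨⟨0, by have := G.two; omega⟩⟩
instance : Nonempty G.Pr := ⟨⟨(⟨0, by have := G.two; omega⟩, ⟨1, by have := G.two; omega⟩), by simp⟩⟩

lemma l_lip (i : Fin G.N) (x y : E3) : |G.l i x - G.l i y| ≤ ‖x - y‖ := by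
  have : G.l i x - G.l i y = ⟪G.n i, x - y⟫ := by simp [l, inner_sub_right]
  rw [this]
  simpa [G.rep.1 i] using abs_real_inner_le_norm (G.n i) (x - y)

lemma l_add (i : Fin G.N) (x t : E3) : G.l i (x + t) = G.l i x + ⟪G.n i, t⟫ := by
  simp [l, inner_add_right]; ring

lemma d_le (i : Fin G.N) (x : E3) : G.d x ≤ G.l i x :=
  ciInf_le (Set.finite_range _).bddBelow i

lemma d_ex (x : E3) : ∃ i, G.l i x = G.d x := exists_eq_ciInf_of_finite

lemma q_le {i j : Fin G.N} (hij : i ≠ j) (x : E3) : G.q x ≤ G.l i x + G.l j x :=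
  ciInf_le (f := fun p : G.Pr => G.l p.1.1 x + G.l p.1.2 x) (Set.finite_range _).bddBelow ⟨(i, j), hij⟩

lemma q_ex (x : E3) : ∃ p : G.Pr, G.l p.1.1 x + G.l p.1.2 x = G.q x := exists_eq_ciInf_of_finite

lemma d_lip (x y : E3) : |G.d x - G.d y| ≤ ‖x - y‖ := by
  have key : ∀ x y, G.d x - G.d y ≤ ‖x - y‖ := fun x y => by
    obtain ⟨i, hi⟩ := G.d_ex y
    have := G.d_le i x
    have := (abs_le.1 (G.l_lip i x y)).2
    linarith
  rw [abs_le]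
  have := key y x
  rw [norm_sub_rev] at this
  exact ⟨by linarith, key x y⟩

lemma q_lip (x y : E3) : |G.q x - G.q y| ≤ 2 * ‖x - y‖ := by
  have key : ∀ x y, G.q x - G.q y ≤ 2 * ‖x - y‖ := fun x y => by
    obtain ⟨p, hp⟩ := G.q_ex y
    have := G.q_le p.2 x
    have := (abs_le.1 (G.l_lip p.1.1 x y)).2
    have := (abs_le.1 (G.l_lip p.1.2 x y)).2
    linarith
  rw [abs_le]
  have := key y x
  rw [norm_sub_rev] at this
  exact ⟨by linarith, key x y⟩

lemma two_d_le (x : E3) : 2 * G.d x ≤ G.q x := by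
  obtain ⟨p, hp⟩ := G.q_ex x
  have := G.d_le p.1.1 x
  have := G.d_le p.1.2 x
  linarith

lemma mem_iff {x : E3} : x ∈ Ω ↔ 0 < G.d x := by
  have h : x ∈ Ω ↔ ∀ i, 0 < G.l i x := by
    have := G.rep.2.2
    constructor
    · intro hx; rw [this] at hx; exact hx
    · intro hx; rw [this]; exact hx
  rw [h]
  constructor
  · intro hx; obtain ⟨i, hi⟩ := G.d_ex x; rw [← hi]; exact hx i
  · intro hx i; exact hx.trans_le (G.d_le i x)

lemma d_cont : Continuous G.d := (lip_of_le 1 fun x y => by rw [one_mul]; exact G.d_lip x y).cont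

lemma q_cont : Continuous G.q := (lip_of_le 2 fun x y => G.q_lip x y).cont

lemma closure_d {x : E3} (hx : x ∈ closure Ω) : 0 ≤ G.d x := by
  have hcl : IsClosed {x | 0 ≤ G.d x} := isClosed_le continuous_const G.d_cont
  exact closure_minimal (fun y hy => (G.mem_iff.1 hy).le) hcl hx

lemma frontier_d {x : E3} (hx : x ∈ frontier Ω) : G.d x = 0 := by
  rw [G.dom.1.frontier_eq] at hx
  exact le_antisymm (not_lt.1 fun h => hx.2 (G.mem_iff.2 h)) (G.closure_d hx.1)

lemma P_lip (h : ℝ) (x y : E3) : |G.P h x - G.P h y| ≤ 3 * ‖x - y‖ := by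
  have h1 := (abs_abs_sub_abs_le_abs_sub (G.q x) (G.q y)).trans (G.q_lip x y)
  have h2 := (abs_abs_sub_abs_le_abs_sub (G.d x) (G.d y)).trans (G.d_lip x y)
  have e : G.P h x - G.P h y = (|G.q x| - |G.q y|) + (|G.d x| - |G.d y|) := by simp [P]; ring
  rw [e]
  exact (abs_add_le _ _).trans (by linarith)

lemma P_ge (h : ℝ) (x : E3) : h ≤ G.P h x := by
  have := abs_nonneg (G.q x); have := abs_nonneg (G.d x); simp only [P]; linarith

lemma P_cont (h : ℝ) : Continuous (G.P h) := (lip_of_le 3 fun x y => G.P_lip h x y).cont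

lemma P_pos {h : ℝ} (hh : 0 < h) (x : E3) : 0 < G.P h x := hh.trans_le (G.P_ge h x)

lemma P_inv_bm {h : ℝ} (hh : 0 < h) : BM (fun x => (G.P h x)⁻¹) :=
  ⟨(G.P_cont h).measurable.inv, h⁻¹, fun x => by
    rw [norm_inv, Real.norm_eq_abs, abs_of_pos (G.P_pos hh x)]
    exact inv_anti₀ hh (G.P_ge h x)⟩

end Geo

/-! ### Hardy inequality -/

/-- Approximate solution of the Dirichlet problem. -/
def AppSol (Ω : Set E3) (f : E3 → ℝ) (ε : ℝ) (φ : E3 → ℝ) : Prop :=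
  Lip0 Ω φ ∧ ∀ χ, Lip0 Ω χ → |DD φ χ - ∫ x, f x * χ x| ≤ ε * (1 + DD χ χ)

lemma wedge_deriv_aux1 {y δ r : ℝ} {R1 : ℝ → ℝ} (h1 : HasDerivAt R1 (y / r) 0) (e1 : R1 0 = r)
    (hr0 : 0 < r) (hψ : 0 < y - δ * r) :
    HasDerivAt (fun s : ℝ => (y + s) / R1 s ^ 4
        - (1 - δ * (y + s) / R1 s) / (R1 s ^ 2 * ((y + s) - δ * R1 s)))
      ((r ^ 4 - y * (4 * r ^ 3 * (y / r))) / (r ^ 4) ^ 2 -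
        ((-((δ * r - δ * y * (y / r)) / r ^ 2)) * (r ^ 2 * (y - δ * r)) -
          (1 - δ * y / r) * (2 * r * (y / r) * (y - δ * r) + r ^ 2 * (1 - δ * (y / r)))) /
          (r ^ 2 * (y - δ * r)) ^ 2) 0 := by
  have hy : HasDerivAt (fun s : ℝ => y + s) 1 0 := (hasDerivAt_id (0 : ℝ)).const_add y
  have p4 : HasDerivAt (fun s => R1 s ^ 4) (4 * r ^ 3 * (y / r)) 0 := by
    have := h1.fun_pow 4; rw [e1] at this; simpa using this
  have p2 : HasDerivAt (fun s => R1 s ^ 2) (2 * r * (y / r)) 0 := by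
    have := h1.fun_pow 2; rw [e1] at this; simpa using this
  have q1 : HasDerivAt (fun s => (y + s) / R1 s ^ 4) ((r ^ 4 - y * (4 * r ^ 3 * (y / r))) / (r ^ 4) ^ 2) 0 := by
    have := hy.fun_div p4 (by rw [e1]; positivity)
    simpa [e1] using this
  have q2 : HasDerivAt (fun s => 1 - δ * (y + s) / R1 s) (-((δ * r - δ * y * (y / r)) / r ^ 2)) 0 := by
    have := ((hy.const_mul δ).fun_div h1 (by rw [e1]; positivity)).const_sub 1
    simpa [e1] using this
  have q3 : HasDerivAt (fun s => R1 s ^ 2 * ((y + s) - δ * R1 s))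
      (2 * r * (y / r) * (y - δ * r) + r ^ 2 * (1 - δ * (y / r))) 0 := by
    have := p2.fun_mul (hy.fun_sub (h1.const_mul δ))
    simpa only [e1, add_zero] using this
  have := q1.fun_sub (q2.fun_div q3 (by rw [e1, add_zero]; positivity))
  simpa only [e1, add_zero] using this

lemma wedge_deriv_aux2 {y m δ r : ℝ} {R2 : ℝ → ℝ} (h1 : HasDerivAt R2 (m / r) 0) (e1 : R2 0 = r)
    (hr0 : 0 < r) (hψ : 0 < y - δ * r) :
    HasDerivAt (fun s : ℝ => (m + s) / R2 s ^ 4 + δ * (m + s) / (R2 s ^ 3 * (y - δ * R2 s)))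
      ((r ^ 4 - m * (4 * r ^ 3 * (m / r))) / (r ^ 4) ^ 2 +
        (δ * (r ^ 3 * (y - δ * r)) -
          δ * m * (3 * r ^ 2 * (m / r) * (y - δ * r) + r ^ 3 * (-(δ * (m / r))))) /
          (r ^ 3 * (y - δ * r)) ^ 2) 0 := by
  have hm : HasDerivAt (fun s : ℝ => m + s) 1 0 := (hasDerivAt_id (0 : ℝ)).const_add m
  have p4 : HasDerivAt (fun s => R2 s ^ 4) (4 * r ^ 3 * (m / r)) 0 := by
    have := h1.fun_pow 4; rw [e1] at this; simpa using this
  have p3 : HasDerivAt (fun s => R2 s ^ 3) (3 * r ^ 2 * (m / r)) 0 := by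
    have := h1.fun_pow 3; rw [e1] at this; simpa using this
  have q1 : HasDerivAt (fun s => (m + s) / R2 s ^ 4) ((r ^ 4 - m * (4 * r ^ 3 * (m / r))) / (r ^ 4) ^ 2) 0 := by
    have := hm.fun_div p4 (by rw [e1]; positivity)
    simpa [e1] using this
  have q3 : HasDerivAt (fun s => R2 s ^ 3 * (y - δ * R2 s))
      (3 * r ^ 2 * (m / r) * (y - δ * r) + r ^ 3 * (-(δ * (m / r)))) 0 := by
    have := p3.fun_mul ((h1.const_mul δ).const_sub y)
    simpa only [e1, add_zero] using this
  have := q1.fun_add ((hm.const_mul δ).fun_div q3 (by rw [e1]; positivity))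
  simpa only [e1, add_zero, mul_one] using this

lemma wedge_alg {y m δ r : ℝ} (hm2 : m ^ 2 = r ^ 2 - y ^ 2) (hr0 : 0 < r) (hψ : 0 < y - δ * r) :
    ((r ^ 4 - y * (4 * r ^ 3 * (y / r))) / (r ^ 4) ^ 2 -
        ((-((δ * r - δ * y * (y / r)) / r ^ 2)) * (r ^ 2 * (y - δ * r)) -
          (1 - δ * y / r) * (2 * r * (y / r) * (y - δ * r) + r ^ 2 * (1 - δ * (y / r)))) /
          (r ^ 2 * (y - δ * r)) ^ 2) +
      ((r ^ 4 - m * (4 * r ^ 3 * (m / r))) / (r ^ 4) ^ 2 +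
        (δ * (r ^ 3 * (y - δ * r)) -
          δ * m * (3 * r ^ 2 * (m / r) * (y - δ * r) + r ^ 3 * (-(δ * (m / r))))) /
          (r ^ 3 * (y - δ * r)) ^ 2)
      - r ^ 2 * (((1 - δ * y / r) / (r ^ 2 * (y - δ * r))) ^ 2
        + (δ * m / (r ^ 3 * (y - δ * r))) ^ 2) = δ / (r ^ 3 * (y - δ * r)) := by
  have a1 : m * (4 * r ^ 3 * (m / r)) = 4 * r ^ 3 * (r ^ 2 - y ^ 2) / r := by rw [← hm2]; ring
  have a2 : δ * m * (3 * r ^ 2 * (m / r) * (y - δ * r) + r ^ 3 * (-(δ * (m / r)))) =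
    δ * (r ^ 2 - y ^ 2) * (3 * r ^ 2 * (y - δ * r) - r ^ 3 * δ) / r := by rw [← hm2]; ring
  have a3 : (δ * m / (r ^ 3 * (y - δ * r))) ^ 2 = δ ^ 2 * (r ^ 2 - y ^ 2) / (r ^ 3 * (y - δ * r)) ^ 2 := by
    rw [← hm2, div_pow, mul_pow]
  rw [a1, a2, a3]
  obtain ⟨ψ, hψe⟩ : ∃ ψ, ψ = y - δ * r := ⟨_, rfl⟩
  rw [← hψe] at hψ ⊢
  have hy : y = ψ + δ * r := by linarith
  subst hy
  have := hψ.ne'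
  field_simp
  ring

lemma wedge_deriv {y m δ r : ℝ} (hr : r = √(y ^ 2 + m ^ 2)) (hr0 : 0 < r) (hψ : 0 < y - δ * r) :
    ∃ a b : ℝ,
      HasDerivAt (fun s : ℝ => (y + s) / √((y + s) ^ 2 + m ^ 2) ^ 4
        - (1 - δ * (y + s) / √((y + s) ^ 2 + m ^ 2)) /
          (√((y + s) ^ 2 + m ^ 2) ^ 2 * ((y + s) - δ * √((y + s) ^ 2 + m ^ 2)))) a 0 ∧
      HasDerivAt (fun s : ℝ => (m + s) / √(y ^ 2 + (m + s) ^ 2) ^ 4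
        + δ * (m + s) /
          (√(y ^ 2 + (m + s) ^ 2) ^ 3 * (y - δ * √(y ^ 2 + (m + s) ^ 2)))) b 0 ∧
      a + b - r ^ 2 * (((1 - δ * y / r) / (r ^ 2 * (y - δ * r))) ^ 2
        + (δ * m / (r ^ 3 * (y - δ * r))) ^ 2) = δ / (r ^ 3 * (y - δ * r)) := by
  have hr2 : r ^ 2 = y ^ 2 + m ^ 2 := by rw [hr, Real.sq_sqrt (by positivity)]
  have hne : y ^ 2 + m ^ 2 ≠ 0 := by rw [← hr2]; positivity
  have h1 : HasDerivAt (fun s : ℝ => √((y + s) ^ 2 + m ^ 2)) (y / r) 0 := by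
    have : HasDerivAt (fun s : ℝ => (y + s) ^ 2 + m ^ 2) (2 * y) 0 := by
      have := (((hasDerivAt_id (0 : ℝ)).const_add y).pow 2).add_const (m ^ 2)
      simpa using this
    have h := this.sqrt (by simpa using hne)
    convert h using 1
    simp only [add_zero]; rw [← hr]; field_simp
  have h2 : HasDerivAt (fun s : ℝ => √(y ^ 2 + (m + s) ^ 2)) (m / r) 0 := by
    have : HasDerivAt (fun s : ℝ => y ^ 2 + (m + s) ^ 2) (2 * m) 0 := by
      have := (((hasDerivAt_id (0 : ℝ)).const_add m).pow 2).const_add (y ^ 2)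
      simpa using this
    have h := this.sqrt (by simpa using hne)
    convert h using 1
    simp only [add_zero]; rw [← hr]; field_simp
  exact ⟨_, _, wedge_deriv_aux1 h1 (by rw [add_zero, hr]) hr0 hψ,
    wedge_deriv_aux2 h2 (by rw [add_zero, hr]) hr0 hψ, wedge_alg (by linarith) hr0 hψ⟩

lemma lip_on_closure {Ω : Set E3} (hΩ : Dom Ω) {w : E3 → ℝ} (hw : ∀ x ∈ closure Ω, ContDiffAt ℝ 1 w x) :
    ∃ K : ℝ, 0 ≤ K ∧ ∀ x ∈ closure Ω, ∀ y ∈ closure Ω, |w x - w y| ≤ K * ‖x - y‖ := by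
  have h1 : ContDiffOn ℝ 1 w (closure Ω) := fun x hx => (hw x hx).contDiffWithinAt
  obtain ⟨K, hK⟩ := h1.exists_lipschitzOnWith (by simp) hΩ.2.2.closure
    (Metric.isCompact_of_isClosed_isBounded isClosed_closure hΩ.2.1.closure)
  refine ⟨K, K.2, fun x hx y hy => ?_⟩
  have := hK.dist_le_mul x hx y hy
  rwa [Real.dist_eq, dist_eq_norm] at this

lemma wedge_pt {pe pm G2 φ y m r δ a b Ye Ym ψ : ℝ} (hr : 0 < r) (hψ : 0 < ψ) (hψr : ψ ≤ r) (hδ : 0 ≤ δ)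
    (hG : pe ^ 2 + pm ^ 2 ≤ G2)
    (hab : a + b - r ^ 2 * (Ye ^ 2 + Ym ^ 2) = δ / (r ^ 3 * ψ)) :
    δ * φ ^ 2 / r ^ 4 ≤ G2 / r ^ 2 - 2 * φ * (y * pe + m * pm) / r ^ 4
      + (2 * φ * pe * (y / r ^ 4 - Ye) + φ ^ 2 * a) + (2 * φ * pm * (m / r ^ 4 - Ym) + φ ^ 2 * b) := by
  have h1 : δ / r ^ 4 ≤ δ / (r ^ 3 * ψ) := by
    apply div_le_div_of_nonneg_left hδ (by positivity)
    nlinarith [pow_pos hr 3]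
  have h2 : (pe ^ 2 + pm ^ 2) / r ^ 2 ≤ G2 / r ^ 2 := by gcongr
  have h3 : φ ^ 2 * (a + b) = φ ^ 2 * (δ / (r ^ 3 * ψ)) + φ ^ 2 * (r ^ 2 * (Ye ^ 2 + Ym ^ 2)) := by
    rw [← mul_add]; congr 1; linarith
  have h4 : φ ^ 2 * (δ / r ^ 4) ≤ φ ^ 2 * (δ / (r ^ 3 * ψ)) := by gcongr
  have h5 : 0 ≤ (pe / r - φ * r * Ye) ^ 2 + (pm / r - φ * r * Ym) ^ 2 := by positivity
  have h6 : (pe / r - φ * r * Ye) ^ 2 + (pm / r - φ * r * Ym) ^ 2 =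
     (pe ^ 2 + pm ^ 2) / r ^ 2 - 2 * φ * (pe * Ye + pm * Ym) + φ ^ 2 * (r ^ 2 * (Ye ^ 2 + Ym ^ 2)) := by
    field_simp; ring
  have h7 : 2 * φ * (y * pe + m * pm) / r ^ 4 = 2 * φ * pe * (y / r ^ 4) + 2 * φ * pm * (m / r ^ 4) := by ring
  have h8 : δ * φ ^ 2 / r ^ 4 = φ ^ 2 * (δ / r ^ 4) := by ring
  rw [h8, h7]
  nlinarith

lemma grad_affine (e : E3) (b : ℝ) (x : E3) : gradient (fun y : E3 => ⟪e, y⟫ + b) x = e := by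
  have h : DifferentiableAt ℝ (fun y : E3 => ⟪e, y⟫) x :=
    (innerSL ℝ e).differentiableAt
  have := grad_add h (differentiableAt_const (𝕜 := ℝ) b) (x := x)
  rw [this, grad_inner_const, gradient_fun_const, add_zero]

lemma grad_inv_Q {e k : E3} {b b' : ℝ} {x : E3} (hQ : 0 < (⟪e, x⟫ + b) ^ 2 + (⟪k, x⟫ + b') ^ 2) :
    DifferentiableAt ℝ (fun z => ((⟪e, z⟫ + b) ^ 2 + (⟪k, z⟫ + b') ^ 2)⁻¹) x ∧
    gradient (fun z => ((⟪e, z⟫ + b) ^ 2 + (⟪k, z⟫ + b') ^ 2)⁻¹) x =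
      (-2 / ((⟪e, x⟫ + b) ^ 2 + (⟪k, x⟫ + b') ^ 2) ^ 2) • ((⟪e, x⟫ + b) • e + (⟪k, x⟫ + b') • k) := by
  have hd1 : ∀ (e : E3) b, DifferentiableAt ℝ (fun y : E3 => ⟪e, y⟫ + b) x :=
    fun e b => (innerSL ℝ e).differentiableAt.add_const b
  have hsq : ∀ (e : E3) b, DifferentiableAt ℝ (fun y : E3 => (⟪e, y⟫ + b) ^ 2) x ∧
      gradient (fun y : E3 => (⟪e, y⟫ + b) ^ 2) x = (2 * (⟪e, x⟫ + b)) • e := fun e b => by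
    refine ⟨(hd1 e b).pow 2, ?_⟩
    have := grad_mul (hd1 e b) (hd1 e b)
    simp only [← pow_two, grad_affine] at this
    rw [this, ← add_smul]; congr 1; ring
  set Q : E3 → ℝ := fun z => (⟪e, z⟫ + b) ^ 2 + (⟪k, z⟫ + b') ^ 2 with hQdef
  have hQd : DifferentiableAt ℝ Q x := (hsq e b).1.add (hsq k b').1
  have hQg : gradient Q x = (2 * (⟪e, x⟫ + b)) • e + (2 * (⟪k, x⟫ + b')) • k := by
    rw [hQdef, grad_add (hsq e b).1 (hsq k b').1, (hsq e b).2, (hsq k b').2]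
  have hQx : Q x ≠ 0 := hQ.ne'
  have hWd : DifferentiableAt ℝ (fun z => (Q z)⁻¹) x := hQd.inv hQx
  refine ⟨hWd, ?_⟩
  have h1 := grad_mul hWd hQd
  have h2 : (fun y => (Q y)⁻¹ * Q y) =ᶠ[nhds x] fun _ => 1 := by
    filter_upwards [hQd.continuousAt.eventually_ne hQx] with y hy
    exact inv_mul_cancel₀ hy
  rw [h2.gradient_eq, gradient_fun_const, hQg] at h1
  have h3 : Q x • gradient (fun z => (Q z)⁻¹) x = -((Q x)⁻¹ • ((2 * (⟪e, x⟫ + b)) • e + (2 * (⟪k, x⟫ + b')) • k)) := by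
    rw [eq_neg_iff_add_eq_zero, add_comm]; exact h1.symm
  have h4 : gradient (fun z => (Q z)⁻¹) x = (Q x)⁻¹ • (Q x • gradient (fun z => (Q z)⁻¹) x) := by
    rw [smul_smul, inv_mul_cancel₀ hQx, one_smul]
  rw [h4, h3]
  change _ = (-2 / Q x ^ 2) • _
  rw [← neg_smul]
  simp only [smul_add, smul_smul]
  congr 2 <;> (field_simp)

/-- Hardy type inequality in a wedge. -/
lemma hardy_wedge {Ω : Set E3} (hΩ : Dom Ω) {e k : E3} (he : ‖e‖ = 1) (hk : ‖k‖ = 1) (hek : ⟪e, k⟫ = 0)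
    {b b' h γ : ℝ} (hh : 0 < h) (hγ : 0 < γ) (hγ1 : γ ≤ 1) (hy : ∀ x ∈ closure Ω, h ≤ ⟪e, x⟫ + b)
    (hr : ∀ x ∈ closure Ω, γ * √((⟪e, x⟫ + b) ^ 2 + (⟪k, x⟫ + b') ^ 2) ≤ ⟪e, x⟫ + b)
    {φ : E3 → ℝ} (hφ : Lip0 Ω φ) {W : E3 → ℝ}
    (hW : W = fun x => (max ((⟪e, x⟫ + b) ^ 2 + (⟪k, x⟫ + b') ^ 2) (h ^ 2))⁻¹) :
    Lip0 Ω (fun x => φ x * W x) ∧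
    γ / 2 * ∫ x, W x ^ 2 * φ x ^ 2 ≤ DD φ (fun x => φ x * W x) ∧
    (∫ x, W x * ‖gradient φ x‖ ^ 2) / 2 - 2 * ∫ x, W x ^ 2 * φ x ^ 2 ≤ DD φ (fun x => φ x * W x) ∧
    DD (fun x => φ x * W x) (fun x => φ x * W x) ≤ 2 * (h ^ 2)⁻¹ * (∫ x, W x * ‖gradient φ x‖ ^ 2) +
      8 * (h ^ 2)⁻¹ * ∫ x, W x ^ 2 * φ x ^ 2 := by
  obtain ⟨δ, hδ⟩ : ∃ δ, δ = γ / 2 := ⟨_, rfl⟩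
  have hδ0 : 0 < δ := by rw [hδ]; positivity
  set Y : E3 → ℝ := fun x => ⟪e, x⟫ + b with hY
  set M : E3 → ℝ := fun x => ⟪k, x⟫ + b' with hM
  set ρ : E3 → ℝ := fun x => √(Y x ^ 2 + M x ^ 2) with hρ
  have hYp : ∀ x ∈ closure Ω, 0 < Y x := fun x hx => hh.trans_le (hy x hx)
  have hQp : ∀ x ∈ closure Ω, 0 < Y x ^ 2 + M x ^ 2 := fun x hx => by
    have := hYp x hx; positivity
  have hρp : ∀ x ∈ closure Ω, 0 < ρ x := fun x hx => Real.sqrt_pos.2 (hQp x hx)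
  have hρ2 : ∀ x, ρ x ^ 2 = Y x ^ 2 + M x ^ 2 := fun x => Real.sq_sqrt (by positivity)
  have hYρ : ∀ x, Y x ≤ ρ x := fun x => Real.le_sqrt_of_sq_le (by nlinarith [sq_nonneg (M x)])
  have hψ : ∀ x ∈ closure Ω, 0 < Y x - δ * ρ x := fun x hx => by
    have := hr x hx; have := hYp x hx
    change γ * ρ x ≤ Y x at *
    rw [hδ]; linarith
  have hYc : ContDiff ℝ 1 Y := (innerSL ℝ e).contDiff.add contDiff_const
  have hMc : ContDiff ℝ 1 M := (innerSL ℝ k).contDiff.add contDiff_const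
  have hρc : ∀ x ∈ closure Ω, ContDiffAt ℝ 1 ρ x := fun x hx =>
    (hYc.contDiffAt.pow 2 |>.add (hMc.contDiffAt.pow 2)).sqrt (hQp x hx).ne'
  set Xe : E3 → ℝ := fun x => Y x / ρ x ^ 4 - (1 - δ * Y x / ρ x) / (ρ x ^ 2 * (Y x - δ * ρ x)) with hXe
  set Xm : E3 → ℝ := fun x => M x / ρ x ^ 4 + δ * M x / (ρ x ^ 3 * (Y x - δ * ρ x)) with hXm
  have hXec : ∀ x ∈ closure Ω, ContDiffAt ℝ 1 Xe x := fun x hx => by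
    have h1 := hρc x hx
    have h2 := (hρp x hx).ne'
    have h3 := (hψ x hx).ne'
    have hYx : ContDiffAt ℝ 1 Y x := hYc.contDiffAt
    refine (hYx.div (h1.pow 4) (by positivity)).sub ((contDiffAt_const.sub ((contDiffAt_const.mul hYx).div h1 h2)).div
      ((h1.pow 2).mul (hYx.sub (contDiffAt_const.mul h1))) ?_)
    exact mul_ne_zero (pow_ne_zero _ h2) h3
  have hXmc : ∀ x ∈ closure Ω, ContDiffAt ℝ 1 Xm x := fun x hx => by
    have h1 := hρc x hx
    have h2 := (hρp x hx).ne'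
    have h3 := (hψ x hx).ne'
    have hYx : ContDiffAt ℝ 1 Y x := hYc.contDiffAt
    have hMx : ContDiffAt ℝ 1 M x := hMc.contDiffAt
    refine (hMx.div (h1.pow 4) (by positivity)).add ((contDiffAt_const.mul hMx).div
      ((h1.pow 3).mul (hYx.sub (contDiffAt_const.mul h1))) ?_)
    exact mul_ne_zero (pow_ne_zero _ h2) h3
  obtain ⟨K1, hK1, hL1⟩ := lip_on_closure hΩ hXec
  obtain ⟨K2, hK2, hL2⟩ := lip_on_closure hΩ hXmc
  have hVc : ∀ x ∈ closure Ω, ContDiffAt ℝ 1 (fun z => (Y z ^ 2 + M z ^ 2)⁻¹) x := fun x hx =>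
    (hYc.contDiffAt.pow 2 |>.add (hMc.contDiffAt.pow 2)).inv (hQp x hx).ne'
  obtain ⟨K3, hK3, hL3⟩ := lip_on_closure hΩ hVc
  have hWV : ∀ x ∈ closure Ω, W x = (Y x ^ 2 + M x ^ 2)⁻¹ := fun x hx => by
    rw [hW]; dsimp only; rw [max_eq_left]
    have := hy x hx
    nlinarith [sq_nonneg (M x)]
  have hWp : ∀ x, 0 < W x := fun x => by rw [hW]; dsimp only; positivity
  have hWle : ∀ x, W x ≤ (h ^ 2)⁻¹ := fun x => by
    rw [hW]; exact inv_anti₀ (by positivity) (le_max_right _ _)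
  have hWbm : BM W := by
    refine BM.of_bdd (h ^ 2)⁻¹ ?_ fun x => ?_
    · rw [hW]
      exact (((hYc.continuous.pow 2).add (hMc.continuous.pow 2)).max continuous_const).measurable.inv
    · rw [Real.norm_eq_abs, abs_of_pos (hWp x)]; exact hWle x
  have hφlc := hφ.lc hΩ
  have hge : Lip0 Ω (fun x => φ x * (φ x * Xe x)) := by
    have h1 := Lip0.mul_on hΩ hφ hK1 hL1
    obtain ⟨K, hK0, hK⟩ := h1.1.le
    exact Lip0.mul_on hΩ hφ hK0 fun x _ y _ => hK x y
  have hgm : Lip0 Ω (fun x => φ x * (φ x * Xm x)) := by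
    have h1 := Lip0.mul_on hΩ hφ hK2 hL2
    obtain ⟨K, hK0, hK⟩ := h1.1.le
    exact Lip0.mul_on hΩ hφ hK0 fun x _ y _ => hK x y
  have hχ : Lip0 Ω (fun x => φ x * W x) :=
    Lip0.mul_on hΩ hφ hK3 fun x hx y hy => by rw [hWV x hx, hWV y hy]; exact hL3 x hx y hy
  have hbes : ∀ v : E3, ⟪v, e⟫ ^ 2 + ⟪v, k⟫ ^ 2 ≤ ‖v‖ ^ 2 := fun v => by
    have h1 : 0 ≤ ⟪v - ⟪v, e⟫ • e - ⟪v, k⟫ • k, v - ⟪v, e⟫ • e - ⟪v, k⟫ • k⟫ := real_inner_self_nonneg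
    have h2 : ⟪e, e⟫ = 1 := by rw [real_inner_self_eq_norm_sq, he]; norm_num
    have h3 : ⟪k, k⟫ = 1 := by rw [real_inner_self_eq_norm_sq, hk]; norm_num
    have h4 : ⟪k, e⟫ = 0 := by rw [real_inner_comm]; exact hek
    simp only [inner_sub_left, inner_sub_right, inner_smul_left, inner_smul_right, h2, h3, h4, hek,
      real_inner_comm v e, real_inner_comm v k] at h1
    rw [← real_inner_self_eq_norm_sq]
    simp at h1
    rw [real_inner_self_eq_norm_sq]
    nlinarith
  -- pointwise facts
  have hpt : ∀ x ∈ Ω, DifferentiableAt ℝ φ x →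
      gradient (fun z => φ z * W z) x = φ x • ((-2 * W x ^ 2) • (Y x • e + M x • k)) + W x • gradient φ x ∧
      δ * (W x ^ 2 * φ x ^ 2) ≤ ⟪gradient φ x, gradient (fun z => φ z * W z) x⟫
        + ⟪gradient (fun x => φ x * (φ x * Xe x)) x, e⟫ + ⟪gradient (fun x => φ x * (φ x * Xm x)) x, k⟫ := by
    intro x hx hd
    have hxc := subset_closure hx
    have hWe : W =ᶠ[nhds x] fun z => (Y z ^ 2 + M z ^ 2)⁻¹ := by
      filter_upwards [hΩ.1.mem_nhds hx] with z hz
      exact hWV z (subset_closure hz)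
    obtain ⟨hWd', hWg⟩ := grad_inv_Q (e := e) (k := k) (b := b) (b' := b') (hQp x hxc)
    have hWd : DifferentiableAt ℝ W x := hWd'.congr_of_eventuallyEq hWe
    have hgW : gradient W x = (-2 * W x ^ 2) • (Y x • e + M x • k) := by
      rw [hWe.gradient_eq, hWg, hWV x hxc, inv_pow]; rfl
    have hg1 : gradient (fun z => φ z * W z) x = φ x • ((-2 * W x ^ 2) • (Y x • e + M x • k)) + W x • gradient φ x := by
      rw [grad_mul hd hWd, hgW]
    refine ⟨hg1, ?_⟩
    obtain ⟨a, b₁, ha, hb, hab⟩ := wedge_deriv (y := Y x) (m := M x) (δ := δ) (r := ρ x) rfl (hρp x hxc) (hψ x hxc)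
    have hee : ⟪e, e⟫ = 1 := by rw [real_inner_self_eq_norm_sq, he]; norm_num
    have hkk : ⟪k, k⟫ = 1 := by rw [real_inner_self_eq_norm_sq, hk]; norm_num
    have hke : ⟪k, e⟫ = 0 := by rw [real_inner_comm]; exact hek
    have hXed : DifferentiableAt ℝ Xe x := (hXec x hxc).differentiableAt (by simp)
    have hXmd : DifferentiableAt ℝ Xm x := (hXmc x hxc).differentiableAt (by simp)
    have hda : ⟪gradient Xe x, e⟫ = a := by
      rw [grad_inner]
      have h1 : HasDerivAt (fun s : ℝ => Xe (x + s • e)) (fderiv ℝ Xe x e) 0 :=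
        hXed.hasFDerivAt.hasLineDerivAt e
      refine h1.unique ?_
      refine ha.congr_of_eventuallyEq (Filter.Eventually.of_forall fun s => ?_)
      simp only [hXe, hρ, hY, hM, inner_add_right, inner_smul_right, hee, hke, mul_one, mul_zero, add_zero]
      ring_nf
    have hdb : ⟪gradient Xm x, k⟫ = b₁ := by
      rw [grad_inner]
      have h1 : HasDerivAt (fun s : ℝ => Xm (x + s • k)) (fderiv ℝ Xm x k) 0 :=
        hXmd.hasFDerivAt.hasLineDerivAt k
      refine h1.unique ?_
      refine hb.congr_of_eventuallyEq (Filter.Eventually.of_forall fun s => ?_)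
      simp only [hXm, hρ, hY, hM, inner_add_right, inner_smul_right, hkk, hek, mul_one, mul_zero, add_zero]
      ring_nf
    rw [grad_mul hd (hd.fun_mul hXed), grad_mul hd hXed, grad_mul hd (hd.fun_mul hXmd), grad_mul hd hXmd, hg1]
    simp only [inner_add_left, inner_add_right, inner_smul_left, inner_smul_right, hda, hdb, real_inner_self_eq_norm_sq]
    have key := wedge_pt (φ := φ x) (y := Y x) (m := M x) (hρp x hxc) (hψ x hxc)
      (by have := hYρ x; have := mul_pos hδ0 (hρp x hxc); linarith) hδ0.le (hbes (gradient φ x))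
      (a := a) (b := b₁) (Ye := (1 - δ * Y x / ρ x) / (ρ x ^ 2 * (Y x - δ * ρ x)))
      (Ym := -(δ * M x / (ρ x ^ 3 * (Y x - δ * ρ x)))) (by rw [neg_sq]; exact hab)
    have hWr : W x = (ρ x ^ 2)⁻¹ := by rw [hWV x hxc, hρ2]
    simp only [hXe, hXm]
    rw [hWr]
    have e1 : δ * (((ρ x ^ 2)⁻¹) ^ 2 * φ x ^ 2) = δ * φ x ^ 2 / ρ x ^ 4 := by
      have := (hρp x hxc).ne'
      field_simp
    rw [e1]
    refine key.trans (le_of_eq ?_)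
    have := (hρp x hxc).ne'
    simp only [conj_trivial]
    generalize (1 - δ * Y x / ρ x) / (ρ x ^ 2 * (Y x - δ * ρ x)) = Z1
    generalize δ * M x / (ρ x ^ 3 * (Y x - δ * ρ x)) = Z2
    field_simp
    ring
  have hWφ : Nice fun x => W x ^ 2 * φ x ^ 2 := Nice.mul' hWbm.sq hφlc.nice.sq
  have hWG : Nice fun x => W x * ‖gradient φ x‖ ^ 2 := Nice.mul' hWbm hφlc.grad.norm.sq
  have hnorm : ∀ x ∈ Ω, ‖Y x • e + M x • k‖ ^ 2 = (W x)⁻¹ := fun x hx => by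
    rw [hWV x (subset_closure hx), inv_inv, norm_add_sq_real, norm_smul, norm_smul, he, hk,
      inner_smul_left, inner_smul_right, hek]
    simp
  refine ⟨hχ, ?_, ?_, ?_⟩
  · have i1 := int_grad_zero (hge.lc hΩ) e
    have i2 := int_grad_zero (hgm.lc hΩ) k
    have n0 := hφlc.ii hχ.1
    have n1 := ((hge.lc hΩ).grad.inner (bm_const e)).integrable
    have n2 := ((hgm.lc hΩ).grad.inner (bm_const k)).integrable
    have : DD φ (fun x => φ x * W x) = ∫ x, (⟪gradient φ x, gradient (fun z => φ z * W z) x⟫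
        + ⟪gradient (fun x => φ x * (φ x * Xe x)) x, e⟫ + ⟪gradient (fun x => φ x * (φ x * Xm x)) x, k⟫) := by
      rw [integral_add (n0.fun_add n1) n2, integral_add n0 n1, i1, i2, add_zero, add_zero]; rfl
    rw [this, ← hδ, ← integral_const_mul]
    refine integral_mono_ae (hWφ.integrable.const_mul δ) ((n0.add n1).add n2) ?_
    filter_upwards [hφ.1.ae, hΩ.ae_grad hφ.2, hΩ.ae_grad hge.2, hΩ.ae_grad hgm.2] with x h1 h2 h3 h4
    by_cases hx : x ∈ Ω
    · exact (hpt x hx h1).2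
    · simp [h2 hx, h3 hx, h4 hx, hφ.2 x hx]
  · have n0 := hφlc.ii hχ.1
    rw [← integral_const_mul, ← integral_div, ← integral_sub (hWG.integrable.div_const 2) (hWφ.integrable.const_mul 2)]
    refine integral_mono_ae ((hWG.integrable.div_const 2).sub (hWφ.integrable.const_mul 2)) n0 ?_
    filter_upwards [hφ.1.ae, hΩ.ae_grad hφ.2] with x h1 h2
    by_cases hx : x ∈ Ω
    · rw [(hpt x hx h1).1]
      have c1 := abs_real_inner_le_norm (gradient φ x) (Y x • e + M x • k)
      have c2 := hnorm x hx
      have c3 := hWp x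
      rw [inner_add_right, inner_smul_right, inner_smul_right, inner_smul_right, real_inner_self_eq_norm_sq]
      set I := ⟪gradient φ x, Y x • e + M x • k⟫
      set g := ‖gradient φ x‖
      have c4 : I ^ 2 ≤ g ^ 2 * (W x)⁻¹ := by
        rw [← c2, ← mul_pow, ← sq_abs]; gcongr
      have c5 : W x * I ^ 2 ≤ g ^ 2 := by
        have := mul_le_mul_of_nonneg_left c4 c3.le
        rwa [mul_comm (g ^ 2), mul_inv_cancel_left₀ c3.ne'] at this
      have c6 : W x ^ 2 * I ^ 2 ≤ W x * g ^ 2 := by nlinarith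
      nlinarith [sq_nonneg (W x * I - 2 * (W x * φ x))]
    · simp [h2 hx, hφ.2 x hx]
  · rw [DD_self, ← integral_const_mul, ← integral_const_mul, ← integral_add (hWG.integrable.const_mul _) (hWφ.integrable.const_mul _)]
    refine integral_mono_ae (hχ.lc hΩ).grad.norm.sq.integrable ((hWG.integrable.const_mul _).add (hWφ.integrable.const_mul _)) ?_
    filter_upwards [hφ.1.ae, hΩ.ae_grad hχ.2] with x h1 h2
    by_cases hx : x ∈ Ω
    · rw [(hpt x hx h1).1]
      have c0 := norm_add_le (φ x • ((-2 * W x ^ 2) • (Y x • e + M x • k))) (W x • gradient φ x)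
      have c2 := hnorm x hx
      have c3 := hWp x
      have c7 := hWle x
      have d1 : ‖φ x • ((-2 * W x ^ 2) • (Y x • e + M x • k))‖ ^ 2 = 4 * φ x ^ 2 * W x ^ 3 := by
        rw [norm_smul, norm_smul, mul_pow, mul_pow, c2]; simp; field_simp; norm_num
      have d2 : ‖W x • gradient φ x‖ ^ 2 = W x * (W x * ‖gradient φ x‖ ^ 2) := by
        rw [norm_smul, mul_pow]; simp; ring
      have d3 : W x * (W x * ‖gradient φ x‖ ^ 2) ≤ (h ^ 2)⁻¹ * (W x * ‖gradient φ x‖ ^ 2) := by gcongr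
      have d4 : W x * (φ x ^ 2 * W x ^ 2) ≤ (h ^ 2)⁻¹ * (φ x ^ 2 * W x ^ 2) := by gcongr
      have d5 := pow_le_pow_left₀ (norm_nonneg _) c0 2
      nlinarith [sq_nonneg (‖φ x • ((-2 * W x ^ 2) • (Y x • e + M x • k))‖ - ‖W x • gradient φ x‖)]
    · rw [h2 hx]
      have := (hWp x).le
      simp; positivity

namespace Geo
variable {Ω : Set E3} (G : Geo Ω)

/-- The edge weight of a pair. -/
def sp (p : G.Pr) (h : ℝ) (x : E3) : ℝ := max (G.l p.1.1 x + G.l p.1.2 x) 0 + h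

lemma l_pos {x : E3} (hx : x ∈ Ω) (i) : 0 < G.l i x := (G.mem_iff.1 hx).trans_le (G.d_le i x)

lemma l_nonneg {x : E3} (hx : x ∈ closure Ω) (i) : 0 ≤ G.l i x := (G.closure_d hx).trans (G.d_le i x)

lemma l_cont (i : Fin G.N) : Continuous (G.l i) :=
  (lip_of_le 1 fun x y => by rw [one_mul]; exact G.l_lip i x y).cont

lemma sp_ge (p : G.Pr) (h : ℝ) (x : E3) : h ≤ G.sp p h x := by
  have := le_max_right (G.l p.1.1 x + G.l p.1.2 x) 0
  simp only [sp]; linarith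

lemma sp_inv_bm (p : G.Pr) {h : ℝ} (hh : 0 < h) : BM (fun x => (G.sp p h x)⁻¹) :=
  BM.of_bdd h⁻¹ ((((G.l_cont _).add (G.l_cont _)).max continuous_const).add continuous_const).measurable.inv fun x => by
    rw [norm_inv, Real.norm_eq_abs, abs_of_pos (hh.trans_le (G.sp_ge p h x))]
    exact inv_anti₀ hh (G.sp_ge p h x)

lemma hardy_abs {δ D S1 S2 F ε h fχ Dχ : ℝ} (hδ : 0 < δ) (hδ1 : δ ≤ 1 / 2) (hh : 0 < h) (hS1 : 0 ≤ S1) (hS2 : 0 ≤ S2)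
    (hF : 0 ≤ F) (hε : 0 ≤ ε) (hε1 : ε ≤ δ / 100 * h ^ 2)
    (h1 : δ * S2 ≤ D) (h2 : S1 / 2 - 2 * S2 ≤ D) (h3 : Dχ ≤ 2 * (h ^ 2)⁻¹ * S1 + 8 * (h ^ 2)⁻¹ * S2)
    (h4 : D - fχ ≤ ε * (1 + Dχ)) (h5 : fχ ≤ F / (2 * δ) + δ * S2 / 2) :
    S1 + S2 ≤ (2 + 5 / δ) * (4 * (1 / (2 * δ) + 1)) * (F + ε) := by
  have hD0 : 0 ≤ D := le_trans (by positivity) h1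
  have e1 : ε * Dχ ≤ δ / 100 * (2 * S1 + 8 * S2) := by
    calc ε * Dχ ≤ ε * (2 * (h ^ 2)⁻¹ * S1 + 8 * (h ^ 2)⁻¹ * S2) := by gcongr
      _ ≤ (δ / 100 * h ^ 2) * (2 * (h ^ 2)⁻¹ * S1 + 8 * (h ^ 2)⁻¹ * S2) := by gcongr
      _ = _ := by field_simp
  have e2 : D ≤ 4 * (F / (2 * δ) + ε) := by nlinarith
  have e3 : S2 ≤ D / δ := by rw [le_div_iff₀ hδ]; linarith
  have e4 : S1 + S2 ≤ (2 + 5 / δ) * D := by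
    have : (2 + 5 / δ) * D = 2 * D + 5 * (D / δ) := by ring
    rw [this]; linarith
  have e5 : F / (2 * δ) + ε ≤ (1 / (2 * δ) + 1) * (F + ε) := by
    have : 0 ≤ 1 / (2 * δ) * ε + F := by positivity
    have e : F / (2 * δ) = 1 / (2 * δ) * F := by ring
    rw [e]; nlinarith
  calc _ ≤ (2 + 5 / δ) * D := e4
    _ ≤ (2 + 5 / δ) * (4 * ((1 / (2 * δ) + 1) * (F + ε))) := by gcongr; linarith
    _ = _ := by ring

lemma weight_le {f g A : E3 → ℝ} {K : ℝ} {v : E3 → ℝ} (hΩ : Dom Ω) (hv : Lip0 Ω v) (hf : BM f) (hg : BM g)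
    (hfg : ∀ x ∈ Ω, f x ≤ K * g x) (hA : Nice A) (hA0 : ∀ x, 0 ≤ A x) (hA1 : ∀ᵐ x, x ∉ Ω → A x = 0) :
    ∫ x, f x * A x ≤ K * ∫ x, g x * A x := by
  rw [← integral_const_mul]
  refine integral_mono_ae (Nice.mul' hf hA).integrable ((Nice.mul' hg hA).integrable.const_mul K) ?_
  filter_upwards [hA1] with x hx
  by_cases h : x ∈ Ω
  · have := mul_le_mul_of_nonneg_right (hfg x h) (hA0 x)
    linarith
  · simp [hx h]

lemma grad_sq_ae (hΩ : Dom Ω) {v : E3 → ℝ} (hv : Lip0 Ω v) : ∀ᵐ x, x ∉ Ω → ‖gradient v x‖ ^ 2 = 0 := by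
  filter_upwards [hΩ.ae_grad hv.2] with x hx h
  simp [hx h]

lemma _root_.BM.sum {ι : Type*} {s : Finset ι} {a : ι → E3 → ℝ} (ha : ∀ i ∈ s, BM (a i)) :
    BM (fun x => ∑ i ∈ s, a i x) := by
  classical
  induction s using Finset.induction_on with
  | empty => simpa using bm_const (F := ℝ) 0
  | insert i s hi ih =>
    simp only [Finset.sum_insert hi]
    exact (ha i (Finset.mem_insert_self _ _)).add (ih fun j hj => ha j (Finset.mem_insert_of_mem hj))

set_option maxHeartbeats 1000000 in
/-- Hardy inequality for one pair of faces. -/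
lemma hardy_pair (p : G.Pr) : ∃ C c₀ : ℝ, 0 < C ∧ 0 < c₀ ∧ ∀ h, 0 < h → ∀ f, Nice f → ∀ ε, 0 ≤ ε → ε ≤ c₀ * h ^ 2 →
    ∀ φ, AppSol Ω f ε φ →
      (∫ x, (G.sp p h x)⁻¹ ^ 2 * ‖gradient φ x‖ ^ 2) + (∫ x, (G.sp p h x)⁻¹ ^ 4 * φ x ^ 2) ≤
        C * ((∫ x, f x ^ 2) + ε + DD φ φ) := by
  obtain ⟨⟨i, j⟩, hij⟩ := p
  simp only at hij
  set p : G.Pr := ⟨(i, j), hij⟩ with hp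
  have hn := G.rep.1
  by_cases hanti : G.n i + G.n j = 0
  · obtain ⟨R, hR0, hR⟩ := G.dom.ball
    obtain ⟨x0, hx0⟩ := G.ne
    obtain ⟨κ, hκ⟩ : ∃ κ, κ = G.a i + G.a j := ⟨_, rfl⟩
    have hl : ∀ x, G.l i x + G.l j x = κ := fun x => by
      have : ⟪G.n i + G.n j, x⟫ = 0 := by rw [hanti, inner_zero_left]
      rw [inner_add_left] at this
      simp only [l]; rw [hκ]; linarith
    have hκ0 : 0 < κ := by rw [← hl x0]; exact add_pos (G.l_pos hx0 i) (G.l_pos hx0 j)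
    refine ⟨κ⁻¹ ^ 2 + κ⁻¹ ^ 4 * (4 * R ^ 2), 1, by positivity, one_pos, ?_⟩
    intro h hh f hf ε hε _ φ hφ
    have hsp : ∀ x, (G.sp p h x)⁻¹ ≤ κ⁻¹ := fun x => by
      apply inv_anti₀ hκ0
      have := le_max_left (G.l p.1.1 x + G.l p.1.2 x) 0
      have h2 := hl x
      simp only [sp]; linarith
    have hsp0 : ∀ x, 0 ≤ (G.sp p h x)⁻¹ := fun x => inv_nonneg.2 (hh.le.trans (G.sp_ge p h x))
    have hlc := hφ.1.lc G.dom
    have bm := G.sp_inv_bm p hh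
    have i1 := weight_le (K := κ⁻¹ ^ 2) (g := fun _ => 1) G.dom hφ.1 bm.sq (bm_const _)
      (fun x _ => by rw [mul_one]; exact pow_le_pow_left₀ (hsp0 x) (hsp x) 2) hlc.grad.norm.sq (fun x => by positivity)
      (grad_sq_ae G.dom hφ.1)
    have i2 := weight_le (K := κ⁻¹ ^ 4) (g := fun _ => 1) (f := fun x => (G.sp p h x)⁻¹ ^ 4) G.dom hφ.1
      (by have := bm.sq.sq; simpa only [← pow_mul] using this) (bm_const _)
      (fun x _ => by rw [mul_one]; exact pow_le_pow_left₀ (hsp0 x) (hsp x) 4) hlc.nice.sq (fun x => by positivity)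
      (Filter.Eventually.of_forall fun x hx => by simp [hφ.1.2 x hx])
    simp only [one_mul] at i1 i2
    rw [← DD_self] at i1
    have i3 := poincare hlc (R := R) (fun x hx => hφ.1.2 x fun hxΩ => absurd (hR x (subset_closure hxΩ)) (not_le.2 hx))
    have hF : 0 ≤ ∫ x, f x ^ 2 := integral_nonneg fun x => sq_nonneg _
    calc _ ≤ κ⁻¹ ^ 2 * DD φ φ + κ⁻¹ ^ 4 * (4 * R ^ 2 * DD φ φ) := by
          refine add_le_add i1 (i2.trans ?_); gcongr
      _ = (κ⁻¹ ^ 2 + κ⁻¹ ^ 4 * (4 * R ^ 2)) * DD φ φ := by ring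
      _ ≤ _ := by gcongr; linarith
  · have hne : G.n i - G.n j ≠ 0 := fun h => hij (G.rep.2.1 (sub_eq_zero.1 h))
    obtain ⟨α, hα⟩ : ∃ α, α = ‖G.n i + G.n j‖ / 2 := ⟨_, rfl⟩
    obtain ⟨γ, hγ⟩ : ∃ γ, γ = ‖G.n i - G.n j‖ / 2 := ⟨_, rfl⟩
    have hα0 : 0 < α := by rw [hα]; have := norm_pos_iff.2 hanti; positivity
    have hγ0 : 0 < γ := by rw [hγ]; have := norm_pos_iff.2 hne; positivity
    have hαγ : α ^ 2 + γ ^ 2 = 1 := by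
      have := parallelogram_law_with_norm ℝ (G.n i) (G.n j)
      rw [hn, hn] at this
      rw [hα, hγ]; nlinarith
    have hγ1 : γ ≤ 1 := by nlinarith
    obtain ⟨e, he⟩ : ∃ e : E3, e = (1 / (2 * α)) • (G.n i + G.n j) := ⟨_, rfl⟩
    obtain ⟨k, hk⟩ : ∃ k : E3, k = (1 / (2 * γ)) • (G.n i - G.n j) := ⟨_, rfl⟩
    have he1 : ‖e‖ = 1 := by
      rw [he, norm_smul, Real.norm_of_nonneg (by positivity), show ‖G.n i + G.n j‖ = 2 * α by linarith]; field_simp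
    have hk1 : ‖k‖ = 1 := by
      rw [hk, norm_smul, Real.norm_of_nonneg (by positivity), show ‖G.n i - G.n j‖ = 2 * γ by linarith]; field_simp
    have hek : ⟪e, k⟫ = 0 := by
      rw [he, hk, inner_smul_left, inner_smul_right, real_inner_add_sub_eq_zero_iff _ _ |>.2 (by rw [hn, hn])]; simp
    obtain ⟨κ, hκ⟩ : ∃ κ, κ = (1 / (2 * α) + 1) / γ := ⟨_, rfl⟩
    have hκ0 : 0 < κ := by rw [hκ]; positivity
    obtain ⟨δ, hδ⟩ : ∃ δ, δ = γ / 2 := ⟨_, rfl⟩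
    have hδ0 : 0 < δ := by rw [hδ]; positivity
    refine ⟨(κ ^ 2 + κ ^ 4) * ((2 + 5 / δ) * (4 * (1 / (2 * δ) + 1))), δ / 100, by positivity, by positivity, ?_⟩
    intro h hh f hf ε hε hε1 φ hφ
    obtain ⟨b, hb⟩ : ∃ b, b = (G.a i + G.a j) / (2 * α) + h := ⟨_, rfl⟩
    obtain ⟨b', hb'⟩ : ∃ b', b' = (G.a i - G.a j) / (2 * γ) := ⟨_, rfl⟩
    have hY : ∀ x, ⟪e, x⟫ + b = (G.l i x + G.l j x) / (2 * α) + h := fun x => by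
      rw [he, hb, inner_smul_left, inner_add_left]; simp [l]; ring
    have hM : ∀ x, ⟪k, x⟫ + b' = (G.l i x - G.l j x) / (2 * γ) := fun x => by
      rw [hk, hb', inner_smul_left, inner_sub_left]; simp [l]; ring
    have hyh : ∀ x ∈ closure Ω, h ≤ ⟪e, x⟫ + b := fun x hx => by
      rw [hY]
      have := add_nonneg (G.l_nonneg hx i) (G.l_nonneg hx j)
      have : 0 ≤ (G.l i x + G.l j x) / (2 * α) := by positivity
      linarith
    have hQ : ∀ x ∈ closure Ω, γ ^ 2 * ((⟪e, x⟫ + b) ^ 2 + (⟪k, x⟫ + b') ^ 2) ≤ (⟪e, x⟫ + b) ^ 2 := fun x hx => by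
      have h1 := G.l_nonneg hx i
      have h2 := G.l_nonneg hx j
      have h3 : γ ^ 2 * (⟪k, x⟫ + b') ^ 2 = (G.l i x - G.l j x) ^ 2 / 4 := by
        rw [hM]; field_simp; norm_num
      have h4 : α * (⟪e, x⟫ + b - h) = (G.l i x + G.l j x) / 2 := by
        rw [hY]; field_simp; ring
      have h5 : α ^ 2 * (⟪e, x⟫ + b - h) ^ 2 = (G.l i x + G.l j x) ^ 2 / 4 := by rw [← mul_pow, h4]; ring
      have h6 : (⟪e, x⟫ + b - h) ^ 2 ≤ (⟪e, x⟫ + b) ^ 2 := by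
        have := hyh x hx; exact pow_le_pow_left₀ (by linarith) (by linarith) 2
      have h7 : α ^ 2 * (⟪e, x⟫ + b - h) ^ 2 ≤ α ^ 2 * (⟪e, x⟫ + b) ^ 2 := by gcongr
      nlinarith [mul_nonneg h1 h2]
    have hr : ∀ x ∈ closure Ω, γ * √((⟪e, x⟫ + b) ^ 2 + (⟪k, x⟫ + b') ^ 2) ≤ ⟪e, x⟫ + b := fun x hx => by
      have h1 := hQ x hx
      have h2 : 0 ≤ ⟪e, x⟫ + b := hh.le.trans (hyh x hx)
      apply le_of_sq_le_sq _ h2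
      rw [mul_pow, Real.sq_sqrt (by positivity)]; exact h1
    obtain ⟨W, hW⟩ : ∃ W : E3 → ℝ, W = fun x => (max ((⟪e, x⟫ + b) ^ 2 + (⟪k, x⟫ + b') ^ 2) (h ^ 2))⁻¹ := ⟨_, rfl⟩
    obtain ⟨r0, r1, r2, r3⟩ := hardy_wedge G.dom he1 hk1 hek hh hγ0 hγ1 hyh hr hφ.1 hW
    have hWp : ∀ x, 0 < W x := fun x => by rw [hW]; dsimp only; positivity
    have hWbm : BM W := by
      refine BM.of_bdd (h ^ 2)⁻¹ ?_ fun x => ?_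
      · rw [hW]
        exact ((((((continuous_const.inner continuous_id).add continuous_const).pow 2).add
          (((continuous_const.inner continuous_id).add continuous_const).pow 2)).max continuous_const).measurable).inv
      · rw [Real.norm_eq_abs, abs_of_pos (hWp x), hW]; exact inv_anti₀ (by positivity) (le_max_right _ _)
    have hlc := hφ.1.lc G.dom
    have hsp0 : ∀ x, 0 < (G.sp p h x)⁻¹ := fun x => inv_pos.2 (hh.trans_le (G.sp_ge p h x))
    have hspW : ∀ x ∈ Ω, (G.sp p h x)⁻¹ ^ 2 ≤ κ ^ 2 * W x := fun x hx => by
      have hxc := subset_closure hx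
      have h1 := hQ x hxc
      have h2 := hyh x hxc
      have hl := add_pos (G.l_pos hx i) (G.l_pos hx j)
      have h3 : ⟪e, x⟫ + b ≤ (1 / (2 * α) + 1) * G.sp p h x := by
        have e1 : G.sp p h x = G.l i x + G.l j x + h := by simp only [sp, hp]; rw [max_eq_left hl.le]
        rw [hY, e1]
        have : 0 ≤ 1 / (2 * α) * h + (G.l i x + G.l j x) := by positivity
        have e2 : (G.l i x + G.l j x) / (2 * α) = 1 / (2 * α) * (G.l i x + G.l j x) := by ring
        rw [e2]; nlinarith
      have hs := hh.trans_le (G.sp_ge p h x)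
      have h4 : (max ((⟪e, x⟫ + b) ^ 2 + (⟪k, x⟫ + b') ^ 2) (h ^ 2)) ≤ κ ^ 2 * G.sp p h x ^ 2 := by
        have h2' := pow_le_pow_left₀ hh.le h2 2
        have h2'' := sq_nonneg (⟪k, x⟫ + b')
        rw [max_eq_left (by linarith)]
        have h5 := pow_le_pow_left₀ (hh.le.trans h2) h3 2
        rw [hκ, div_pow, div_mul_eq_mul_div, le_div_iff₀ (by positivity), ← mul_pow]
        linarith
      have h6 : 0 < max ((⟪e, x⟫ + b) ^ 2 + (⟪k, x⟫ + b') ^ 2) (h ^ 2) := by positivity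
      rw [hW]; dsimp only
      rw [inv_pow, ← div_eq_mul_inv, le_div_iff₀ h6, inv_mul_le_iff₀ (by positivity)]
      linarith
    have bm := G.sp_inv_bm p hh
    have i1 := weight_le G.dom hφ.1 bm.sq hWbm hspW hlc.grad.norm.sq (fun x => by positivity)
      (grad_sq_ae G.dom hφ.1)
    have i2 := weight_le (K := κ ^ 4) (f := fun x => (G.sp p h x)⁻¹ ^ 4) G.dom hφ.1
      (by have := bm.sq.sq; simpa only [← pow_mul] using this) hWbm.sq
      (fun x hx => by
        have := pow_le_pow_left₀ (by positivity) (hspW x hx) 2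
        calc (G.sp p h x)⁻¹ ^ 4 = ((G.sp p h x)⁻¹ ^ 2) ^ 2 := by ring
          _ ≤ _ := this
          _ = _ := by ring) hlc.nice.sq (fun x => by positivity)
      (Filter.Eventually.of_forall fun x hx => by simp [hφ.1.2 x hx])
    have hF : 0 ≤ ∫ x, f x ^ 2 := integral_nonneg fun x => sq_nonneg _
    have hS1 : 0 ≤ ∫ x, W x * ‖gradient φ x‖ ^ 2 := integral_nonneg fun x => by have := hWp x; positivity
    have hS2 : 0 ≤ ∫ x, W x ^ 2 * φ x ^ 2 := integral_nonneg fun x => by have := hWp x; positivity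
    have hfχ : ∫ x, f x * (φ x * W x) ≤ (∫ x, f x ^ 2) / (2 * δ) + δ * (∫ x, W x ^ 2 * φ x ^ 2) / 2 := by
      have n2 := (Nice.mul' hWbm.sq hlc.nice.sq).integrable
      rw [← integral_div, ← integral_const_mul, ← integral_div, ← integral_add (hf.sq.integrable.div_const _)
        ((n2.const_mul _).div_const _)]
      refine integral_mono (hf.mul (r0.lc G.dom).nice.bm).integrable
        ((hf.sq.integrable.div_const _).add ((n2.const_mul _).div_const _)) fun x => ?_
      dsimp only
      have : 0 ≤ (f x - δ * (φ x * W x)) ^ 2 / (2 * δ) := by positivity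
      have e : (f x - δ * (φ x * W x)) ^ 2 / (2 * δ) = f x ^ 2 / (2 * δ) + δ * (W x ^ 2 * φ x ^ 2) / 2 - f x * (φ x * W x) := by
        field_simp; ring
      change f x * (φ x * W x) ≤ f x ^ 2 / (2 * δ) + δ * (W x ^ 2 * φ x ^ 2) / 2
      linarith
    have habs := hardy_abs hδ0 (by linarith) hh hS1 hS2 hF hε hε1 (by rw [hδ]; exact r1) r2 r3
      ((le_abs_self _).trans (hφ.2 _ r0)) hfχ
    have hD := DD_self_nonneg φ
    calc _ ≤ κ ^ 2 * (∫ x, W x * ‖gradient φ x‖ ^ 2) + κ ^ 4 * ∫ x, W x ^ 2 * φ x ^ 2 := add_le_add i1 i2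
      _ ≤ (κ ^ 2 + κ ^ 4) * ((∫ x, W x * ‖gradient φ x‖ ^ 2) + ∫ x, W x ^ 2 * φ x ^ 2) := by
        rw [mul_add]; gcongr
        · exact le_add_of_nonneg_right (by positivity)
        · exact le_add_of_nonneg_left (by positivity)
      _ ≤ (κ ^ 2 + κ ^ 4) * ((2 + 5 / δ) * (4 * (1 / (2 * δ) + 1)) * ((∫ x, f x ^ 2) + ε)) := by gcongr
      _ ≤ (κ ^ 2 + κ ^ 4) * ((2 + 5 / δ) * (4 * (1 / (2 * δ) + 1)) * ((∫ x, f x ^ 2) + ε + DD φ φ)) := by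
        exact mul_le_mul_of_nonneg_left (mul_le_mul_of_nonneg_left (by linarith) (by positivity)) (by positivity)
      _ = _ := by ring

/-- Weighted estimate in terms of the distance to the edges. -/
lemma hardy : ∃ C c₀ : ℝ, 0 < C ∧ 0 < c₀ ∧ ∀ h, 0 < h → ∀ f, Nice f → ∀ ε, 0 ≤ ε → ε ≤ c₀ * h ^ 2 →
    ∀ φ, AppSol Ω f ε φ →
      (∫ x, (G.P h x)⁻¹ ^ 2 * ‖gradient φ x‖ ^ 2) + (∫ x, (G.P h x)⁻¹ ^ 4 * φ x ^ 2) ≤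
        C * ((∫ x, f x ^ 2) + ε + DD φ φ) := by
  choose C c₀ hC hc H using G.hardy_pair
  obtain ⟨p0⟩ : Nonempty G.Pr := inferInstance
  obtain ⟨p1, hp1⟩ := Finite.exists_min c₀
  refine ⟨∑ p, C p, c₀ p1, Finset.sum_pos (fun p _ => hC p) ⟨p0, Finset.mem_univ _⟩, hc p1, ?_⟩
  intro h hh f hf ε hε hε1 φ hφ
  have hHp : ∀ p, _ := fun p => H p h hh f hf ε hε (hε1.trans (by gcongr; exact hp1 p)) φ hφ
  have hlc := hφ.1.lc G.dom
  have hsp0 : ∀ p x, 0 < (G.sp p h x)⁻¹ := fun p x => inv_pos.2 (hh.trans_le (G.sp_ge p h x))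
  have hP0 : ∀ x, 0 < (G.P h x)⁻¹ := fun x => inv_pos.2 (G.P_pos hh x)
  have key : ∀ m : ℕ, ∀ x ∈ Ω, (G.P h x)⁻¹ ^ m ≤ 1 * ∑ p, (G.sp p h x)⁻¹ ^ m := fun m x hx => by
    obtain ⟨p, hp⟩ := G.q_ex x
    rw [one_mul]
    refine le_trans ?_ (Finset.single_le_sum (f := fun p => (G.sp p h x)⁻¹ ^ m) (fun p _ => (pow_pos (hsp0 p x) m).le) (Finset.mem_univ p))
    refine pow_le_pow_left₀ (hP0 x).le (inv_anti₀ (hh.trans_le (G.sp_ge p h x)) ?_) m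
    have := add_pos (G.l_pos hx p.1.1) (G.l_pos hx p.1.2)
    simp only [sp, P]
    rw [max_eq_left this.le, hp, abs_of_pos (by rw [← hp]; exact this)]
    have := abs_nonneg (G.d x)
    linarith
  have bmp : ∀ p, ∀ m : ℕ, BM fun x => (G.sp p h x)⁻¹ ^ m := fun p m => by
    induction m with
    | zero => simpa using bm_const (F := ℝ) 1
    | succ m ih => simpa only [pow_succ] using ih.mul (G.sp_inv_bm p hh)
  have bmP : ∀ m : ℕ, BM fun x => (G.P h x)⁻¹ ^ m := fun m => by
    induction m with
    | zero => simpa using bm_const (F := ℝ) 1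
    | succ m ih => simpa only [pow_succ] using ih.mul (G.P_inv_bm hh)
  have bms : ∀ m : ℕ, BM fun x => ∑ p, (G.sp p h x)⁻¹ ^ m := fun m =>
    BM.sum fun p _ => bmp p m
  have i1 := weight_le G.dom hφ.1 (bmP 2) (bms 2) (key 2) hlc.grad.norm.sq (fun x => by positivity)
      (grad_sq_ae G.dom hφ.1)
  have i2 := weight_le G.dom hφ.1 (bmP 4) (bms 4) (key 4) hlc.nice.sq (fun x => by positivity)
      (Filter.Eventually.of_forall fun x hx => by simp [hφ.1.2 x hx])
  simp only [one_mul, Finset.sum_mul] at i1 i2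
  rw [integral_finsetSum _ fun p _ => (Nice.mul' (bmp p 2) hlc.grad.norm.sq).integrable] at i1
  rw [integral_finsetSum _ fun p _ => (Nice.mul' (bmp p 4) hlc.nice.sq).integrable] at i2
  refine (add_le_add i1 i2).trans ?_
  rw [← Finset.sum_add_distrib, Finset.sum_mul]
  exact Finset.sum_le_sum fun p _ => hHp p

end Geo

/-! ### Affine isometries and reflections -/

/-- Affine isometries. -/
def AI (A : E3 → E3) : Prop := ∃ (ρ : E3 ≃ₗᵢ[ℝ] E3) (c : E3), ∀ x, A x = ρ x + c

lemma AI.eq {A : E3 → E3} (h : AI A) : ∃ (ρ : E3 ≃ₗᵢ[ℝ] E3) (c : E3), A = fun x => ρ x + c := by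
  obtain ⟨ρ, c, h⟩ := h; exact ⟨ρ, c, funext h⟩

lemma ai_trans (t : E3) : AI (fun x => x + t) := ⟨LinearIsometryEquiv.refl ℝ E3, t, fun x => by simp⟩

lemma AI.iso {A : E3 → E3} (h : AI A) (x y : E3) : ‖A x - A y‖ = ‖x - y‖ := by
  obtain ⟨ρ, c, rfl⟩ := h.eq
  simp [← map_sub]

lemma AI.isometry {A : E3 → E3} (h : AI A) : Isometry A :=
  Isometry.of_dist_eq fun x y => by rw [dist_eq_norm, dist_eq_norm, h.iso]

lemma AI.meas {A : E3 → E3} (h : AI A) : Measurable A := h.isometry.continuous.measurable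

lemma AI.integral {A : E3 → E3} (h : AI A) (g : E3 → ℝ) : ∫ x, g (A x) = ∫ x, g x := by
  have hm : MeasurePreserving A := by
    obtain ⟨ρ, c, rfl⟩ := h.eq
    exact (measurePreserving_add_right volume c).comp ρ.measurePreserving
  exact hm.integral_comp h.isometry.isClosedEmbedding.measurableEmbedding g

lemma AI.lip {A : E3 → E3} (h : AI A) {v : E3 → ℝ} (hv : Lip v) : Lip (fun x => v (A x)) :=
  hv.comp_le A fun x y => (h.iso x y).le

lemma AI.nice {F : Type*} [NormedAddCommGroup F] [MeasurableSpace F] [BorelSpace F] [SecondCountableTopology F]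
    {A : E3 → E3} (h : AI A) {v : E3 → F} (hv : Nice v) : Nice (fun x => v (A x)) :=
  hv.comp h.meas ‖A 0‖ fun x => by
    have := h.iso x 0
    rw [sub_zero] at this; rw [← this]; exact norm_sub_le _ _

lemma AI.lc {A : E3 → E3} (h : AI A) {v : E3 → ℝ} (hv : LC v) : LC (fun x => v (A x)) := by
  refine ⟨h.lip hv.1, ?_⟩
  obtain ⟨R, hR⟩ := hv.2
  refine ⟨R + ‖A 0‖, fun x hx => hR _ ?_⟩
  have := h.iso x 0
  rw [sub_zero] at this
  have := norm_sub_le (A x) (A 0)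
  linarith

lemma AI.grad {A : E3 → E3} (h : AI A) (v w : E3 → ℝ) (x : E3) :
    ⟪gradient (fun y => v (A y)) x, gradient (fun y => w (A y)) x⟫ = ⟪gradient v (A x), gradient w (A x)⟫ := by
  obtain ⟨ρ, c, rfl⟩ := h.eq
  have key : ∀ v : E3 → ℝ, gradient (fun y => v (ρ y + c)) x = ρ.symm (gradient v (ρ x + c)) := fun v => by
    apply grad_ext
    intro t
    have h1 := ρ.toContinuousLinearEquiv.comp_right_fderiv (f := fun z => v (z + c)) (x := x)
    have h2 : (fun y => v (ρ y + c)) = (fun z => v (z + c)) ∘ ρ.toContinuousLinearEquiv := rfl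
    rw [h2, h1, fderiv_comp_add_right]
    simp only [ContinuousLinearMap.comp_apply]
    rw [← grad_inner, ← LinearIsometryEquiv.inner_map_map ρ (ρ.symm _) t]
    simp
  rw [key, key]
  simp

lemma AI.norm_grad {A : E3 → E3} (h : AI A) (v : E3 → ℝ) (x : E3) :
    ‖gradient (fun y => v (A y)) x‖ ^ 2 = ‖gradient v (A x)‖ ^ 2 := by
  rw [← real_inner_self_eq_norm_sq, h.grad, real_inner_self_eq_norm_sq]

lemma AI.DD {A : E3 → E3} (h : AI A) (v w : E3 → ℝ) : DD (fun x => v (A x)) (fun x => w (A x)) = DD v w := by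
  unfold _root_.DD
  simp only [h.grad]
  exact h.integral fun x => ⟪gradient v x, gradient w x⟫

lemma grad_trans (v : E3 → ℝ) (t x : E3) : gradient (fun y => v (y + t)) x = gradient v (x + t) :=
  grad_ext fun s => by rw [fderiv_comp_add_right, grad_inner]

namespace Geo
variable {Ω : Set E3} (G : Geo Ω)

/-- Index set of the identity and the face reflections. -/
abbrev O : Type := Option (Fin G.N)

/-- The reflections. -/
def A : G.O → E3 → E3
  | none => fun x => x
  | some i => fun x => x - (2 * G.l i x) • G.n i

/-- Signs. -/
def sg : G.O → ℝ
  | none => 1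
  | some _ => -1

/-- Number of terms. -/
def Mc : ℝ := (Fintype.card G.O : ℝ)

lemma Mc_ge : 1 ≤ G.Mc := by
  have : 1 ≤ Fintype.card G.O := Fintype.card_pos
  unfold Mc; exact_mod_cast this

lemma sg_sq (o : G.O) : G.sg o ^ 2 = 1 := by cases o <;> simp [sg]

lemma A_ai (o : G.O) : AI (G.A o) := by
  cases o with
  | none => exact ⟨LinearIsometryEquiv.refl ℝ E3, 0, fun x => by simp [A]⟩
  | some i =>
    refine ⟨((Submodule.span ℝ {G.n i}).reflection).trans (LinearIsometryEquiv.neg ℝ), -((2 * G.a i) • G.n i), fun x => ?_⟩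
    simp only [LinearIsometryEquiv.trans_apply, LinearIsometryEquiv.coe_neg, Submodule.reflection_singleton_apply, A, l, G.rep.1]
    simp only [RCLike.ofReal_real_eq_id, id, one_pow, div_one, mul_add, add_smul, two_smul, neg_sub]
    simp only [two_mul, add_smul]
    abel

lemma l_A (i : Fin G.N) (x : E3) : G.l i (G.A (some i) x) = - G.l i x := by
  have h : ⟪G.n i, G.n i⟫ = 1 := by rw [real_inner_self_eq_norm_sq, G.rep.1]; norm_num
  have : G.l i (G.A (some i) x) = G.l i x - 2 * G.l i x * ⟪G.n i, G.n i⟫ := by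
    simp only [A]; simp only [l, inner_sub_right, inner_smul_right]; ring
  rw [this, h]; ring

lemma A_inv (o : G.O) (x : E3) : G.A o (G.A o x) = x := by
  cases o with
  | none => rfl
  | some i =>
    have h := G.l_A i x
    have : G.A (some i) (G.A (some i) x) = G.A (some i) x - (2 * G.l i (G.A (some i) x)) • G.n i := rfl
    rw [this, h]
    simp [A]

lemma A_DD (o : G.O) (v w : E3 → ℝ) : DD (fun x => v (G.A o x)) w = DD v (fun x => w (G.A o x)) := by
  rw [← (G.A_ai o).DD v]
  simp only [G.A_inv]

lemma A_int (o : G.O) (v w : E3 → ℝ) : ∫ x, v (G.A o x) * w x = ∫ x, v x * w (G.A o x) := by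
  rw [← (G.A_ai o).integral]
  simp only [G.A_inv]

lemma P_A {h : ℝ} (hh : 0 < h) (o : G.O) {x : E3} (hx : x ∈ Ω) : G.P h x ≤ 7 * G.P h (G.A o x) := by
  cases o with
  | none => have := G.P_pos hh x; simp only [A]; linarith
  | some i =>
    have h1 := G.l_pos hx i
    have h2 := G.d_le i (G.A (some i) x)
    rw [G.l_A] at h2
    have h3 := (abs_le.1 (G.P_lip h x (G.A (some i) x))).2
    have h4 : ‖x - G.A (some i) x‖ = 2 * G.l i x := by
      simp only [A, sub_sub_cancel]
      rw [norm_smul, G.rep.1, mul_one, Real.norm_of_nonneg (by positivity)]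
    have h5 : G.l i x ≤ |G.d (G.A (some i) x)| := by rw [abs_of_neg (by linarith)]; linarith
    have h6 : |G.d (G.A (some i) x)| ≤ G.P h (G.A (some i) x) := by
      have := abs_nonneg (G.q (G.A (some i) x)); simp only [P]; linarith
    linarith

/-- Odd extension across all faces. -/
def hat (v : E3 → ℝ) (x : E3) : ℝ := ∑ o, G.sg o * v (G.A o x)

lemma hat_lc {v : E3 → ℝ} (hv : LC v) : LC (G.hat v) :=
  LC.sum fun o _ => ((G.A_ai o).lc hv).const_mul _

lemma hat_nice {v : E3 → ℝ} (hv : Nice v) : Nice (G.hat v) :=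
  Nice.sum fun o _ => Nice.mul' (bm_const _) ((G.A_ai o).nice hv)

lemma hat_eq {v : E3 → ℝ} (hv : ∀ x, x ∉ Ω → v x = 0) {x : E3} (hx : x ∈ closure Ω) : G.hat v x = v x := by
  simp only [hat, Fintype.sum_option]
  rw [Finset.sum_eq_zero]
  · simp [sg, A]
  · intro i _
    rw [hv, mul_zero]
    intro h
    have h1 := G.l_pos h i
    rw [G.l_A] at h1
    have := G.l_nonneg hx i
    linarith

lemma sum_sq {ι : Type*} [Fintype ι] (b : ι → E3) : ‖∑ o, b o‖ ^ 2 ≤ (Fintype.card ι : ℝ) * ∑ o, ‖b o‖ ^ 2 := by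
  calc _ ≤ (∑ o, ‖b o‖) ^ 2 := by gcongr; exact norm_sum_le _ _
    _ ≤ _ := by simpa using sq_sum_le_card_mul_sum_sq (s := Finset.univ) (f := fun o => ‖b o‖)

lemma hat_sq (v : E3 → ℝ) (x : E3) : G.hat v x ^ 2 ≤ G.Mc * ∑ o, v (G.A o x) ^ 2 := by
  have := sq_sum_le_card_mul_sum_sq (s := Finset.univ) (f := fun o => G.sg o * v (G.A o x))
  rw [Finset.card_univ] at this
  simpa only [mul_pow, G.sg_sq, one_mul, hat, Mc] using this

lemma hat_grad {v : E3 → ℝ} (hv : Lip v) : ∀ᵐ x, ‖gradient (G.hat v) x‖ ^ 2 ≤ G.Mc * ∑ o, ‖gradient v (G.A o x)‖ ^ 2 := by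
  have : ∀ᵐ x, ∀ o, DifferentiableAt ℝ (fun y => v (G.A o y)) x :=
    ae_all_iff.2 fun o => ((G.A_ai o).lip hv).ae
  filter_upwards [this] with x hx
  have h1 : gradient (G.hat v) x = ∑ o, G.sg o • gradient (fun y => v (G.A o y)) x := by
    have := grad_sum (s := Finset.univ) (v := fun o y => G.sg o * v (G.A o y)) (x := x) fun o _ => (hx o).const_mul _
    change gradient (fun y => ∑ o, G.sg o * v (G.A o y)) x = _
    rw [this]
    exact Finset.sum_congr rfl fun o _ => grad_smul _ (hx o)
  rw [h1]
  refine (sum_sq _).trans (le_of_eq ?_)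
  congr 1
  refine Finset.sum_congr rfl fun o _ => ?_
  rw [norm_smul, mul_pow, Real.norm_eq_abs, sq_abs, G.sg_sq, one_mul, (G.A_ai o).norm_grad]

lemma hat_int {a b W : E3 → ℝ} {K : ℝ} (hW : BM W) (hK : ∀ o, ∀ x ∈ Ω, W (G.A o x) ≤ K * W x) (hW0 : ∀ x, 0 ≤ W x)
    (ha : Nice a) (ha0 : ∀ x, 0 ≤ a x) (haΩ : ∀ᵐ x, x ∉ Ω → a x = 0) (hb : Nice b)
    (hba : ∀ᵐ x, b x ≤ G.Mc * ∑ o, a (G.A o x)) :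
    ∫ x, W x * b x ≤ G.Mc ^ 2 * K * ∫ x, W x * a x := by
  have hMc := G.Mc_ge
  have i0 : ∀ o, Nice fun x => W x * a (G.A o x) := fun o => Nice.mul' hW ((G.A_ai o).nice ha)
  have h1 : ∀ o, ∫ x, W x * a (G.A o x) ≤ K * ∫ x, W x * a x := fun o => by
    rw [← G.A_int o W a, ← integral_const_mul]
    refine integral_mono_ae (Nice.mul' (hW.comp (G.A_ai o).meas) ha).integrable ((Nice.mul' hW ha).integrable.const_mul K) ?_
    filter_upwards [haΩ] with x hx
    by_cases h : x ∈ Ω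
    · have := mul_le_mul_of_nonneg_right (hK o x h) (ha0 x)
      linarith
    · simp [hx h]
  calc ∫ x, W x * b x ≤ ∫ x, G.Mc * ∑ o, W x * a (G.A o x) := by
        refine integral_mono_ae (Nice.mul' hW hb).integrable
          ((Nice.sum fun o _ => i0 o).integrable.const_mul _) ?_
        filter_upwards [hba] with x hx
        have := mul_le_mul_of_nonneg_left hx (hW0 x)
        rw [← Finset.mul_sum]; linarith
    _ = G.Mc * ∑ o, ∫ x, W x * a (G.A o x) := by
        rw [integral_const_mul, integral_finsetSum _ fun o _ => (i0 o).integrable]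
    _ ≤ G.Mc * ∑ _o : G.O, (K * ∫ x, W x * a x) := by gcongr with o; exact h1 o
    _ = _ := by rw [Finset.sum_const, Finset.card_univ, nsmul_eq_mul]; simp only [Mc]; ring

lemma hat_DD {v : E3 → ℝ} (hv : LC v) : DD (G.hat v) (G.hat v) ≤ G.Mc ^ 2 * DD v v := by
  have hMc := G.Mc_ge
  have i0 : ∀ o, Nice fun x => ‖gradient v (G.A o x)‖ ^ 2 := fun o => (G.A_ai o).nice hv.grad.norm.sq
  rw [DD_self, DD_self]
  calc _ ≤ ∫ x, G.Mc * ∑ o, ‖gradient v (G.A o x)‖ ^ 2 :=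
        integral_mono_ae (G.hat_lc hv).grad.norm.sq.integrable
          ((Nice.sum fun o _ => i0 o).integrable.const_mul _) (G.hat_grad hv.1)
    _ = G.Mc * ∑ o, ∫ x, ‖gradient v (G.A o x)‖ ^ 2 := by
        rw [integral_const_mul, integral_finsetSum _ fun o _ => (i0 o).integrable]
    _ = _ := by
        simp only [fun o => (G.A_ai o).integral fun x => ‖gradient v x‖ ^ 2]
        rw [Finset.sum_const, Finset.card_univ, nsmul_eq_mul]; simp only [Mc]; ring

lemma hat_L2 {v : E3 → ℝ} (hv : Nice v) : ∫ x, G.hat v x ^ 2 ≤ G.Mc ^ 2 * ∫ x, v x ^ 2 := by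
  have i0 : ∀ o, Nice fun x => v (G.A o x) ^ 2 := fun o => (G.A_ai o).nice hv.sq
  calc _ ≤ ∫ x, G.Mc * ∑ o, v (G.A o x) ^ 2 :=
        integral_mono (G.hat_nice hv).sq.integrable
          ((Nice.sum fun o _ => i0 o).integrable.const_mul _) (G.hat_sq v)
    _ = G.Mc * ∑ o, ∫ x, v (G.A o x) ^ 2 := by
        rw [integral_const_mul, integral_finsetSum _ fun o _ => (i0 o).integrable]
    _ = _ := by
        simp only [fun o => (G.A_ai o).integral fun x => v x ^ 2]
        rw [Finset.sum_const, Finset.card_univ, nsmul_eq_mul]; simp only [Mc]; ring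

lemma hat_adj_int {v w : E3 → ℝ} (hv : Nice v) (hw : Nice w) : ∫ x, G.hat v x * w x = ∫ x, v x * G.hat w x := by
  simp only [hat, Finset.sum_mul, Finset.mul_sum]
  rw [integral_finsetSum _ fun o _ => ((Nice.mul' (bm_const _) ((G.A_ai o).nice hv)).mul hw.bm).integrable,
    integral_finsetSum _ fun o _ => (hv.mul (Nice.mul' (bm_const _) ((G.A_ai o).nice hw)).bm).integrable]
  refine Finset.sum_congr rfl fun o _ => ?_
  have h1 : ∀ x, G.sg o * v (G.A o x) * w x = G.sg o * (v (G.A o x) * w x) := fun x => by ring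
  have h2 : ∀ x, v x * (G.sg o * w (G.A o x)) = G.sg o * (v x * w (G.A o x)) := fun x => by ring
  simp only [h1, h2]
  rw [integral_const_mul, integral_const_mul, G.A_int]

lemma _root_.DD_sum_right {ι : Type*} (s : Finset ι) {u : E3 → ℝ} {w : ι → E3 → ℝ} (hu : LC u) (hw : ∀ i, LC (w i)) :
    DD u (fun x => ∑ i ∈ s, w i x) = ∑ i ∈ s, DD u (w i) := by
  classical
  induction s using Finset.induction_on with
  | empty => simp [DD, gradient_fun_const]
  | insert i s hi ih =>
    simp only [Finset.sum_insert hi]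
    rw [DD_add_right hu (hw i) (LC.sum fun j _ => hw j), ih]

lemma hat_adj_DD {v w : E3 → ℝ} (hv : LC v) (hw : LC w) : DD (G.hat v) w = DD v (G.hat w) := by
  have h1 := DD_sum_right Finset.univ (u := v) hv fun o => ((G.A_ai o).lc hw).const_mul (G.sg o)
  have h2 := DD_sum_right Finset.univ (u := w) hw fun o => ((G.A_ai o).lc hv).const_mul (G.sg o)
  rw [DD_comm]
  change DD w (fun x => ∑ o, G.sg o * v (G.A o x)) = DD v (fun x => ∑ o, G.sg o * w (G.A o x))
  rw [h1, h2]
  refine Finset.sum_congr rfl fun o _ => ?_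
  rw [DD_smul_right _ ((G.A_ai o).lc hv), DD_smul_right _ ((G.A_ai o).lc hw), DD_comm, G.A_DD]

end Geo

/-! ### Cutoff and difference quotients -/

namespace Geo
variable {Ω : Set E3} (G : Geo Ω)

/-- The cutoff. -/
def eta (h : ℝ) (x : E3) : ℝ := min 1 (max 0 (4 * ((4 * G.d x + G.q x - 36 * h) / G.P h x)))

lemma eta_nonneg (h : ℝ) (x : E3) : 0 ≤ G.eta h x := le_min zero_le_one (le_max_left _ _)

lemma eta_le (h : ℝ) (x : E3) : G.eta h x ≤ 1 := min_le_left _ _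

lemma eta_abs (h : ℝ) (x : E3) : |G.eta h x| ≤ 1 := abs_le.2 ⟨by linarith [G.eta_nonneg h x], G.eta_le h x⟩

lemma m_lip (x y : E3) : |(4 * G.d x + G.q x) - (4 * G.d y + G.q y)| ≤ 6 * ‖x - y‖ := by
  have h1 := abs_le.1 (G.d_lip x y)
  have h2 := abs_le.1 (G.q_lip x y)
  exact abs_le.2 ⟨by linarith, by linarith⟩

lemma eta_lip_pt {h : ℝ} (hh : 0 < h) (x y : E3) : |G.eta h x - G.eta h y| ≤ 456 * (G.P h x)⁻¹ * ‖x - y‖ := by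
  have hx := G.P_pos hh x
  have hy := G.P_pos hh y
  set m : E3 → ℝ := fun z => 4 * G.d z + G.q z - 36 * h with hm
  have c1 : ∀ a b : ℝ, |min 1 (max 0 a) - min 1 (max 0 b)| ≤ |a - b| := fun a b =>
    (abs_min_sub_min_le_max 1 (max 0 a) 1 (max 0 b)).trans (by
      rw [sub_self, abs_zero]
      refine max_le (abs_nonneg _) ((abs_max_sub_max_le_max 0 a 0 b).trans ?_)
      rw [sub_self, abs_zero]
      exact max_le (abs_nonneg _) le_rfl)
  refine (c1 _ _).trans ?_
  have e1 : 4 * (m x / G.P h x) - 4 * (m y / G.P h y) =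
      4 * (G.P h x)⁻¹ * ((m x - m y) + m y / G.P h y * (G.P h y - G.P h x)) := by
    field_simp; ring
  change |4 * (m x / G.P h x) - 4 * (m y / G.P h y)| ≤ _
  rw [e1, abs_mul, abs_of_pos (by positivity)]
  have e2 : |m x - m y| ≤ 6 * ‖x - y‖ := by
    have := G.m_lip x y
    simp only [hm]
    rwa [sub_sub_sub_cancel_right]
  have e3 : |m y / G.P h y| ≤ 36 := by
    rw [abs_div, abs_of_pos hy, div_le_iff₀ hy]
    simp only [hm, P]
    have a1 := abs_le.1 (le_refl |G.d y|)
    have a2 := abs_le.1 (le_refl |G.q y|)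
    have a3 := abs_nonneg (G.d y)
    have a4 := abs_nonneg (G.q y)
    exact abs_le.2 ⟨by linarith, by linarith⟩
  have e4 : |m y / G.P h y * (G.P h y - G.P h x)| ≤ 36 * (3 * ‖x - y‖) := by
    rw [abs_mul, abs_sub_comm (G.P h y)]
    exact mul_le_mul e3 (G.P_lip h x y) (abs_nonneg _) (by norm_num)
  have e5 := (abs_add_le (m x - m y) (m y / G.P h y * (G.P h y - G.P h x))).trans (add_le_add e2 e4)
  calc _ ≤ 4 * (G.P h x)⁻¹ * (6 * ‖x - y‖ + 36 * (3 * ‖x - y‖)) := by gcongr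
    _ = _ := by ring

lemma eta_lip {h : ℝ} (hh : 0 < h) : Lip (G.eta h) := lip_of_le (456 * h⁻¹) fun x y =>
  (G.eta_lip_pt hh x y).trans (by gcongr; exact G.P_ge h x)

lemma eta_grad {h : ℝ} (hh : 0 < h) (x : E3) : ‖gradient (G.eta h) x‖ ≤ 456 * (G.P h x)⁻¹ := by
  have := G.P_pos hh x
  rw [norm_grad]
  refine norm_fderiv_le_of_lip' ℝ (by positivity) (Filter.Eventually.of_forall fun y => ?_)
  rw [Real.norm_eq_abs, abs_sub_comm, norm_sub_rev]
  exact G.eta_lip_pt hh x y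

lemma eta_zero {h : ℝ} (hh : 0 < h) {x : E3} (hx : 4 * G.d x + G.q x ≤ 36 * h) : G.eta h x = 0 := by
  have : (4 * G.d x + G.q x - 36 * h) / G.P h x ≤ 0 := div_nonpos_of_nonpos_of_nonneg (by linarith) (G.P_pos hh x).le
  unfold eta
  rw [max_eq_left (by linarith)]
  simp

lemma eta_one {h : ℝ} (hh : 0 < h) {z x : E3} (hz : z ∈ closure Ω) (hq : 202 * h ≤ G.q z) (hx : ‖x - z‖ ≤ 3 * h) :
    G.eta h x = 1 := by
  have h1 := G.closure_d hz
  have h2 := abs_le.1 (G.d_lip x z)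
  have h3 := abs_le.1 (G.q_lip x z)
  unfold eta
  apply min_eq_left
  apply le_max_of_le_right
  rw [← mul_div_assoc, le_div_iff₀ (G.P_pos hh x)]
  unfold P
  rw [abs_of_pos (by linarith : 0 < G.q x)]
  rcases abs_cases (G.d x) with h | h <;> linarith

lemma refl_small {z : E3} (hz : z ∈ closure Ω) {a j : Fin G.N} (haj : j ≠ a) (ha : G.l a z = 0) :
    4 * G.d (G.A (some j) z) + G.q (G.A (some j) z) ≤ 0 := by
  have h1 := G.l_nonneg hz j
  have h2 := G.d_le j (G.A (some j) z)
  have h3 := G.q_le haj (G.A (some j) z)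
  rw [G.l_A] at h2 h3
  have h4 : ‖G.A (some j) z - z‖ = 2 * G.l j z := by
    simp only [A]
    rw [sub_sub_cancel_left, norm_neg, norm_smul, G.rep.1, mul_one, Real.norm_of_nonneg (by positivity)]
  have h5 := (abs_le.1 (G.l_lip a (G.A (some j) z) z)).2
  linarith

/-- Odd reflected combination vanishes at the boundary when the function is supported away. -/
lemma hat_frontier {χ : E3 → ℝ} (hχ : ∀ x, 4 * G.d x + G.q x ≤ 0 → χ x = 0) {z : E3} (hz : z ∈ frontier Ω) :
    G.hat χ z = 0 := by
  obtain ⟨a, ha⟩ := G.d_ex z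
  rw [G.frontier_d hz] at ha
  have hA : G.A (some a) z = z := by simp [A, ha]
  unfold hat
  rw [Fintype.sum_option, Finset.sum_eq_single a, hA]
  · simp [sg, A]
  · intro j _ hj
    rw [hχ _ (G.refl_small (frontier_subset_closure hz) hj ha), mul_zero]
  · simp

lemma hat_ind_lip0 {χ : E3 → ℝ} (hL : LC χ) (hχ : ∀ x, 4 * G.d x + G.q x ≤ 0 → χ x = 0) :
    Lip0 Ω (Ω.indicator (G.hat χ)) := by
  obtain ⟨K, hK, h⟩ := (G.hat_lc hL).1.le
  exact lip0_ext hK (fun x _ y _ => h x y) fun z hz => G.hat_frontier hχ hz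

lemma grad_ind {v : E3 → ℝ} (hO : IsOpen Ω) {x : E3} (hx : x ∈ Ω) : gradient (Ω.indicator v) x = gradient v x := by
  have : Ω.indicator v =ᶠ[nhds x] v := by
    filter_upwards [hO.mem_nhds hx] with y hy
    exact indicator_of_mem hy _
  unfold gradient
  rw [this.fderiv_eq]

lemma nir_alg {X Y Z h M F ε Dc Q : ℝ} (hM : 1 ≤ M) (hε : 0 ≤ ε) (hε1 : ε ≤ 1 / (64 * M ^ 2)) (hh : 0 < h)
    (hX : 0 ≤ X) (hY : 0 ≤ Y)
    (h1 : X / 2 - 2 * Y ≤ Dc) (h2 : Z ≤ 2 * X + 8 * Y)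
    (h4 : Dc ≤ Q + ε * (1 + M ^ 2 * (4 * Z))) (h5 : Q ≤ 144 * (h ^ 2 * F) + Z / 16) : X ≤ 12 * Y + 576 * (h ^ 2 * F) + 4 * ε := by
  have : ε * (M ^ 2 * (4 * (2 * X + 8 * Y))) ≤ 1 / (64 * M ^ 2) * (M ^ 2 * (4 * (2 * X + 8 * Y))) := by gcongr
  have e : 1 / (64 * M ^ 2) * (M ^ 2 * (4 * (2 * X + 8 * Y))) = (2 * X + 8 * Y) / 16 := by
    field_simp; ring
  have : ε * (M ^ 2 * (4 * Z)) ≤ ε * (M ^ 2 * (4 * (2 * X + 8 * Y))) := by gcongr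
  linarith

/-- The discrete Nirenberg estimate. -/
lemma nirenberg {h : ℝ} (hh : 0 < h) {f : E3 → ℝ} (hf : Nice f) (hf0 : ∀ x, x ∉ Ω → f x = 0) {ε : ℝ} (hε : 0 ≤ ε)
    (hε1 : ε ≤ 1 / (64 * G.Mc ^ 2)) {φ : E3 → ℝ} (hφ : AppSol Ω f ε φ) {t : E3} (ht : ‖t‖ ≤ 6 * h) :
    ∫ x, G.eta h x ^ 2 * ‖gradient (G.hat φ) (x + t) - gradient (G.hat φ) x‖ ^ 2 ≤
      12 * (∫ x, (G.hat φ (x + t) - G.hat φ x) ^ 2 * ‖gradient (G.eta h) x‖ ^ 2) +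
        576 * (h ^ 2 * ∫ x, G.hat f x ^ 2) + 4 * ε := by
  have hM := G.Mc_ge
  have hL := G.hat_lc (hφ.1.lc G.dom)
  have hfh := G.hat_nice hf
  set w := G.hat φ with hw
  set η := G.eta h with hη
  have hηL := G.eta_lip hh
  have hηb : ∃ B, ∀ x, |η x| ≤ B := ⟨1, G.eta_abs h⟩
  set δ : E3 → ℝ := fun x => w (x + t) - w x with hδ
  have hδL : LC δ := (hL.trans t).sub hL
  set g : E3 → ℝ := fun x => δ x * η x * η x with hg
  have hgL : LC g := (hδL.mul hηL hηb).mul hηL hηb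
  set χ : E3 → ℝ := fun x => g (x + (-t)) - g x with hχ
  have hχL : LC χ := (hgL.trans (-t)).sub hgL
  have hχ0 : ∀ x, 4 * G.d x + G.q x ≤ 0 → χ x = 0 := fun x hx => by
    have e1 : η x = 0 := G.eta_zero hh (by linarith)
    have e2 : η (x + -t) = 0 := G.eta_zero hh (by
      have := (abs_le.1 (G.m_lip (x + -t) x)).2
      rw [add_sub_cancel_left, norm_neg] at this
      linarith)
    simp [hχ, hg, e1, e2]
  set ψ := Ω.indicator (G.hat χ) with hψ
  have hψL : Lip0 Ω ψ := G.hat_ind_lip0 hχL hχ0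
  have hgraddδ : ∀ᵐ x, gradient δ x = gradient w (x + t) - gradient w x := by
    filter_upwards [hL.1.ae, (hL.trans t).1.ae] with x h1 h2
    rw [← grad_trans w t x]
    exact grad_sub h2 h1
  have hgg : ∀ᵐ x, gradient g x = (η x ^ 2) • gradient δ x + (2 * η x * δ x) • gradient η x := by
    filter_upwards [hδL.1.ae, hηL.ae] with x h1 h2
    have e1 : gradient g x = _ := grad_mul (h1.fun_mul h2) h2
    rw [e1, grad_mul h1 h2]
    module
  set X := ∫ x, η x ^ 2 * ‖gradient δ x‖ ^ 2 with hX
  set Y := ∫ x, δ x ^ 2 * ‖gradient η x‖ ^ 2 with hY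
  have iX : Integrable fun x => η x ^ 2 * ‖gradient δ x‖ ^ 2 :=
    (Nice.mul' (BM.sq (BM.of_bdd 1 hηL.cont.measurable (G.eta_abs h))) hδL.grad.norm.sq).integrable
  have iY : Integrable fun x => δ x ^ 2 * ‖gradient η x‖ ^ 2 :=
    (hδL.nice.sq.mul hηL.grad_bm.norm.sq).integrable
  have hXe : ∫ x, η x ^ 2 * ‖gradient w (x + t) - gradient w x‖ ^ 2 = X := by
    apply integral_congr_ae
    filter_upwards [hgraddδ] with x hx
    rw [hx]
  rw [hXe]
  have hη1 : ∀ x, 0 ≤ η x ∧ η x ≤ 1 := fun x => ⟨G.eta_nonneg h x, G.eta_le h x⟩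
  have h1 : X / 2 - 2 * Y ≤ DD δ g := by
    have : X / 2 - 2 * Y = ∫ x, (η x ^ 2 * ‖gradient δ x‖ ^ 2 / 2 - 2 * (δ x ^ 2 * ‖gradient η x‖ ^ 2)) := by
      rw [integral_sub (iX.div_const 2) (iY.const_mul 2), integral_div, integral_const_mul]
    rw [this]
    refine integral_mono_ae ((iX.div_const 2).sub (iY.const_mul 2)) (hδL.ii hgL.1) ?_
    filter_upwards [hgg] with x hx
    rw [hx, inner_add_right, inner_smul_right, inner_smul_right, real_inner_self_eq_norm_sq]
    have := abs_le.1 (abs_real_inner_le_norm (gradient δ x) (gradient η x))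
    have e1 : |2 * η x * δ x * ⟪gradient δ x, gradient η x⟫| ≤ 2 * |η x * ‖gradient δ x‖| * |δ x * ‖gradient η x‖| := by
      rw [abs_mul, abs_mul, abs_mul, abs_mul, abs_mul, abs_two, abs_norm, abs_norm]
      have := abs_real_inner_le_norm (gradient δ x) (gradient η x)
      calc _ ≤ 2 * |η x| * |δ x| * (‖gradient δ x‖ * ‖gradient η x‖) := by gcongr
        _ = _ := by ring
    have e2 := (abs_le.1 e1).1
    have e3 := sq_nonneg (|η x * ‖gradient δ x‖| / 2 - |δ x * ‖gradient η x‖|)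
    have e4 := sq_abs (η x * ‖gradient δ x‖)
    have e5 := sq_abs (δ x * ‖gradient η x‖)
    nlinarith
  set Z := DD g g with hZ
  have h2 : Z ≤ 2 * X + 8 * Y := by
    have : 2 * X + 8 * Y = ∫ x, (2 * (η x ^ 2 * ‖gradient δ x‖ ^ 2) + 8 * (δ x ^ 2 * ‖gradient η x‖ ^ 2)) := by
      rw [integral_add (iX.const_mul 2) (iY.const_mul 8), integral_const_mul, integral_const_mul]
    rw [this, hZ, DD_self]
    refine integral_mono_ae hgL.grad.norm.sq.integrable ((iX.const_mul 2).add (iY.const_mul 8)) ?_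
    filter_upwards [hgg] with x hx
    simp only [hx]
    have e1 : ‖(η x ^ 2) • gradient δ x + (2 * η x * δ x) • gradient η x‖ ≤
        η x * ‖gradient δ x‖ + 2 * |δ x| * ‖gradient η x‖ := by
      refine (norm_add_le _ _).trans ?_
      rw [norm_smul, norm_smul, Real.norm_eq_abs, Real.norm_eq_abs, abs_mul, abs_mul, abs_two, abs_of_nonneg (sq_nonneg _), abs_of_nonneg (hη1 x).1]
      have a1 : η x ^ 2 ≤ η x := by nlinarith [(hη1 x).1, (hη1 x).2]
      have a2 : 2 * η x * |δ x| ≤ 2 * |δ x| := by nlinarith [(hη1 x).1, (hη1 x).2, abs_nonneg (δ x)]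
      gcongr
    have e2 := pow_le_pow_left₀ (norm_nonneg _) e1 2
    have e3 := sq_nonneg (η x * ‖gradient δ x‖ - 2 * |δ x| * ‖gradient η x‖)
    have e4 := sq_abs (δ x)
    have e5 : (2 * |δ x| * ‖gradient η x‖) ^ 2 = 4 * (δ x ^ 2 * ‖gradient η x‖ ^ 2) := by rw [mul_pow, mul_pow, e4]; ring
    nlinarith
  have hIg : ∫ x, χ x ^ 2 ≤ 36 * h ^ 2 * Z := by
    have := trans_sq_LC hgL (bm_const (1 : ℝ)) (bm_const (1 : ℝ)) (-t) (fun _ => zero_le_one) (fun _ => zero_le_one)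
      (fun _ _ _ _ => le_rfl)
    simp only [one_mul] at this
    rw [norm_neg, ← DD_self] at this
    refine this.trans ?_
    have : ‖t‖ ^ 2 ≤ (6 * h) ^ 2 := by gcongr
    have := DD_self_nonneg g
    nlinarith
  have hDDχ : DD χ χ ≤ 4 * Z := by
    rw [DD_self, hZ, DD_self]
    have i1 := hgL.grad.norm.sq.integrable
    have i2 := (hgL.grad.norm.sq.trans (-t)).integrable
    have : 4 * ∫ x, ‖gradient g x‖ ^ 2 = ∫ x, (2 * ‖gradient g (x + -t)‖ ^ 2 + 2 * ‖gradient g x‖ ^ 2) := by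
      rw [integral_add (i2.const_mul 2) (i1.const_mul 2), integral_const_mul, integral_const_mul,
        integral_add_right_eq_self (fun x => ‖gradient g x‖ ^ 2)]
      ring
    rw [this]
    refine integral_mono_ae hχL.grad.norm.sq.integrable ((i2.const_mul 2).add (i1.const_mul 2)) ?_
    filter_upwards [hgL.1.ae, (hgL.trans (-t)).1.ae] with x a1 a2
    have e : gradient χ x = gradient g (x + -t) - gradient g x := by
      rw [← grad_trans g (-t) x]
      exact grad_sub a2 a1
    simp only [e]
    have := norm_sub_le (gradient g (x + -t)) (gradient g x)
    have := pow_le_pow_left₀ (norm_nonneg _) this 2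
    nlinarith [sq_nonneg (‖gradient g (x + -t)‖ - ‖gradient g x‖)]
  have hDψ : DD ψ ψ ≤ G.Mc ^ 2 * (4 * Z) := by
    have : DD ψ ψ ≤ DD (G.hat χ) (G.hat χ) := by
      rw [DD_self, DD_self]
      refine integral_mono_ae (hψL.lc G.dom).grad.norm.sq.integrable (G.hat_lc hχL).grad.norm.sq.integrable ?_
      filter_upwards [G.dom.ae_grad hψL.2] with x hx
      by_cases hxO : x ∈ Ω
      · rw [hψ, grad_ind G.dom.1 hxO]
      · simp only [hx hxO, norm_zero]; exact (zero_pow two_ne_zero).le.trans (sq_nonneg _)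
    refine this.trans ((G.hat_DD hχL).trans ?_)
    gcongr
  have hDe : DD φ ψ = DD δ g := by
    have e1 : DD φ ψ = DD φ (G.hat χ) := by
      apply integral_congr_ae
      filter_upwards [G.dom.ae_grad hφ.1.2] with x hx
      by_cases hxO : x ∈ Ω
      · rw [hψ, grad_ind G.dom.1 hxO]
      · rw [hx hxO, inner_zero_left, inner_zero_left]
    have e3 : DD w (fun x => g (x + -t)) = DD (fun x => w (x + t)) g := by
      rw [← (ai_trans t).DD w (fun x => g (x + -t))]
      simp
    rw [e1, ← G.hat_adj_DD (hφ.1.lc G.dom) hχL, hχ, DD_sub_right hL (hgL.trans (-t)) hgL, e3, DD_comm _ g, DD_comm _ g,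
      DD_comm δ g, hδ, DD_sub_right hgL (hL.trans t) hL]
  have hfe : ∫ x, f x * ψ x = ∫ x, G.hat f x * χ x := by
    rw [G.hat_adj_int hf hχL.nice]
    congr 1; ext x
    by_cases hxO : x ∈ Ω
    · rw [hψ, indicator_of_mem hxO]
    · rw [hf0 x hxO]; simp
  have h5 : ∫ x, f x * ψ x ≤ 144 * (h ^ 2 * ∫ x, G.hat f x ^ 2) + Z / 16 := by
    rw [hfe]
    have i1 := hfh.sq.integrable
    have i2 := hχL.nice.sq.integrable
    have : ∫ x, G.hat f x * χ x ≤ ∫ x, (144 * h ^ 2 * G.hat f x ^ 2 + (576 * h ^ 2)⁻¹ * χ x ^ 2) := by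
      refine integral_mono (hfh.mul hχL.nice.bm).integrable ((i1.const_mul _).add (i2.const_mul _)) fun x => ?_
      have e := sq_nonneg (12 * h * G.hat f x - (24 * h)⁻¹ * χ x)
      have e' : (12 * h * G.hat f x - (24 * h)⁻¹ * χ x) ^ 2 = 144 * h ^ 2 * G.hat f x ^ 2 + (576 * h ^ 2)⁻¹ * χ x ^ 2 - G.hat f x * χ x := by
        field_simp; ring
      simp only
      linarith
    rw [integral_add (i1.const_mul _) (i2.const_mul _), integral_const_mul, integral_const_mul] at this
    have a : (576 * h ^ 2)⁻¹ * ∫ x, χ x ^ 2 ≤ (576 * h ^ 2)⁻¹ * (36 * h ^ 2 * Z) := by gcongr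
    have b : (576 * h ^ 2)⁻¹ * (36 * h ^ 2 * Z) = Z / 16 := by field_simp; ring
    linarith
  have h4 : DD δ g ≤ (∫ x, f x * ψ x) + ε * (1 + G.Mc ^ 2 * (4 * Z)) := by
    have a := (abs_le.1 (hφ.2 ψ hψL)).2
    have b : ε * (1 + DD ψ ψ) ≤ ε * (1 + G.Mc ^ 2 * (4 * Z)) := by gcongr
    rw [hDe] at a
    linarith
  exact nir_alg hM hε hε1 hh (integral_nonneg fun x => by positivity) (integral_nonneg fun x => by positivity) h1 h2 h4 h5

/-- Summary of the regularity theory. -/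
lemma regularity : ∃ C c₀ : ℝ, 0 < C ∧ 0 < c₀ ∧ ∀ h, 0 < h → ∀ f, Nice f → (∀ x, x ∉ Ω → f x = 0) → ∀ ε, 0 ≤ ε →
    ε ≤ c₀ * h ^ 2 → ε ≤ c₀ → ∀ φ, AppSol Ω f ε φ →
      (∫ x, (G.P h x)⁻¹ ^ 2 * ‖gradient (G.hat φ) x‖ ^ 2 ≤ C * ((∫ x, f x ^ 2) + ε + DD φ φ)) ∧
      (∫ x, (G.P h x)⁻¹ ^ 4 * G.hat φ x ^ 2 ≤ C * ((∫ x, f x ^ 2) + ε + DD φ φ)) ∧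
      ∀ t : E3, ‖t‖ ≤ 6 * h → ∫ x, G.eta h x ^ 2 * ‖gradient (G.hat φ) (x + t) - gradient (G.hat φ) x‖ ^ 2 ≤
        C * (h ^ 2 * ((∫ x, f x ^ 2) + ε + DD φ φ) + ε) := by
  obtain ⟨C, c₀, hC, hc, H⟩ := G.hardy
  have hM := G.Mc_ge
  set M := G.Mc with hMd
  set C1 : ℝ := M ^ 2 * 7 ^ 4 * C with hC1
  have hC1p : 0 < C1 := by positivity
  set C2 : ℝ := 12 * 456 ^ 2 * 36 * 361 * C1 + 576 * M ^ 2 + 4 with hC2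
  have hC2p : 0 < C2 := by positivity
  refine ⟨C1 + C2, min c₀ (1 / (64 * M ^ 2)), by positivity, lt_min hc (by positivity), ?_⟩
  intro h hh f hf hf0 ε hε hε1 hε2 φ hφ
  have hφL := hφ.1.lc G.dom
  set E := (∫ x, f x ^ 2) + ε + DD φ φ with hE
  have hf2 : 0 ≤ ∫ x, f x ^ 2 := integral_nonneg fun x => sq_nonneg _
  have hD := DD_self_nonneg φ
  have hE0 : 0 ≤ E := by positivity
  have H1 := H h hh f hf ε hε (hε1.trans (by gcongr; exact min_le_left _ _)) φ hφ
  have hPi := G.P_inv_bm hh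
  have hPA : ∀ o, ∀ x ∈ Ω, (G.P h (G.A o x))⁻¹ ≤ 7 * (G.P h x)⁻¹ := fun o x hx => by
    have := G.P_A hh o hx
    have a := G.P_pos hh x
    have b := G.P_pos hh (G.A o x)
    rw [← div_eq_mul_inv, inv_le_comm₀ b (by positivity), inv_div]
    linarith
  have n1 : 0 ≤ ∫ x, (G.P h x)⁻¹ ^ 2 * ‖gradient φ x‖ ^ 2 := integral_nonneg fun x => by positivity
  have n2 : 0 ≤ ∫ x, (G.P h x)⁻¹ ^ 4 * φ x ^ 2 := integral_nonneg fun x => by positivity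
  have A1 : ∫ x, (G.P h x)⁻¹ ^ 2 * ‖gradient (G.hat φ) x‖ ^ 2 ≤ C1 * E := by
    have := G.hat_int (W := fun x => (G.P h x)⁻¹ ^ 2) (K := 7 ^ 2) (a := fun x => ‖gradient φ x‖ ^ 2)
      (b := fun x => ‖gradient (G.hat φ) x‖ ^ 2) hPi.sq (fun o x hx => by
        rw [← mul_pow]; have := G.P_pos hh (G.A o x); gcongr; exact hPA o x hx) (fun x => by positivity) hφL.grad.norm.sq (fun x => by positivity)
        (grad_sq_ae G.dom hφ.1) (G.hat_lc hφL).grad.norm.sq (G.hat_grad hφL.1)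
    refine this.trans ?_
    calc _ ≤ M ^ 2 * 7 ^ 2 * (C * E) := by gcongr; linarith
      _ ≤ C1 * E := by rw [hC1]; nlinarith [show 0 ≤ M ^ 2 * (C * E) by positivity]
  have A2 : ∫ x, (G.P h x)⁻¹ ^ 4 * G.hat φ x ^ 2 ≤ C1 * E := by
    have hb4 : BM fun x => (G.P h x)⁻¹ ^ 4 := by
      have := hPi.sq.sq
      simpa only [← pow_mul] using this
    have := G.hat_int (W := fun x => (G.P h x)⁻¹ ^ 4) (K := 7 ^ 4) (a := fun x => φ x ^ 2)
      (b := fun x => (G.hat φ x) ^ 2) hb4 (fun o x hx => by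
        rw [← mul_pow]; have := G.P_pos hh (G.A o x); gcongr; exact hPA o x hx) (fun x => by positivity) hφL.nice.sq (fun x => by positivity)
        (Filter.Eventually.of_forall fun x hx => by simp [hφ.1.2 x hx]) (G.hat_lc hφL).nice.sq
        (Filter.Eventually.of_forall fun x => G.hat_sq φ x)
    refine this.trans ?_
    calc _ ≤ M ^ 2 * 7 ^ 4 * (C * E) := by gcongr; linarith
      _ = C1 * E := by rw [hC1]; ring
  have n3 : 0 ≤ C2 * E := by positivity
  refine ⟨by linarith, by linarith, fun t ht => ?_⟩
  refine (G.nirenberg hh hf hf0 hε (hε2.trans (min_le_right _ _)) hφ ht).trans ?_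
  have B1 := G.hat_L2 hf
  have B2 : ∫ x, (G.hat φ (x + t) - G.hat φ x) ^ 2 * ‖gradient (G.eta h) x‖ ^ 2 ≤
      456 ^ 2 * (‖t‖ ^ 2 * (361 * (C1 * E))) := by
    have hLh := G.hat_lc hφL
    have hδ : LC (fun x => G.hat φ (x + t) - G.hat φ x) := (hLh.trans t).sub hLh
    have s1 : ∫ x, (G.hat φ (x + t) - G.hat φ x) ^ 2 * ‖gradient (G.eta h) x‖ ^ 2 ≤
        ∫ x, 456 ^ 2 * ((G.P h x)⁻¹ ^ 2 * (G.hat φ (x + t) - G.hat φ x) ^ 2) := by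
      refine integral_mono (hδ.nice.sq.mul (G.eta_lip hh).grad_bm.norm.sq).integrable
        ((Nice.mul' hPi.sq hδ.nice.sq).integrable.const_mul _) fun x => ?_
      have := pow_le_pow_left₀ (norm_nonneg _) (G.eta_grad hh x) 2
      calc _ ≤ (G.hat φ (x + t) - G.hat φ x) ^ 2 * (456 * (G.P h x)⁻¹) ^ 2 := by gcongr
        _ = _ := by ring
    refine s1.trans ?_
    rw [integral_const_mul]
    have s2 := trans_sq_LC hLh (W := fun x => (G.P h x)⁻¹ ^ 2) (W' := fun x => 361 * (G.P h x)⁻¹ ^ 2) hPi.sq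
      ((bm_const (361 : ℝ)).mul hPi.sq) t (fun x => by positivity) (fun x => by positivity) (fun x s hs0 hs1 => by
        have a := G.P_pos hh x
        have b := G.P_pos hh (x - s • t)
        have c := (abs_le.1 (G.P_lip h x (x - s • t))).2
        rw [sub_sub_cancel, norm_smul, Real.norm_of_nonneg hs0] at c
        have d := G.P_ge h (x - s • t)
        have e : s * ‖t‖ ≤ 1 * (6 * h) := by gcongr
        have e2 : (G.P h (x - s • t))⁻¹ ≤ 19 * (G.P h x)⁻¹ := by
          rw [← div_eq_mul_inv, inv_le_comm₀ b (by positivity), inv_div]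
          linarith
        calc _ ≤ (19 * (G.P h x)⁻¹) ^ 2 := by gcongr
          _ = _ := by ring)
    refine mul_le_mul_of_nonneg_left (s2.trans ?_) (by norm_num)
    refine mul_le_mul_of_nonneg_left ?_ (by positivity)
    simp only [mul_assoc]
    rw [integral_const_mul]
    linarith
  have B3 : ‖t‖ ^ 2 ≤ 36 * h ^ 2 := by
    calc _ ≤ (6 * h) ^ 2 := by gcongr
      _ = _ := by ring
  have B4 : 456 ^ 2 * (‖t‖ ^ 2 * (361 * (C1 * E))) ≤ 456 ^ 2 * (36 * h ^ 2 * (361 * (C1 * E))) := by gcongr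
  have B5 : h ^ 2 * ∫ x, G.hat f x ^ 2 ≤ h ^ 2 * (M ^ 2 * E) := by
    gcongr
    refine B1.trans ?_
    gcongr
    linarith
  have n4 : 0 ≤ C1 * (h ^ 2 * E + ε) := by positivity
  have n5 : 0 ≤ (12 * 456 ^ 2 * 36 * 361 * C1 + 576 * M ^ 2) * ε := by positivity
  have n6 : 0 ≤ 4 * (h ^ 2 * E) := by positivity
  have : (C1 + C2) * (h ^ 2 * E + ε) = C1 * (h ^ 2 * E + ε) + 12 * (456 ^ 2 * (36 * h ^ 2 * (361 * (C1 * E)))) + 576 * (h ^ 2 * (M ^ 2 * E)) + 4 * (h ^ 2 * E) + (12 * 456 ^ 2 * 36 * 361 * C1 + 576 * M ^ 2) * ε + 4 * ε := by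
    rw [hC2]; ring
  rw [this]
  linarith
end Geo

/-! ### Polynomials -/

/-- Polynomial functions. -/
def pe (p : MvPolynomial (Fin 3) ℝ) (x : E3) : ℝ := MvPolynomial.eval (fun i => x i) p

lemma pe_contDiff (p : MvPolynomial (Fin 3) ℝ) : ContDiff ℝ 2 (pe p) := by
  induction p using MvPolynomial.induction_on with
  | C a =>
    have e : pe (MvPolynomial.C a) = fun _ => a := by ext x; simp [pe]
    rw [e]; exact contDiff_const
  | add p q hp hq =>
    have e : pe (p + q) = fun x => pe p x + pe q x := by ext x; simp [pe]
    rw [e]; exact hp.add hq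
  | mul_X p i hp =>
    have : ContDiff ℝ 2 fun x : E3 => x i := by fun_prop
    have h := hp.mul this
    have e : pe (p * MvPolynomial.X i) = fun x => pe p x * x i := by ext x; simp [pe]
    rw [e]; exact h

lemma pe_diff (p : MvPolynomial (Fin 3) ℝ) : Differentiable ℝ (pe p) := (pe_contDiff p).differentiable (by norm_num)

lemma pe_gcont (p : MvPolynomial (Fin 3) ℝ) : Continuous (gradient (pe p)) := by
  unfold gradient
  exact (LinearIsometryEquiv.continuous _).comp ((pe_contDiff p).continuous_fderiv (by norm_num))

/-- Affine substitution. -/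
lemma pe_affine {r : ℕ} {p : MvPolynomial (Fin 3) ℝ} (hp : p.totalDegree ≤ r) (x0 : E3) (h : ℝ) :
    ∃ q : MvPolynomial (Fin 3) ℝ, q.totalDegree ≤ r ∧ ∀ y, pe q y = pe p (x0 + h • y) := by
  let g : Fin 3 → MvPolynomial (Fin 3) ℝ := fun i => MvPolynomial.C (x0 i) + MvPolynomial.C h * MvPolynomial.X i
  have hg : ∀ i, (g i).totalDegree ≤ 1 := fun i => by
    refine (MvPolynomial.totalDegree_add _ _).trans (max_le (by simp) ((MvPolynomial.totalDegree_mul _ _).trans (by simp)))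
  refine ⟨MvPolynomial.bind₁ g p, ?_, fun y => ?_⟩
  · rw [p.as_sum, map_sum]
    refine MvPolynomial.totalDegree_finsetSum_le fun d hd => ?_
    rw [MvPolynomial.bind₁_monomial]
    refine (MvPolynomial.totalDegree_mul _ _).trans ?_
    rw [MvPolynomial.totalDegree_C, zero_add]
    refine (MvPolynomial.totalDegree_finsetProd _ _).trans ?_
    refine le_trans ?_ ((MvPolynomial.le_totalDegree hd).trans hp)
    refine Finset.sum_le_sum fun i _ => (MvPolynomial.totalDegree_pow _ _).trans ?_
    exact (Nat.mul_le_mul_left _ (hg i)).trans (by simp)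
  · simp only [pe, MvPolynomial.eval, MvPolynomial.eval₂Hom_bind₁]
    congr 2
    ext i
    simp [g]

/-- The affine polynomial. -/
lemma pe_lin (a : ℝ) (g : E3) : ∃ q : MvPolynomial (Fin 3) ℝ, q.totalDegree ≤ 1 ∧ ∀ y, pe q y = a + ⟪g, y⟫ := by
  refine ⟨MvPolynomial.C a + ∑ i, MvPolynomial.C (g i) * MvPolynomial.X i, ?_, fun y => ?_⟩
  · refine (MvPolynomial.totalDegree_add _ _).trans (max_le (by simp) (MvPolynomial.totalDegree_finsetSum_le fun i _ =>
      (MvPolynomial.totalDegree_mul _ _).trans (by simp)))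
  · simp [pe, PiLp.inner_apply, mul_comm]

lemma qf_lower {ι : Type*} [Fintype ι] (M : ι → ι → ℝ) (hpos : ∀ a : ι → ℝ, a ≠ 0 → 0 < ∑ i, ∑ j, a i * a j * M i j) :
    ∃ m : ℝ, 0 < m ∧ ∀ a : ι → ℝ, m * ∑ i, a i ^ 2 ≤ ∑ i, ∑ j, a i * a j * M i j := by
  let Q : EuclideanSpace ℝ ι → ℝ := fun a => ∑ i, ∑ j, a i * a j * M i j
  have hQ : Continuous Q := by fun_prop
  rcases (sphere (0 : EuclideanSpace ℝ ι) 1).eq_empty_or_nonempty with he | hne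
  · refine ⟨1, one_pos, fun a => ?_⟩
    have : a = 0 := by
      by_contra ha
      have h1 : (WithLp.toLp 2 a : EuclideanSpace ℝ ι) ≠ 0 := fun h => ha (by simpa using h)
      have : (‖(WithLp.toLp 2 a : EuclideanSpace ℝ ι)‖⁻¹ • (WithLp.toLp 2 a : EuclideanSpace ℝ ι)) ∈ sphere (0 : EuclideanSpace ℝ ι) 1 := by
        rw [mem_sphere_zero_iff_norm]; exact norm_smul_inv_norm (𝕜 := ℝ) h1
      rw [he] at this
      exact this
    simp [this]
  · obtain ⟨a0, ha0, hmin⟩ := (isCompact_sphere (0 : EuclideanSpace ℝ ι) 1).exists_isMinOn hne hQ.continuousOn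
    refine ⟨Q a0, hpos (fun i => a0 i) fun h => ?_, fun a => ?_⟩
    · have : a0 = 0 := by ext i; exact congrFun h i
      rw [this] at ha0
      simp at ha0
    · rcases eq_or_ne a 0 with rfl | ha
      · simp
      set A : EuclideanSpace ℝ ι := WithLp.toLp 2 a with hA
      have h1 : A ≠ 0 := fun h => ha (by simpa [hA] using h)
      have h2 := norm_pos_iff.2 h1
      have := hmin (a := ‖A‖⁻¹ • A) (by rw [mem_sphere_zero_iff_norm]; exact norm_smul_inv_norm (𝕜 := ℝ) h1)
      have e1 : Q (‖A‖⁻¹ • A) = (‖A‖⁻¹) ^ 2 * ∑ i, ∑ j, a i * a j * M i j := by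
        simp only [Q, Finset.mul_sum]
        refine Finset.sum_congr rfl fun i _ => Finset.sum_congr rfl fun j _ => ?_
        simp [hA]; ring
      have e2 : ∑ i, a i ^ 2 = ‖A‖ ^ 2 := by simp [EuclideanSpace.norm_sq_eq, hA]
      have e3 : Q a0 ≤ Q (‖A‖⁻¹ • A) := this
      rw [e1] at e3
      rw [e2]
      calc _ ≤ ((‖A‖⁻¹) ^ 2 * ∑ i, ∑ j, a i * a j * M i j) * ‖A‖ ^ 2 := by gcongr
        _ = _ := by field_simp

lemma pe_second (p : MvPolynomial (Fin 3) ℝ) : ∃ K : ℝ, 0 ≤ K ∧ ∀ y : E3, ‖y‖ ≤ 1 → ∀ s : ℝ, 0 ≤ s → s ≤ 1 → ∀ e : E3, ‖e‖ ≤ 1 →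
    |pe p (y + s • e) + pe p (y - s • e) - 2 * pe p y| ≤ K * s ^ 2 := by
  have hc1 : ContDiff ℝ 1 (fderiv ℝ (pe p)) := (pe_contDiff p).fderiv_right (by norm_num)
  obtain ⟨K, hK⟩ := (isCompact_closedBall (0 : E3) 3).exists_bound_of_continuousOn
    (hc1.continuous_fderiv (by norm_num)).continuousOn
  have hK0 : 0 ≤ K := (norm_nonneg _).trans (hK 0 (by simp))
  have hlip : ∀ a ∈ closedBall (0 : E3) 3, ∀ b ∈ closedBall (0 : E3) 3, ‖fderiv ℝ (pe p) b - fderiv ℝ (pe p) a‖ ≤ K * ‖b - a‖ :=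
    fun a ha b hb => (convex_closedBall (0 : E3) 3).norm_image_sub_le_of_norm_fderiv_le (𝕜 := ℝ)
      (fun x _ => (hc1.differentiable (by norm_num)) x) hK ha hb
  refine ⟨K, hK0, fun y hy s hs0 hs1 e he => ?_⟩
  have hse : ‖s • e‖ ≤ s := by
    rw [norm_smul, Real.norm_of_nonneg hs0]; nlinarith [norm_nonneg e]
  have hd : ∀ x, HasFDerivAt (fun x => pe p x - pe p (x - s • e)) (fderiv ℝ (pe p) x - fderiv ℝ (pe p) (x - s • e)) x := fun x => by
    have h2 : HasFDerivAt (fun x => pe p (x - s • e)) (fderiv ℝ (pe p) (x - s • e)) x := by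
      have := ((pe_diff p) (x - s • e)).hasFDerivAt.comp x ((hasFDerivAt_id x).sub_const (s • e))
      simpa using! this
    exact ((pe_diff p) x).hasFDerivAt.sub h2
  have := (convex_closedBall (0 : E3) 2).norm_image_sub_le_of_norm_hasFDerivWithin_le (𝕜 := ℝ) (C := K * s)
    (f := fun x => pe p x - pe p (x - s • e)) (x := y) (y := y + s • e)
    (fun x _ => (hd x).hasFDerivWithinAt) (fun x hx => by
      rw [mem_closedBall_zero_iff] at hx
      have := hlip (x - s • e) (by rw [mem_closedBall_zero_iff]; linarith [norm_sub_le x (s • e)]) x (by rw [mem_closedBall_zero_iff]; linarith)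
      rw [sub_sub_cancel] at this
      exact this.trans (by gcongr)) (by rw [mem_closedBall_zero_iff]; linarith)
      (by rw [mem_closedBall_zero_iff]; linarith [norm_add_le y (s • e)])
  simp only [add_sub_cancel_right, add_sub_cancel_left, Real.norm_eq_abs] at this
  calc _ = |pe p (y + s • e) - pe p y - (pe p y - pe p (y - s • e))| := by congr 1; ring
    _ ≤ _ := this
    _ ≤ K * s * s := by gcongr
    _ = _ := by ring

lemma pe_sum {n : ℕ} (b : Fin n → MvPolynomial (Fin 3) ℝ) (a : Fin n → ℝ) (x : E3) :
    pe (∑ i, a i • b i) x = ∑ i, a i * pe (b i) x := by simp [pe, MvPolynomial.smul_eval]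

lemma pe_sum_grad {n : ℕ} (b : Fin n → MvPolynomial (Fin 3) ℝ) (a : Fin n → ℝ) (x : E3) :
    gradient (pe (∑ i, a i • b i)) x = ∑ i, a i • gradient (pe (b i)) x := by
  have : pe (∑ i, a i • b i) = fun x => ∑ i, a i * pe (b i) x := by ext x; exact pe_sum b a x
  rw [this, grad_sum fun i _ => ((pe_diff (b i)) x).const_mul _]
  exact Finset.sum_congr rfl fun i _ => grad_smul _ (pe_diff (b i) x)

lemma pe_zero {p : MvPolynomial (Fin 3) ℝ} {c : ℝ} (hc : 0 < c) (h0 : pe p 0 = 0)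
    (hI : ∫ x in closedBall (0 : E3) c, ‖gradient (pe p) x‖ ^ 2 = 0) : p = 0 := by
  have hcont : Continuous fun x => ‖gradient (pe p) x‖ ^ 2 := (pe_gcont p).norm.pow 2
  have h1 : ∀ x ∈ ball (0 : E3) c, ‖gradient (pe p) x‖ ^ 2 = 0 := by
    have h2 := (setIntegral_eq_zero_iff_of_nonneg_ae (Filter.Eventually.of_forall fun x => by positivity)
      (hcont.continuousOn.integrableOn_compact (isCompact_closedBall _ _))).1 hI
    have h3 := ae_restrict_of_ae_restrict_of_subset (ball_subset_closedBall (x := (0 : E3)) (ε := c)) h2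
    exact Measure.eqOn_open_of_ae_eq h3 isOpen_ball hcont.continuousOn continuousOn_const
  have h2 : ∀ x ∈ ball (0 : E3) c, pe p x = 0 := fun x hx => by
    have := (convex_ball (0 : E3) c).norm_image_sub_le_of_norm_fderiv_le (𝕜 := ℝ) (f := pe p) (C := 0) (x := 0) (y := x)
      (fun y _ => pe_diff p y) (fun y hy => by
        rw [← norm_grad]; exact (pow_eq_zero_iff two_ne_zero).1 (h1 y hy) |>.le) (mem_ball_self hc) hx
    rw [h0, zero_mul, sub_zero] at this
    exact norm_le_zero_iff.1 this
  refine MvPolynomial.funext_set (fun _ => Ioo 0 (c / 2)) (fun _ => Ioo_infinite (by positivity)) fun x hx => ?_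
  rw [map_zero]
  refine h2 (WithLp.toLp 2 x) ?_
  rw [mem_ball_zero_iff, EuclideanSpace.norm_eq, Real.sqrt_lt' hc]
  simp only [Real.norm_eq_abs, sq_abs, Fin.sum_univ_three]
  have a : ∀ i, x i ^ 2 ≤ (c / 2) ^ 2 := fun i => by
    have := hx i (mem_univ i)
    exact pow_le_pow_left₀ this.1.le this.2.le 2
  nlinarith [a 0, a 1, a 2]

lemma poly_ref (r : ℕ) {c : ℝ} (hc : 0 < c) : ∃ C : ℝ, 0 < C ∧ ∀ p : MvPolynomial (Fin 3) ℝ, p.totalDegree ≤ r →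
    (∀ y : E3, ‖y‖ ≤ 1 → ‖gradient (pe p) y‖ ^ 2 ≤ C * ∫ x in closedBall (0 : E3) c, ‖gradient (pe p) x‖ ^ 2) ∧
    (∀ y : E3, ‖y‖ ≤ 1 → ∀ s : ℝ, 0 ≤ s → s ≤ 1 → ∀ e : E3, ‖e‖ ≤ 1 →
      (pe p (y + s • e) + pe p (y - s • e) - 2 * pe p y) ^ 2 ≤ C * s ^ 4 * ∫ x in closedBall (0 : E3) c, ‖gradient (pe p) x‖ ^ 2) := by
  let V := MvPolynomial.restrictTotalDegree (Fin 3) ℝ r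
  let B := Module.finBasis ℝ V
  let b : Fin (Module.finrank ℝ V) → MvPolynomial (Fin 3) ℝ := fun i => (B i : MvPolynomial (Fin 3) ℝ)
  have hint : ∀ i j, IntegrableOn (fun x => ⟪gradient (pe (b i)) x, gradient (pe (b j)) x⟫) (closedBall (0 : E3) c) := fun i j =>
    (((pe_gcont _).inner (pe_gcont _)).continuousOn).integrableOn_compact (isCompact_closedBall _ _)
  let M := fun i j => pe (b i) 0 * pe (b j) 0 + ∫ x in closedBall (0 : E3) c, ⟪gradient (pe (b i)) x, gradient (pe (b j)) x⟫
  have hM : ∀ a : Fin (Module.finrank ℝ V) → ℝ, ∑ i, ∑ j, a i * a j * M i j =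
      pe (∑ i, a i • b i) 0 ^ 2 + ∫ x in closedBall (0 : E3) c, ‖gradient (pe (∑ i, a i • b i)) x‖ ^ 2 := fun a => by
    have e1 : ∀ x, ‖gradient (pe (∑ i, a i • b i)) x‖ ^ 2 = ∑ i, ∑ j, a i * a j * ⟪gradient (pe (b i)) x, gradient (pe (b j)) x⟫ := fun x => by
      rw [pe_sum_grad, ← real_inner_self_eq_norm_sq, sum_inner]
      refine Finset.sum_congr rfl fun i _ => ?_
      rw [inner_sum]
      refine Finset.sum_congr rfl fun j _ => ?_
      rw [inner_smul_left, inner_smul_right]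
      simp; ring
    simp only [e1]
    rw [integral_finsetSum _ fun i _ => integrable_finsetSum _ fun j _ => (hint i j).const_mul _, pe_sum, sq, Finset.sum_mul_sum, ← Finset.sum_add_distrib]
    refine Finset.sum_congr rfl fun i _ => ?_
    rw [integral_finsetSum _ fun j _ => (hint i j).const_mul _, ← Finset.sum_add_distrib]
    refine Finset.sum_congr rfl fun j _ => ?_
    rw [integral_const_mul]
    simp only [M]; ring
  obtain ⟨m, hm, hlow⟩ := qf_lower M fun a ha => by
    rw [hM]
    by_contra hn
    have n1 : 0 ≤ ∫ x in closedBall (0 : E3) c, ‖gradient (pe (∑ i, a i • b i)) x‖ ^ 2 := integral_nonneg fun x => by positivity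
    have n2 := sq_nonneg (pe (∑ i, a i • b i) 0)
    have z := pe_zero hc (by nlinarith : pe (∑ i, a i • b i) 0 = 0) (by linarith)
    apply ha
    have hli := Fintype.linearIndependent_iff.1 B.linearIndependent a (by
      apply Subtype.ext
      simpa [b] using z)
    exact funext hli
  choose K hK0 hK using fun i => pe_second (b i)
  choose K' hK' using fun i => (isCompact_closedBall (0 : E3) 1).exists_bound_of_continuousOn (pe_gcont (b i)).continuousOn
  set KK : ℝ := ∑ i, (K i ^ 2 + K' i ^ 2) with hKK
  have hKK0 : 0 ≤ KK := Finset.sum_nonneg fun i _ => by positivity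
  refine ⟨(KK + 1) / m, by positivity, fun p hp => ?_⟩
  set p' := p - MvPolynomial.C (pe p 0) with hp'
  have e0 : ∀ x, pe p' x = pe p x - pe p 0 := fun x => by simp [hp', pe]
  have eg : ∀ x, gradient (pe p') x = gradient (pe p) x := fun x => by
    have : pe p' = fun x => pe p x - pe p 0 := funext e0
    rw [this]
    unfold gradient
    rw [fderiv_sub_const]
  have hp'V : p' ∈ V := by
    rw [MvPolynomial.mem_restrictTotalDegree]
    exact (MvPolynomial.totalDegree_sub _ _).trans (max_le hp (by simp))
  set a := B.repr ⟨p', hp'V⟩ with ha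
  have hpa : ∑ i, a i • b i = p' := by
    have := congrArg V.subtype (B.sum_repr ⟨p', hp'V⟩)
    rw [map_sum] at this
    exact this
  have hS : m * ∑ i, a i ^ 2 ≤ ∫ x in closedBall (0 : E3) c, ‖gradient (pe p) x‖ ^ 2 := by
    have := hlow a
    rw [hM, hpa, e0, sub_self] at this
    simpa only [eg, zero_pow two_ne_zero, zero_add] using this
  set S := ∫ x in closedBall (0 : E3) c, ‖gradient (pe p) x‖ ^ 2 with hSd
  have cs : ∀ L : Fin (Module.finrank ℝ V) → ℝ, (∀ i, L i ^ 2 ≤ K i ^ 2 + K' i ^ 2) → ∀ z : ℝ, |z| ≤ ∑ i, |a i| * L i → z ^ 2 ≤ (KK + 1) / m * S := fun L hL z hz => by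
    calc z ^ 2 = |z| ^ 2 := (sq_abs z).symm
      _ ≤ (∑ i, |a i| * L i) ^ 2 := by gcongr
      _ ≤ (∑ i, |a i| ^ 2) * ∑ i, L i ^ 2 := Finset.sum_mul_sq_le_sq_mul_sq _ _ _
      _ ≤ (S / m) * (KK + 1) := by
        have h1 : ∑ i, |a i| ^ 2 ≤ S / m := by
          rw [le_div_iff₀ hm]; simp only [sq_abs]; linarith
        have h2 : ∑ i, L i ^ 2 ≤ KK + 1 := by
          have := Finset.sum_le_sum fun i (_ : i ∈ Finset.univ) => hL i
          linarith
        have h3 : 0 ≤ ∑ i, |a i| ^ 2 := Finset.sum_nonneg fun i _ => by positivity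
        exact mul_le_mul h1 h2 (Finset.sum_nonneg fun i _ => by positivity) (h3.trans h1)
      _ = _ := by ring
  constructor
  · intro y hy
    refine cs K' (fun i => by nlinarith [sq_nonneg (K i)]) _ ?_
    rw [abs_norm, ← eg, ← hpa, pe_sum_grad]
    refine (norm_sum_le _ _).trans (Finset.sum_le_sum fun i _ => ?_)
    rw [norm_smul, Real.norm_eq_abs]
    have := hK' i y (by simpa using hy)
    gcongr
  · intro y hy s hs0 hs1 e he
    rcases hs0.eq_or_lt with rfl | hs
    · simp; ring
    have := cs K (fun i => by nlinarith [sq_nonneg (K' i)]) ((pe p (y + s • e) + pe p (y - s • e) - 2 * pe p y) / s ^ 2) ?_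
    · rw [div_pow, div_le_iff₀ (by positivity)] at this
      calc _ ≤ _ := this
        _ = _ := by ring
    · rw [abs_div, abs_of_pos (by positivity : 0 < s ^ 2), div_le_iff₀ (by positivity)]
      have e1 : pe p (y + s • e) + pe p (y - s • e) - 2 * pe p y = ∑ i, a i * (pe (b i) (y + s • e) + pe (b i) (y - s • e) - 2 * pe (b i) y) := by
        have : pe p (y + s • e) + pe p (y - s • e) - 2 * pe p y = pe p' (y + s • e) + pe p' (y - s • e) - 2 * pe p' y := by
          rw [e0, e0, e0]; ring
        rw [this, ← hpa, pe_sum, pe_sum, pe_sum, Finset.mul_sum, ← Finset.sum_add_distrib, ← Finset.sum_sub_distrib]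
        exact Finset.sum_congr rfl fun i _ => by ring
      rw [e1, Finset.sum_mul]
      refine (Finset.abs_sum_le_sum_abs _ _).trans (Finset.sum_le_sum fun i _ => ?_)
      rw [abs_mul, mul_assoc]
      exact mul_le_mul_of_nonneg_left (hK i y hy s hs0 hs1 e he) (abs_nonneg _)

lemma ball_scale (F : E3 → ℝ) (x0 : E3) {h : ℝ} (hh : 0 < h) (c : ℝ) :
    ∫ y in closedBall (0 : E3) c, F (x0 + h • y) = (h ^ 3)⁻¹ * ∫ x in closedBall x0 (c * h), F x := by
  rw [← integral_indicator measurableSet_closedBall, ← integral_indicator measurableSet_closedBall]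
  have e : ∀ y, (closedBall (0 : E3) c).indicator (fun y => F (x0 + h • y)) y =
      (fun z => (closedBall x0 (c * h)).indicator F (x0 + z)) (h • y) := fun y => by
    have : y ∈ closedBall (0 : E3) c ↔ x0 + h • y ∈ closedBall x0 (c * h) := by
      rw [mem_closedBall_zero_iff, mem_closedBall_iff_norm, add_sub_cancel_left, norm_smul, Real.norm_of_nonneg hh.le, mul_comm c h]
      exact (mul_le_mul_iff_right₀ hh).symm
    by_cases hy : y ∈ closedBall (0 : E3) c
    · simp only [indicator_of_mem hy, indicator_of_mem (this.1 hy)]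
    · simp only [indicator_of_notMem hy, indicator_of_notMem (mt this.2 hy)]
  rw [integral_congr_ae (Filter.Eventually.of_forall e), Measure.integral_comp_smul volume (fun z => (closedBall x0 (c * h)).indicator F (x0 + z)) h, integral_add_left_eq_self]
  simp [abs_of_pos hh]

/-- Inverse estimates. -/
lemma poly_inv {r : ℕ} (hr : 1 ≤ r) {c : ℝ} (hc : 0 < c) : ∃ C : ℝ, 0 < C ∧ ∀ h : ℝ, 0 < h → ∀ x0 : E3, ∀ p : MvPolynomial (Fin 3) ℝ,
    p.totalDegree ≤ r → ∀ g : E3,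
    (∀ x : E3, ‖x - x0‖ ≤ h → ‖gradient (pe p) x - g‖ ^ 2 ≤ C * (h ^ 3)⁻¹ * ∫ x in closedBall x0 (c * h), ‖gradient (pe p) x - g‖ ^ 2) ∧
    (∀ x : E3, ‖x - x0‖ ≤ h → ∀ s : ℝ, 0 ≤ s → s ≤ h → ∀ e : E3, ‖e‖ ≤ 1 →
      (pe p (x + s • e) + pe p (x - s • e) - 2 * pe p x) ^ 2 ≤ C * s ^ 4 * (h ^ 5)⁻¹ * ∫ x in closedBall x0 (c * h), ‖gradient (pe p) x - g‖ ^ 2) := by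
  obtain ⟨C, hC, H⟩ := poly_ref r hc
  refine ⟨C, hC, fun h hh x0 p hp g => ?_⟩
  obtain ⟨q1, hq1, e1⟩ := pe_affine hp x0 h
  obtain ⟨q2, hq2, e2⟩ := pe_lin 0 (h • g)
  set q := q1 - q2 with hq
  have hqd : q.totalDegree ≤ r := (MvPolynomial.totalDegree_sub _ _).trans (max_le hq1 (hq2.trans hr))
  have eq : ∀ y, pe q y = pe p (x0 + h • y) - ⟪h • g, y⟫ := fun y => by
    rw [← e1]; have := e2 y; rw [zero_add] at this; rw [← this]; simp [hq, pe]
  have eg : ∀ y, gradient (pe q) y = h • (gradient (pe p) (x0 + h • y) - g) := fun y => by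
    have : pe q = fun y => pe p (x0 + h • y) - ⟪h • g, y⟫ := funext eq
    apply grad_ext
    intro t
    have h1 : HasFDerivAt (fun y : E3 => x0 + h • y) (h • ContinuousLinearMap.id ℝ E3) y := by
      have := ((hasFDerivAt_id (𝕜 := ℝ) y).fun_const_smul h).const_add x0
      exact this
    have hd : HasFDerivAt (fun y : E3 => pe p (x0 + h • y)) ((fderiv ℝ (pe p) (x0 + h • y)).comp (h • ContinuousLinearMap.id ℝ E3)) y :=
      HasFDerivAt.comp (g := pe p) y (pe_diff p (x0 + h • y)).hasFDerivAt h1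
    have h2 : HasFDerivAt (fun y => pe p (x0 + h • y) - ⟪h • g, y⟫) _ y := hd.fun_sub ((innerSL ℝ (h • g)).hasFDerivAt)
    rw [this, h2.fderiv]
    simp [inner_smul_left, inner_sub_left, grad_inner]
    ring
  have hI : ∫ y in closedBall (0 : E3) c, ‖gradient (pe q) y‖ ^ 2 = h ^ 2 * ((h ^ 3)⁻¹ * ∫ x in closedBall x0 (c * h), ‖gradient (pe p) x - g‖ ^ 2) := by
    rw [← ball_scale (fun x => ‖gradient (pe p) x - g‖ ^ 2) x0 hh c, ← integral_const_mul]
    congr 1; ext y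
    rw [eg, norm_smul, mul_pow, Real.norm_of_nonneg hh.le]
  obtain ⟨H1, H2⟩ := H q hqd
  rw [hI] at H1 H2
  have hy : ∀ x : E3, ‖x - x0‖ ≤ h → ‖h⁻¹ • (x - x0)‖ ≤ 1 ∧ x0 + h • (h⁻¹ • (x - x0)) = x := fun x hx => by
    constructor
    · rw [norm_smul, norm_inv, Real.norm_of_nonneg hh.le, inv_mul_le_iff₀ hh]; simpa using hx
    · rw [smul_inv_smul₀ hh.ne']; simp
  constructor
  · intro x hx
    have := H1 _ (hy x hx).1
    rw [eg, (hy x hx).2, norm_smul, mul_pow, Real.norm_of_nonneg hh.le] at this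
    have h2 : 0 < h ^ 2 := by positivity
    refine le_of_mul_le_mul_left (this.trans (le_of_eq ?_)) h2
    ring
  · intro x hx s hs0 hs1 e he
    obtain ⟨y1, y2⟩ := hy x hx
    generalize h⁻¹ • (x - x0) = y at y1 y2
    have := H2 _ y1 (s / h) (by positivity) ((div_le_one hh).2 hs1) e he
    rw [eq, eq, eq, smul_add, smul_sub, smul_smul h, mul_div_cancel₀ _ hh.ne', ← add_assoc, ← add_sub_assoc x0, y2, inner_add_right, inner_sub_right] at this
    calc _ = _ := by congr 1; ring
      _ ≤ _ := this
      _ = _ := by field_simp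

/-! ### Meshes -/

/-- A mesh without repetitions. -/
structure Mesh (Ω : Set E3) (T : Finset (Fin 4 → E3)) (h c : ℝ) : Prop where
  ai : ∀ v ∈ T, AffineIndependent ℝ v
  cov : (⋃ v ∈ T, tet v) = closure Ω
  dis : ∀ v ∈ T, ∀ w ∈ T, v ≠ w → interior (tet v) ∩ interior (tet w) = ∅
  conf : ∀ v ∈ T, ∀ w ∈ T, ∀ x ∈ tet v, x ∈ tet w → x ∈ convexHull ℝ (range v ∩ range w)
  diam : ∀ v ∈ T, Metric.diam (tet v) ≤ h
  inb : ∀ v ∈ T, ∃ x : E3, closedBall x (c * h) ⊆ tet v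

lemma exists_mesh {Ω : Set E3} {T : Finset (Fin 4 → E3)} {h c : ℝ} (hT : IsTetPartition Ω T h c) :
    ∃ T' : Finset (Fin 4 → E3), Mesh Ω T' h c ∧ ∀ r u, MemSh0 Ω T' r u ↔ MemSh0 Ω T r u := by
  classical
  obtain ⟨T', hsub, hinj, him⟩ := (Set.surjOn_image tet (T : Set (Fin 4 → E3))).exists_subset_injOn_image_eq
  have hfin : T'.Finite := T.finite_toSet.subset hsub
  lift T' to Finset (Fin 4 → E3) using hfin
  have hsub' : ∀ v ∈ T', v ∈ T := fun v hv => hsub hv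
  obtain ⟨h1, h2, h3, h4, h5, h6⟩ := hT
  have hne : ∀ v ∈ T', ∀ w ∈ T', v ≠ w → tet v ≠ tet w := fun v hv w hw hvw h => hvw (hinj hv hw h)
  have hback : ∀ v ∈ T, ∃ w ∈ T', tet w = tet v := fun v hv => by
    have : tet v ∈ tet '' (T : Set (Fin 4 → E3)) := ⟨v, hv, rfl⟩
    rw [← him] at this
    exact this
  refine ⟨T', ⟨fun v hv => h1 v (hsub' v hv), ?_, fun v hv w hw hvw => h3 v (hsub' v hv) w (hsub' w hw) (hne v hv w hw hvw), ?_,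
    fun v hv => h5 v (hsub' v hv), fun v hv => h6 v (hsub' v hv)⟩, fun r u => ?_⟩
  · rw [← h2]
    ext x
    simp only [mem_iUnion, exists_prop]
    constructor
    · rintro ⟨v, hv, hx⟩; exact ⟨v, hsub' v hv, hx⟩
    · rintro ⟨v, hv, hx⟩
      obtain ⟨w, hw, e⟩ := hback v hv
      exact ⟨w, hw, e ▸ hx⟩
  · intro v hv w hw x hx hx'
    by_cases hvw : v = w
    · subst hvw; rw [inter_self]; exact hx
    · rcases h4 v (hsub' v hv) w (hsub' w hw) (hne v hv w hw hvw) with h | h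
      · have h0 : x ∈ tet v ∩ tet w := ⟨hx, hx'⟩
        rw [h] at h0
        exact h0.elim
      · rw [← h]; exact ⟨hx, hx'⟩
  · constructor
    · rintro ⟨⟨a, b⟩, d⟩
      refine ⟨⟨a, fun v hv => ?_⟩, d⟩
      obtain ⟨w, hw, e⟩ := hback v hv
      rw [← e]; exact b w hw
    · rintro ⟨⟨a, b⟩, d⟩
      exact ⟨⟨a, fun v hv => b v (hsub' v hv)⟩, d⟩

lemma tet_compact (v : Fin 4 → E3) : IsCompact (tet v) := (Set.finite_range v).isCompact_convexHull ℝ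

lemma tet_closed (v : Fin 4 → E3) : IsClosed (tet v) := (tet_compact v).isClosed

lemma tet_convex (v : Fin 4 → E3) : Convex ℝ (tet v) := convex_convexHull ℝ _

lemma tet_vert (v : Fin 4 → E3) (k : Fin 4) : v k ∈ tet v := subset_convexHull ℝ _ ⟨k, rfl⟩

/-- Volume of the unit ball. -/
def om : ℝ := volume.real (ball (0 : E3) 1)

lemma om_pos : 0 < om := by
  unfold om
  rw [measureReal_def]
  exact ENNReal.toReal_pos (measure_ball_pos _ _ one_pos).ne' measure_ball_lt_top.ne

lemma vol_cb (x : E3) {r : ℝ} (hr : 0 ≤ r) : volume.real (closedBall x r) = r ^ 3 * om := by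
  rw [Measure.addHaar_real_closedBall _ _ hr]; simp [om]

lemma vol_b (x : E3) {r : ℝ} (hr : 0 ≤ r) : volume.real (ball x r) = r ^ 3 * om := by
  rw [← Measure.addHaar_real_closedBall_eq_addHaar_real_ball, vol_cb x hr]

namespace Mesh

variable {Ω : Set E3} {T : Finset (Fin 4 → E3)} {h c : ℝ}

lemma dist_le (M : Mesh Ω T h c) {v : Fin 4 → E3} (hv : v ∈ T) {x y : E3} (hx : x ∈ tet v) (hy : y ∈ tet v) : ‖x - y‖ ≤ h := by
  rw [← dist_eq_norm]
  exact (dist_le_diam_of_mem (tet_compact v).isBounded hx hy).trans (M.diam v hv)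

lemma sub_closure (M : Mesh Ω T h c) {v : Fin 4 → E3} (hv : v ∈ T) : tet v ⊆ closure Ω := by
  rw [← M.cov]; exact fun x hx => mem_iUnion₂.2 ⟨v, hv, hx⟩

lemma ex_tet (M : Mesh Ω T h c) {x : E3} (hx : x ∈ closure Ω) : ∃ v ∈ T, x ∈ tet v := by
  rw [← M.cov] at hx; simpa using hx

lemma count (M : Mesh Ω T h c) (hc : 0 < c) (hh : 0 < h) {A : Finset (Fin 4 → E3)} (hA : A ⊆ T) {S : Set E3} (hS : Bornology.IsBounded S)
    (hAS : ∀ v ∈ A, tet v ⊆ S) : A.card * ((c * h) ^ 3 * om) ≤ volume.real S := by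
  have hfin : volume S ≠ ⊤ := hS.measure_lt_top.ne
  have hd : (A : Set (Fin 4 → E3)).PairwiseDisjoint fun v => interior (tet v) := fun v hv w hw hvw =>
    disjoint_iff_inter_eq_empty.2 (M.dis v (hA hv) w (hA hw) hvw)
  have h1 : volume.real (⋃ v ∈ A, interior (tet v)) = ∑ v ∈ A, volume.real (interior (tet v)) :=
    measureReal_biUnion_finset hd (fun v _ => isOpen_interior.measurableSet)
      (fun v hv => ne_top_of_le_ne_top hfin (measure_mono (interior_subset.trans (hAS v hv))))
  have h2 : volume.real (⋃ v ∈ A, interior (tet v)) ≤ volume.real S :=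
    measureReal_mono (iUnion₂_subset fun v hv => interior_subset.trans (hAS v hv)) hfin
  have h3 : ∀ v ∈ A, (c * h) ^ 3 * om ≤ volume.real (interior (tet v)) := fun v hv => by
    obtain ⟨x, hx⟩ := M.inb v (hA hv)
    rw [← vol_b x (by positivity)]
    exact measureReal_mono (interior_maximal (ball_subset_closedBall.trans hx) isOpen_ball)
      (ne_top_of_le_ne_top hfin (measure_mono (interior_subset.trans (hAS v hv))))
  have h4 := Finset.sum_le_sum h3
  rw [Finset.sum_const, nsmul_eq_mul] at h4
  linarith

open Classical in
lemma overlap (M : Mesh Ω T h c) (hc : 0 < c) (hh : 0 < h) (x : E3) :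
    ((T.filter fun v => x ∈ closedBall (v 0) (3 * h)).card : ℝ) ≤ 64 / c ^ 3 := by
  have := M.count hc hh (A := T.filter fun v => x ∈ closedBall (v 0) (3 * h)) (Finset.filter_subset _ _) (S := closedBall x (4 * h)) isBounded_closedBall
    fun v hv y hy => by
      rw [Finset.mem_filter] at hv
      have h1 := hv.2
      have h2 := M.dist_le hv.1 hy (tet_vert v 0)
      rw [mem_closedBall, dist_eq_norm] at h1 ⊢
      have := norm_add_le (y - v 0) (v 0 - x)
      rw [sub_add_sub_cancel] at this
      rw [norm_sub_rev] at h1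
      linarith
  rw [vol_cb x (by positivity)] at this
  rw [le_div_iff₀ (by positivity)]
  have hp : 0 < h ^ 3 * om := mul_pos (by positivity) om_pos
  refine le_of_mul_le_mul_right ?_ hp
  nlinarith [this]

lemma sum_ball (M : Mesh Ω T h c) (hc : 0 < c) (hh : 0 < h) {f : E3 → ℝ} (hf : Integrable f) (hf0 : ∀ x, 0 ≤ f x) :
    ∑ v ∈ T, ∫ x in closedBall (v 0) (3 * h), f x ≤ 64 / c ^ 3 * ∫ x, f x := by
  classical
  have e1 : ∀ v ∈ T, ∫ x in closedBall (v 0) (3 * h), f x = ∫ x, (closedBall (v 0) (3 * h)).indicator f x := fun v _ =>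
    (integral_indicator measurableSet_closedBall).symm
  rw [Finset.sum_congr rfl e1, ← integral_finsetSum _ fun v _ => hf.indicator measurableSet_closedBall, ← integral_const_mul]
  refine integral_mono (integrable_finsetSum _ fun v _ => hf.indicator measurableSet_closedBall) (hf.const_mul _) fun x => ?_
  have : ∑ v ∈ T, (closedBall (v 0) (3 * h)).indicator f x = (T.filter fun v => x ∈ closedBall (v 0) (3 * h)).card * f x := by
    simp only [indicator_apply]
    rw [← Finset.sum_filter, Finset.sum_const, nsmul_eq_mul]
  simp only [this]
  exact mul_le_mul_of_nonneg_right (M.overlap hc hh x) (hf0 x)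

lemma card_le (M : Mesh Ω T h c) (hΩ : Dom Ω) (hc : 0 < c) (hh : 0 < h) : T.card * ((c * h) ^ 3 * om) ≤ volume.real (closure Ω) :=
  M.count hc hh subset_rfl hΩ.2.1.closure fun v hv => M.sub_closure hv

lemma ae_interior (_ : Mesh Ω T h c) : ∀ᵐ x : E3, ∀ v ∈ T, x ∈ tet v → x ∈ interior (tet v) := by
  rw [Filter.eventually_all_finset]
  intro v hv
  have : ∀ᵐ x : E3, x ∉ frontier (tet v) := measure_eq_zero_iff_ae_notMem.1 ((tet_convex v).addHaar_frontier volume)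
  filter_upwards [this] with x hx hxv
  by_contra hn
  exact hx ⟨subset_closure hxv, hn⟩

end Mesh

/-- Lipschitz bound along a segment covered by finitely many closed sets. -/
lemma seg_lip {ι : Type*} (T : Finset ι) (S : ι → Set E3) (hS : ∀ v ∈ T, IsClosed (S v)) {w : E3 → ℝ} {p : ι → E3 → ℝ}
    (hp : ∀ v ∈ T, Differentiable ℝ (p v)) (hw : ∀ v ∈ T, ∀ x ∈ S v, w x = p v x) {x y : E3}
    (hcov : ∀ z ∈ segment ℝ x y, ∃ v ∈ T, z ∈ S v) (hcont : ContinuousOn w (segment ℝ x y)) {g : E3} {L : ℝ}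
    (hL : ∀ z ∈ segment ℝ x y, ∀ v ∈ T, z ∈ S v → ‖gradient (p v) z - g‖ ≤ L) :
    w y - w x - ⟪g, y - x⟫ ≤ L * ‖y - x‖ := by
  let γ : ℝ → E3 := fun t => x + t • (y - x)
  have hγ : ∀ t ∈ Icc (0 : ℝ) 1, γ t ∈ segment ℝ x y := fun t ht => by
    rw [segment_eq_image']; exact ⟨t, ht, rfl⟩
  have hγc : Continuous γ := by fun_prop
  let f : ℝ → ℝ := fun t => w (γ t) - w x - t * ⟪g, y - x⟫
  have hfc : ContinuousOn f (Icc 0 1) :=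
    ((hcont.comp hγc.continuousOn hγ).sub continuousOn_const).sub (by fun_prop)
  have key := image_le_of_liminf_slope_right_le_deriv_boundary (f := f) (a := 0) (b := 1) hfc
    (B := fun t => t * (L * ‖y - x‖)) (B' := fun _ => L * ‖y - x‖) (by simp [f, γ]) (by fun_prop)
    (fun t _ => by simpa using ((hasDerivAt_id t).mul_const (L * ‖y - x‖)).hasDerivWithinAt) (fun t ht r hr => ?_)
    (right_mem_Icc.2 zero_le_one)
  · simpa [f, γ] using key
  · -- choose the piece
    have hev : ∀ᶠ z in nhdsWithin t (Ioi t), ∃ v ∈ T, γ z ∈ S v := by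
      filter_upwards [Ioo_mem_nhdsGT ht.2] with z hz
      exact hcov _ (hγ z ⟨ht.1.trans hz.1.le, hz.2.le⟩)
    have hfr : ∃ v ∈ T, ∃ᶠ z in nhdsWithin t (Ioi t), γ z ∈ S v := by
      by_contra hn
      push Not at hn
      have h1 : ∀ᶠ z in nhdsWithin t (Ioi t), ∀ v ∈ T, γ z ∉ S v := (Filter.eventually_all_finset T).2 hn
      obtain ⟨z, ⟨v, hv, hz⟩, h2⟩ := (hev.and h1).exists
      exact h2 v hv hz
    obtain ⟨v, hv, hfr⟩ := hfr
    have htS : γ t ∈ S v := (hS v hv).mem_of_frequently_of_tendsto hfr (hγc.continuousAt.tendsto.mono_left nhdsWithin_le_nhds)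
    have hd : HasDerivAt (fun z => p v (γ z) - w x - z * ⟪g, y - x⟫) (⟪gradient (p v) (γ t) - g, y - x⟫) t := by
      have h1 : HasDerivAt γ (y - x) t := by
        have := ((hasDerivAt_id t).smul_const (y - x)).const_add x
        rw [one_smul] at this
        exact this
      have h2 := (hp v hv (γ t)).hasFDerivAt.comp_hasDerivAt t h1
      rw [← grad_inner] at h2
      have h3 := (h2.sub_const (w x)).sub ((hasDerivAt_id t).mul_const ⟪g, y - x⟫)
      rw [one_mul, ← inner_sub_left] at h3
      exact h3
    have hlt : ⟪gradient (p v) (γ t) - g, y - x⟫ < r := by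
      have h1 := real_inner_le_norm (gradient (p v) (γ t) - g) (y - x)
      have h2 := hL _ (hγ t ⟨ht.1, ht.2.le⟩) v hv htS
      nlinarith [norm_nonneg (y - x)]
    have hsl : ∀ᶠ z in nhdsWithin t (Ioi t), slope (fun z => p v (γ z) - w x - z * ⟪g, y - x⟫) t z < r :=
      (hasDerivAt_iff_tendsto_slope.1 hd).mono_left (nhdsWithin_mono _ fun z hz => ne_of_gt hz) |>.eventually (gt_mem_nhds hlt)
    refine (hfr.and_eventually hsl).mono fun z hz => ?_
    have := hz.2
    simp only [slope_def_field, f] at this ⊢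
    rwa [hw v hv _ hz.1, hw v hv _ htS]

lemma memsh_lip0 {Ω : Set E3} (hΩ : Dom Ω) {T : Finset (Fin 4 → E3)} {h c : ℝ} (M : Mesh Ω T h c) {r : ℕ} {u : E3 → ℝ} (hu : MemSh0 Ω T r u) :
    Lip0 Ω (Ω.indicator u) := by
  obtain ⟨⟨hc, hp⟩, h0⟩ := hu
  choose! p hpd hpe using hp
  have hb : ∀ v, ∃ K, ∀ x ∈ tet v, ‖gradient (pe (p v)) x‖ ≤ K := fun v =>
    (tet_compact v).exists_bound_of_continuousOn (pe_gcont (p v)).continuousOn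
  choose K hK using hb
  have hKK : ∀ v ∈ T, K v ≤ ∑ v ∈ T, |K v| := fun v hv => (le_abs_self _).trans (Finset.single_le_sum (f := fun v => |K v|) (fun v _ => abs_nonneg _) hv)
  refine lip0_ext (K := ∑ v ∈ T, |K v|) (Finset.sum_nonneg fun v _ => abs_nonneg _) ?_ h0
  have key : ∀ x ∈ closure Ω, ∀ y ∈ closure Ω, u y - u x ≤ (∑ v ∈ T, |K v|) * ‖y - x‖ := fun x hx y hy => by
    have hseg : segment ℝ x y ⊆ closure Ω := hΩ.2.2.closure.segment_subset hx hy
    have := seg_lip T tet (fun v _ => tet_closed v) (w := u) (p := fun v => pe (p v)) (fun v _ => pe_diff _) hpe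
      (x := x) (y := y) (fun z hz => M.ex_tet (hseg hz)) (hc.mono hseg) (g := 0) (L := ∑ v ∈ T, |K v|)
      (fun z hz v hv hzv => by rw [sub_zero]; exact (hK v z hzv).trans (hKK v hv))
    simpa using this
  intro x hx y hy
  rw [abs_le]
  have h1 := key x hx y hy
  have h2 := key y hy x hx
  rw [norm_sub_rev] at h1
  constructor <;> linarith

/-! ### Local mean gradients -/

lemma prod_int {k : E3 × E3 → ℝ} (hm : Measurable k) {C : ℝ} (hC : ∀ p, ‖k p‖ ≤ C) (x y : E3) (r s : ℝ) :
    Integrable k ((volume.restrict (closedBall x r)).prod (volume.restrict (closedBall y s))) := by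
  haveI h1 : IsFiniteMeasure (volume.restrict (closedBall x r)) := isFiniteMeasure_restrict.2 measure_closedBall_lt_top.ne
  haveI h2 : IsFiniteMeasure (volume.restrict (closedBall y s)) := isFiniteMeasure_restrict.2 measure_closedBall_lt_top.ne
  exact Integrable.of_bound hm.aestronglyMeasurable C (Filter.Eventually.of_forall hC)

lemma diff_prod {H : E3 → E3} (hH : Nice H) : ∃ C : ℝ, ∀ x y : E3, ‖‖H x - H y‖ ^ 2‖ ≤ C := by
  obtain ⟨C, hC⟩ := hH.2.1
  refine ⟨(2 * C) ^ 2, fun x y => ?_⟩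
  rw [Real.norm_of_nonneg (by positivity)]
  have := norm_sub_le (H x) (H y)
  have := hC x; have := hC y
  gcongr; linarith

lemma shift_int {H : E3 → E3} (hH : Nice H) (x : E3) (r s : ℝ) :
    Integrable (fun p : E3 × E3 => ‖H (p.1 + p.2) - H p.1‖ ^ 2) ((volume.restrict (closedBall x r)).prod (volume.restrict (closedBall 0 s))) := by
  obtain ⟨C, hC⟩ := diff_prod hH
  refine prod_int (C := C) ?_ (fun p => hC _ _) x 0 r s
  have := hH.1
  fun_prop

lemma gv_mean {H : E3 → E3} (hH : Nice H) (z : E3) {h : ℝ} (hh : 0 < h) :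
    ∃ g : E3, ∫ x in closedBall z (3 * h), ‖H x - g‖ ^ 2 ≤
      (27 * h ^ 3 * om)⁻¹ * ∫ t in closedBall (0 : E3) (6 * h), ∫ x in closedBall z (3 * h), ‖H (x + t) - H x‖ ^ 2 := by
  have hHm := hH.1
  obtain ⟨C, hC⟩ := diff_prod hH
  set B := closedBall z (3 * h) with hB
  have hint : Integrable (fun p : E3 × E3 => ‖H p.2 - H p.1‖ ^ 2) ((volume.restrict B).prod (volume.restrict B)) :=
    prod_int (C := C) (by fun_prop) (fun p => hC _ _) z z _ _
  have hψ : IntegrableOn (fun y => ∫ x in B, ‖H x - H y‖ ^ 2) B := hint.integral_prod_left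
  have hv : volume.real B = 27 * h ^ 3 * om := by rw [hB, vol_cb z (by positivity)]; ring
  obtain ⟨y, hy, hle⟩ := exists_le_setAverage (measure_closedBall_pos volume z (by positivity : 0 < 3 * h)).ne' measure_closedBall_lt_top.ne hψ
  refine ⟨H y, hle.trans ?_⟩
  rw [setAverage_eq, hv, smul_eq_mul]
  have hp : 0 ≤ (27 * h ^ 3 * om)⁻¹ := by have := om_pos; positivity
  refine mul_le_mul_of_nonneg_left ?_ hp
  have hs := shift_int hH z (3 * h) (6 * h)
  calc ∫ y in B, ∫ x in B, ‖H x - H y‖ ^ 2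
      ≤ ∫ y in B, ∫ t in closedBall (0 : E3) (6 * h), ‖H (y + t) - H y‖ ^ 2 := by
        refine setIntegral_mono_on hψ hs.integral_prod_left measurableSet_closedBall fun y hy => ?_
        rw [← integral_indicator measurableSet_closedBall, ← integral_indicator measurableSet_closedBall,
          ← integral_add_left_eq_self _ y]
        refine integral_mono_of_nonneg (Filter.Eventually.of_forall fun t => indicator_nonneg (fun _ _ => by positivity) _) ?_
          (Filter.Eventually.of_forall fun t => ?_)
        · rw [integrable_indicator_iff measurableSet_closedBall]
          exact Measure.integrableOn_of_bounded (M := C) measure_closedBall_lt_top.ne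
            (Measurable.aestronglyMeasurable (by fun_prop)) (Filter.Eventually.of_forall fun t => hC _ _)
        · by_cases ht : y + t ∈ closedBall z (3 * h)
          · have : t ∈ closedBall (0 : E3) (6 * h) := by
              rw [mem_closedBall_zero_iff]
              rw [mem_closedBall, dist_eq_norm] at ht hy
              have := norm_sub_le (y + t - z) (y - z)
              rw [sub_sub_sub_cancel_right, add_sub_cancel_left] at this
              linarith
            simp only [indicator_of_mem ht, indicator_of_mem this, le_refl]
          · simp only [indicator_of_notMem ht]
            exact indicator_nonneg (fun _ _ => by positivity) _
    _ = _ := integral_integral_swap hs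

namespace Geo

variable {Ω : Set E3} (G : Geo Ω)

lemma gv_sum {T : Finset (Fin 4 → E3)} {h c : ℝ} (M : Mesh Ω T h c) (hc : 0 < c) (hh : 0 < h) {w : E3 → ℝ} (hw : LC w) {Q : ℝ}
    (H1 : ∫ x, (G.P h x)⁻¹ ^ 2 * ‖gradient w x‖ ^ 2 ≤ Q / h ^ 2) (H2 : ∫ x, (G.P h x)⁻¹ ^ 4 * w x ^ 2 ≤ Q / h ^ 2)
    (H3 : ∀ t : E3, ‖t‖ ≤ 6 * h → ∫ x, G.eta h x ^ 2 * ‖gradient w (x + t) - gradient w x‖ ^ 2 ≤ Q) :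
    ∃ g : (Fin 4 → E3) → E3, ∃ b : (Fin 4 → E3) → ℝ, (∀ v, 0 ≤ b v) ∧
      (∀ v ∈ T, G.q (v 0) < 202 * h → g v = 0 ∧ ∫ x in closedBall (v 0) (3 * h), w x ^ 2 ≤ h ^ 2 * b v) ∧
      ∑ v ∈ T, ((∫ x in closedBall (v 0) (3 * h), ‖gradient w x - g v‖ ^ 2) + b v) ≤ 64 / c ^ 3 * (8 + 313 ^ 2 + 313 ^ 4) * Q := by
  classical
  have hHn : Nice (gradient w) := hw.grad
  choose! g0 hg0 using fun z : E3 => gv_mean hHn z hh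
  set good : (Fin 4 → E3) → Prop := fun v => 202 * h ≤ G.q (v 0) with hgood
  set g : (Fin 4 → E3) → E3 := fun v => if good v then g0 (v 0) else 0 with hg
  set b : (Fin 4 → E3) → ℝ := fun v => if good v then 0 else (h ^ 2)⁻¹ * ∫ x in closedBall (v 0) (3 * h), w x ^ 2 with hb
  have hQ : 0 ≤ Q := (integral_nonneg fun x => by positivity).trans (H3 0 (by simp; positivity))
  have hO : 0 ≤ 64 / c ^ 3 := by positivity
  refine ⟨g, b, fun v => ?_, fun v hv hq => ?_, ?_⟩
  · simp only [hb]; split_ifs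
    · exact le_rfl
    · exact mul_nonneg (by positivity) (integral_nonneg fun x => by positivity)
  · have hn : ¬ good v := not_le.2 hq
    simp only [hg, hb, if_neg hn, true_and]
    rw [mul_inv_cancel_left₀ (by positivity)]
  -- bad pieces
  have hPb : ∀ v ∈ T, ¬ good v → ∀ x ∈ closedBall (v 0) (3 * h), G.P h x ≤ 313 * h := fun v hv hn x hx => by
    rw [mem_closedBall, dist_eq_norm] at hx
    have h1 := (abs_le.1 (G.P_lip h x (v 0))).2
    have hcl := M.sub_closure hv (tet_vert v 0)
    have h2 := G.closure_d hcl
    have h3 := G.two_d_le (v 0)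
    have h4 : G.q (v 0) < 202 * h := not_le.1 hn
    have h5 : G.P h (v 0) ≤ 304 * h := by
      unfold P; rw [abs_of_nonneg h2, abs_of_nonneg (by linarith)]; linarith
    linarith
  have hI1 : Integrable fun x => (G.P h x)⁻¹ ^ 2 * ‖gradient w x‖ ^ 2 :=
    (Nice.mul' (G.P_inv_bm hh).sq hHn.norm.sq).integrable
  have hI2 : Integrable fun x => (G.P h x)⁻¹ ^ 4 * w x ^ 2 := by
    have := (Nice.mul' (G.P_inv_bm hh).sq.sq hw.nice.sq).integrable
    simpa only [← pow_mul] using this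
  have bad1 : ∀ v ∈ T, ¬ good v → ∫ x in closedBall (v 0) (3 * h), ‖gradient w x‖ ^ 2 ≤
      (313 * h) ^ 2 * ∫ x in closedBall (v 0) (3 * h), (G.P h x)⁻¹ ^ 2 * ‖gradient w x‖ ^ 2 := fun v hv hn => by
    rw [← integral_const_mul]
    refine setIntegral_mono_on hHn.norm.sq.integrable.integrableOn (hI1.integrableOn.const_mul _) measurableSet_closedBall fun x hx => ?_
    have hp := G.P_pos hh x
    have := hPb v hv hn x hx
    rw [← mul_assoc]
    refine le_mul_of_one_le_left (by positivity) ?_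
    rw [← mul_pow]
    refine one_le_pow₀ ?_
    rw [← div_eq_mul_inv, one_le_div hp]; exact this
  have bad2 : ∀ v ∈ T, ¬ good v → ∫ x in closedBall (v 0) (3 * h), w x ^ 2 ≤
      (313 * h) ^ 4 * ∫ x in closedBall (v 0) (3 * h), (G.P h x)⁻¹ ^ 4 * w x ^ 2 := fun v hv hn => by
    rw [← integral_const_mul]
    refine setIntegral_mono_on hw.nice.sq.integrable.integrableOn (hI2.integrableOn.const_mul _) measurableSet_closedBall fun x hx => ?_
    have hp := G.P_pos hh x
    have := hPb v hv hn x hx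
    rw [← mul_assoc]
    refine le_mul_of_one_le_left (by positivity) ?_
    rw [← mul_pow]
    refine one_le_pow₀ ?_
    rw [← div_eq_mul_inv, one_le_div hp]; exact this
  set k1 : (Fin 4 → E3) → ℝ := fun v => (27 * h ^ 3 * om)⁻¹ * ∫ t in closedBall (0 : E3) (6 * h), ∫ x in closedBall (v 0) (3 * h), G.eta h x ^ 2 * ‖gradient w (x + t) - gradient w x‖ ^ 2 with hk1
  set k2 : (Fin 4 → E3) → ℝ := fun v => ∫ x in closedBall (v 0) (3 * h), (G.P h x)⁻¹ ^ 2 * ‖gradient w x‖ ^ 2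
  set k3 : (Fin 4 → E3) → ℝ := fun v => ∫ x in closedBall (v 0) (3 * h), (G.P h x)⁻¹ ^ 4 * w x ^ 2
  have k1n : ∀ v, 0 ≤ k1 v := fun v => mul_nonneg (by have := om_pos; positivity) (integral_nonneg fun t => integral_nonneg fun x => by positivity)
  have k2n : ∀ v, 0 ≤ k2 v := fun v => integral_nonneg fun x => by positivity
  have k3n : ∀ v, 0 ≤ k3 v := fun v => integral_nonneg fun x => by positivity
  have term : ∀ v ∈ T, (∫ x in closedBall (v 0) (3 * h), ‖gradient w x - g v‖ ^ 2) + b v ≤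
      k1 v + (313 * h) ^ 2 * k2 v + (h ^ 2)⁻¹ * (313 * h) ^ 4 * k3 v := fun v hv => by
    have p2 : 0 ≤ (313 * h) ^ 2 * k2 v := mul_nonneg (by positivity) (k2n v)
    have p3 : 0 ≤ (h ^ 2)⁻¹ * (313 * h) ^ 4 * k3 v := mul_nonneg (by positivity) (k3n v)
    by_cases hn : good v
    · simp only [hg, hb, if_pos hn]
      have := hg0 (v 0)
      have e : ∀ t, ∫ x in closedBall (v 0) (3 * h), ‖gradient w (x + t) - gradient w x‖ ^ 2 =
          ∫ x in closedBall (v 0) (3 * h), G.eta h x ^ 2 * ‖gradient w (x + t) - gradient w x‖ ^ 2 := fun t =>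
        setIntegral_congr_fun measurableSet_closedBall fun x hx => by
          rw [mem_closedBall, dist_eq_norm] at hx
          simp only [G.eta_one hh (M.sub_closure hv (tet_vert v 0)) hn hx, one_pow, one_mul]
      simp only [e] at this
      simp only [hk1]
      linarith
    · have h1 := bad1 v hv hn
      have h2 := mul_le_mul_of_nonneg_left (bad2 v hv hn) (by positivity : 0 ≤ (h ^ 2)⁻¹)
      rw [← mul_assoc] at h2
      simp only [hg, hb, if_neg hn, sub_zero]
      have := k1n v
      linarith
  have s2 : ∑ v ∈ T, k2 v ≤ 64 / c ^ 3 * (Q / h ^ 2) :=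
    (M.sum_ball hc hh hI1 fun x => by positivity).trans (mul_le_mul_of_nonneg_left H1 hO)
  have s3 : ∑ v ∈ T, k3 v ≤ 64 / c ^ 3 * (Q / h ^ 2) :=
    (M.sum_ball hc hh hI2 fun x => by positivity).trans (mul_le_mul_of_nonneg_left H2 hO)
  have hItr : ∀ t : E3, Integrable fun x => G.eta h x ^ 2 * ‖gradient w (x + t) - gradient w x‖ ^ 2 := fun t => by
    have hb : BM (fun x => G.eta h x ^ 2) := BM.of_bdd 1 (((G.eta_lip hh).cont.measurable).pow_const 2) fun x => by
      rw [Real.norm_of_nonneg (by positivity)]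
      exact pow_le_one₀ (G.eta_nonneg h x) (G.eta_le h x)
    exact (Nice.mul' hb ((hHn.trans t).sub hHn).norm.sq).integrable
  have s1 : ∑ v ∈ T, k1 v ≤ 64 / c ^ 3 * 8 * Q := by
    have hom := om_pos
    have hvol : volume.real (closedBall (0 : E3) (6 * h)) = 216 * h ^ 3 * om := by rw [vol_cb 0 (by positivity)]; ring
    have hint : ∀ v ∈ T, IntegrableOn (fun t => ∫ x in closedBall (v 0) (3 * h), G.eta h x ^ 2 * ‖gradient w (x + t) - gradient w x‖ ^ 2) (closedBall (0 : E3) (6 * h)) := fun v _ => by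
      obtain ⟨C, hC⟩ := diff_prod hHn
      have hm := hHn.1
      have he := (G.eta_lip hh).cont.measurable
      refine (prod_int (k := fun p : E3 × E3 => G.eta h p.1 ^ 2 * ‖gradient w (p.1 + p.2) - gradient w p.1‖ ^ 2) (C := C) (by fun_prop) (fun p => ?_) (v 0) 0 (3 * h) (6 * h)).integral_prod_right
      rw [norm_mul]
      refine (mul_le_of_le_one_left (norm_nonneg _) ?_).trans (hC _ _)
      rw [Real.norm_of_nonneg (by positivity)]
      exact pow_le_one₀ (G.eta_nonneg h _) (G.eta_le h _)
    simp only [hk1]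
    rw [← Finset.mul_sum, ← integral_finsetSum _ hint]
    have hle := norm_setIntegral_le_of_norm_le_const (μ := volume) (s := closedBall (0 : E3) (6 * h)) (C := 64 / c ^ 3 * Q)
      (f := fun t => ∑ v ∈ T, ∫ x in closedBall (v 0) (3 * h), G.eta h x ^ 2 * ‖gradient w (x + t) - gradient w x‖ ^ 2)
      measure_closedBall_lt_top (fun t ht => by
        rw [mem_closedBall_zero_iff] at ht
        rw [Real.norm_of_nonneg (Finset.sum_nonneg fun v _ => integral_nonneg fun x => by positivity)]
        exact (M.sum_ball hc hh (hItr t) fun x => by positivity).trans (mul_le_mul_of_nonneg_left (H3 t ht) hO))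
    rw [hvol] at hle
    calc _ ≤ (27 * h ^ 3 * om)⁻¹ * (64 / c ^ 3 * Q * (216 * h ^ 3 * om)) :=
          mul_le_mul_of_nonneg_left ((le_abs_self _).trans hle) (by positivity)
      _ = _ := by field_simp; ring
  calc _ ≤ _ := Finset.sum_le_sum term
    _ = ∑ v ∈ T, k1 v + (313 * h) ^ 2 * ∑ v ∈ T, k2 v + (h ^ 2)⁻¹ * (313 * h) ^ 4 * ∑ v ∈ T, k3 v := by
      rw [Finset.sum_add_distrib, Finset.sum_add_distrib, Finset.mul_sum, Finset.mul_sum]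
    _ ≤ 64 / c ^ 3 * 8 * Q + (313 * h) ^ 2 * (64 / c ^ 3 * (Q / h ^ 2)) + (h ^ 2)⁻¹ * (313 * h) ^ 4 * (64 / c ^ 3 * (Q / h ^ 2)) := by gcongr
    _ = _ := by field_simp

end Geo

/-! ### Nodal values -/

lemma tet_repr {v : Fin 4 → E3} {x : E3} (hx : x ∈ tet v) :
    ∃ lam : Fin 4 → ℝ, (∀ k, 0 ≤ lam k) ∧ ∑ k, lam k = 1 ∧ ∑ k, lam k • v k = x := by
  have : tet v ⊆ {x | ∃ lam : Fin 4 → ℝ, (∀ k, 0 ≤ lam k) ∧ ∑ k, lam k = 1 ∧ ∑ k, lam k • v k = x} := by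
    refine convexHull_min ?_ ?_
    · rintro _ ⟨k, rfl⟩
      exact ⟨Pi.single k 1, fun j => by by_cases h : j = k <;> simp [Pi.single_apply, h], by simp, by simp [Pi.single_apply, ite_smul]⟩
    · rintro _ ⟨l1, p1, s1, rfl⟩ _ ⟨l2, p2, s2, rfl⟩ a b ha hb hab
      refine ⟨fun k => a * l1 k + b * l2 k, fun k => add_nonneg (mul_nonneg ha (p1 k)) (mul_nonneg hb (p2 k)), ?_, ?_⟩
      · rw [Finset.sum_add_distrib, ← Finset.mul_sum, ← Finset.mul_sum, s1, s2, mul_one, mul_one, hab]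
      · simp only [add_smul, mul_smul, Finset.sum_add_distrib, Finset.smul_sum]
  exact this hx

lemma aff_sum {lam : Fin 4 → ℝ} (h1 : ∑ k, lam k = 1) (v : Fin 4 → E3) (al : ℝ) (g : E3) :
    al + ⟪g, ∑ k, lam k • v k⟫ = ∑ k, lam k * (al + ⟪g, v k⟫) := by
  rw [inner_sum]
  simp only [inner_smul_right, mul_add, Finset.sum_add_distrib, ← Finset.sum_mul, h1, one_mul]

lemma aff_bound {v : Fin 4 → E3} {al : ℝ} {g : E3} {ρ : ℝ} (hk : ∀ k, |al + ⟪g, v k⟫| ≤ ρ) {x : E3} (hx : x ∈ tet v) : |al + ⟪g, x⟫| ≤ ρ := by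
  obtain ⟨lam, p, s, rfl⟩ := tet_repr hx
  rw [aff_sum s]
  calc _ ≤ ∑ k, |lam k * (al + ⟪g, v k⟫)| := Finset.abs_sum_le_sum_abs _ _
    _ ≤ ∑ k, lam k * ρ := Finset.sum_le_sum fun k _ => by
      rw [abs_mul, abs_of_nonneg (p k)]; exact mul_le_mul_of_nonneg_left (hk k) (p k)
    _ = ρ := by rw [← Finset.sum_mul, s, one_mul]

lemma aff_grad {v : Fin 4 → E3} {al : ℝ} {g : E3} {ρ : ℝ} (hk : ∀ k, |al + ⟪g, v k⟫| ≤ ρ) {x : E3} {s : ℝ} (hs : 0 < s)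
    (hb : closedBall x s ⊆ tet v) : ‖g‖ * s ≤ ρ := by
  rcases eq_or_ne g 0 with rfl | hg
  · have := (abs_nonneg _).trans (hk 0); simpa using this
  have hn := norm_pos_iff.2 hg
  have hm : ‖(s / ‖g‖) • g‖ = s := by
    rw [norm_smul, Real.norm_of_nonneg (by positivity), div_mul_cancel₀ _ hn.ne']
  have h1 := abs_le.1 (aff_bound hk (hb (show x + (s / ‖g‖) • g ∈ closedBall x s by
    rw [mem_closedBall, dist_eq_norm, add_sub_cancel_left, hm])))
  have h2 := abs_le.1 (aff_bound hk (hb (show x - (s / ‖g‖) • g ∈ closedBall x s by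
    rw [mem_closedBall, dist_eq_norm, sub_sub_cancel_left, norm_neg, hm])))
  rw [inner_add_right, inner_smul_right, real_inner_self_eq_norm_sq] at h1
  rw [inner_sub_right, inner_smul_right, real_inner_self_eq_norm_sq] at h2
  have : s / ‖g‖ * ‖g‖ ^ 2 = ‖g‖ * s := by field_simp
  linarith [h1.2, h2.1]

lemma aff_exists {v : Fin 4 → E3} (hv : AffineIndependent ℝ v) (N : Fin 4 → ℝ) : ∃ (al : ℝ) (g : E3), ∀ k, al + ⟪g, v k⟫ = N k := by
  have htop : affineSpan ℝ (range v) = ⊤ := hv.affineSpan_eq_top_iff_card_eq_finrank_add_one.2 (by simp)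
  let b : AffineBasis (Fin 4) ℝ E3 := ⟨v, hv, htop⟩
  have h1 : ∀ i, ∃ (al : ℝ) (g : E3), ∀ x, al + ⟪g, x⟫ = b.coord i x := fun i => by
    refine ⟨b.coord i 0, (InnerProductSpace.toDual ℝ E3).symm (LinearMap.toContinuousLinearMap (b.coord i).linear), fun x => ?_⟩
    rw [InnerProductSpace.toDual_symm_apply]
    have h1 : b.coord i x = (b.coord i).linear x + b.coord i 0 := congrFun (AffineMap.decomp (b.coord i)) x
    rw [h1, add_comm]; rfl
  choose al g hg using h1
  refine ⟨∑ i, N i * al i, ∑ i, N i • g i, fun k => ?_⟩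
  have e : ∀ i, b.coord i (v k) = if i = k then 1 else 0 := fun i => b.coord_apply i k
  rw [sum_inner, ← Finset.sum_add_distrib]
  have : ∀ i, N i * al i + ⟪N i • g i, v k⟫ = N i * (if i = k then 1 else 0) := fun i => by
    rw [← e, ← hg, inner_smul_left]; simp; ring
  simp [this]

lemma avg_sq {f : E3 → ℝ} (z : E3) {h : ℝ} (hh : 0 < h) (hf : IntegrableOn f (closedBall z h)) (hf2 : IntegrableOn (fun x => f x ^ 2) (closedBall z h)) :
    ((h ^ 3 * om)⁻¹ * ∫ x in closedBall z h, f x) ^ 2 ≤ (h ^ 3 * om)⁻¹ * ∫ x in closedBall z h, f x ^ 2 := by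
  have hp : 0 < h ^ 3 * om := mul_pos (by positivity) om_pos
  set m := (h ^ 3 * om)⁻¹ * ∫ x in closedBall z h, f x with hm
  have h1 : ∫ x in closedBall z h, f x = h ^ 3 * om * m := by rw [hm, mul_inv_cancel_left₀ hp.ne']
  have h0 : 0 ≤ ∫ x in closedBall z h, (f x - m) ^ 2 := integral_nonneg fun x => by positivity
  have e : ∀ x, (f x - m) ^ 2 = f x ^ 2 - 2 * m * f x + m ^ 2 := fun x => by ring
  simp only [e] at h0
  have hc : IntegrableOn (fun _ : E3 => m ^ 2) (closedBall z h) := integrableOn_const measure_closedBall_lt_top.ne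
  have hi : Integrable (fun x => f x ^ 2 - 2 * m * f x) (volume.restrict (closedBall z h)) := hf2.sub (hf.const_mul (2 * m))
  rw [integral_add hi hc, integral_sub hf2 (hf.const_mul _), integral_const_mul, h1, setIntegral_const, vol_cb z hh.le, smul_eq_mul] at h0
  rw [inv_mul_eq_div, le_div_iff₀ hp]
  nlinarith

lemma ball_trans (f : E3 → ℝ) (z t : E3) (h : ℝ) : ∫ x in closedBall (z + t) h, f x = ∫ x in closedBall z h, f (x + t) := by
  rw [← integral_indicator measurableSet_closedBall, ← integral_indicator measurableSet_closedBall, ← integral_add_right_eq_self _ t]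
  congr 1; ext x
  have : x + t ∈ closedBall (z + t) h ↔ x ∈ closedBall z h := by
    rw [mem_closedBall, mem_closedBall, dist_add_right]
  by_cases hx : x ∈ closedBall z h
  · rw [indicator_of_mem hx, indicator_of_mem (this.2 hx)]
  · rw [indicator_of_notMem hx, indicator_of_notMem (mt this.1 hx)]

namespace Geo

variable {Ω : Set E3} (G : Geo Ω)

open Classical in
/-- Nodal values. -/
def nod (h : ℝ) (w : E3 → ℝ) (z : E3) : ℝ :=
  if 200 * h ≤ G.q z then (h ^ 3 * om)⁻¹ * ∫ x in closedBall z h, w x else 0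

lemma nod_frontier {h : ℝ} (hh : 0 < h) {φ : E3 → ℝ} (hφ : Lip0 Ω φ) {z : E3} (hz : z ∈ closure Ω) {a : Fin G.N} (ha : G.l a z = 0) :
    G.nod h (G.hat φ) z = 0 := by
  unfold nod
  split_ifs with hq
  swap
  · rfl
  have hA : G.A (some a) z = z := by simp [A, ha]
  have e : ∀ x ∈ closedBall z h, G.hat φ x = φ x - φ (G.A (some a) x) := fun x hx => by
    rw [mem_closedBall, dist_eq_norm] at hx
    unfold hat
    rw [Fintype.sum_option, Finset.sum_eq_single a]
    · simp [sg, A]; ring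
    · intro j _ hj
      rw [hφ.2, mul_zero]
      intro hm
      have h1 := G.l_pos hm j
      rw [G.l_A] at h1
      have h2 := G.q_le hj z
      have h3 := abs_le.1 (G.l_lip j x z)
      linarith [h3.1]
    · simp
  rw [setIntegral_congr_fun measurableSet_closedBall e]
  have hc := (hφ.lc G.dom).nice
  have i1 : IntegrableOn φ (closedBall z h) := hc.integrable.integrableOn
  have i2 : IntegrableOn (fun x => φ (G.A (some a) x)) (closedBall z h) := ((G.A_ai _).nice hc).integrable.integrableOn
  rw [integral_sub i1 i2]
  have : ∫ x in closedBall z h, φ (G.A (some a) x) = ∫ x in closedBall z h, φ x := by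
    rw [← integral_indicator measurableSet_closedBall, ← integral_indicator measurableSet_closedBall, ← (G.A_ai (some a)).integral]
    congr 1; ext x
    have hm : G.A (some a) x ∈ closedBall z h ↔ x ∈ closedBall z h := by
      rw [mem_closedBall, mem_closedBall, dist_eq_norm, dist_eq_norm, ← (G.A_ai (some a)).iso x z, hA]
    by_cases hx : x ∈ closedBall z h
    · rw [indicator_of_mem (hm.2 hx), indicator_of_mem hx, G.A_inv]
    · rw [indicator_of_notMem (mt hm.1 hx), indicator_of_notMem hx]
  rw [this, sub_self, mul_zero]

lemma nod_sq {h : ℝ} (hh : 0 < h) {w : E3 → ℝ} (hw : LC w) {z y : E3} (hy : ‖y - z‖ ≤ h) :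
    G.nod h w y ^ 2 ≤ (h ^ 3 * om)⁻¹ * ∫ x in closedBall z (3 * h), w x ^ 2 := by
  have hp : 0 ≤ (h ^ 3 * om)⁻¹ := by have := om_pos; positivity
  unfold nod
  split_ifs with hq
  · refine (avg_sq y hh hw.nice.integrable.integrableOn hw.nice.sq.integrable.integrableOn).trans (mul_le_mul_of_nonneg_left ?_ hp)
    refine setIntegral_mono_set hw.nice.sq.integrable.integrableOn (Filter.Eventually.of_forall fun x => by positivity) ?_
    refine HasSubset.Subset.eventuallyLE (closedBall_subset_closedBall' ?_)
    rw [dist_eq_norm]; linarith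
  · rw [zero_pow two_ne_zero]
    exact mul_nonneg hp (integral_nonneg fun x => by positivity)

lemma cb_nice (z : E3) (r : ℝ) : Nice ((closedBall z r).indicator fun _ => (1 : ℝ)) :=
  ⟨measurable_const.indicator measurableSet_closedBall, ⟨1, fun x => by
    by_cases h : x ∈ closedBall z r <;> simp [h]⟩, ⟨‖z‖ + r, fun x hx => indicator_of_notMem (fun h => by
      rw [mem_closedBall, dist_eq_norm] at h
      have := norm_add_le (x - z) z
      rw [sub_add_cancel] at this
      linarith) _⟩⟩

lemma cb_int (z : E3) (r : ℝ) (f : E3 → ℝ) : ∫ x, (closedBall z r).indicator (fun _ => (1 : ℝ)) x * f x = ∫ x in closedBall z r, f x := by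
  rw [← integral_indicator measurableSet_closedBall]
  congr 1; ext x
  by_cases h : x ∈ closedBall z r <;> simp [h]

lemma nod_good {h : ℝ} (hh : 0 < h) {w : E3 → ℝ} (hw : LC w) {z t : E3} (ht : ‖t‖ ≤ h) (hq : 202 * h ≤ G.q z) (g : E3) :
    (G.nod h w (z + t) - G.nod h w z - ⟪g, t⟫) ^ 2 ≤ (h ^ 3 * om)⁻¹ * h ^ 2 * ∫ x in closedBall z (3 * h), ‖gradient w x - g‖ ^ 2 := by
  have hp : 0 < h ^ 3 * om := mul_pos (by positivity) om_pos
  have hq1 : 200 * h ≤ G.q z := by linarith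
  have hq2 : 200 * h ≤ G.q (z + t) := by
    have := (abs_le.1 (G.q_lip (z + t) z)).1
    rw [add_sub_cancel_left] at this
    linarith
  set w1 : E3 → ℝ := fun x => w x - ⟪g, x⟫ with hw1
  have hL : Lip w1 := hw.1.sub (lip_inner g)
  have e : G.nod h w (z + t) - G.nod h w z - ⟪g, t⟫ = (h ^ 3 * om)⁻¹ * ∫ x in closedBall z h, (w1 (x + t) - w1 x) := by
    unfold nod
    rw [if_pos hq1, if_pos hq2, ball_trans]
    have e1 : ∀ x, w1 (x + t) - w1 x = w (x + t) - w x - ⟪g, t⟫ := fun x => by simp only [hw1, inner_add_right]; ring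
    simp only [e1]
    have i1 : IntegrableOn (fun x => w (x + t)) (closedBall z h) := (hw.nice.trans t).integrable.integrableOn
    have i2 : IntegrableOn w (closedBall z h) := hw.nice.integrable.integrableOn
    rw [integral_sub (f := fun x => w (x + t) - w x) (i1.sub i2) (integrableOn_const measure_closedBall_lt_top.ne), integral_sub i1 i2, setIntegral_const, vol_cb z hh.le, smul_eq_mul,
      mul_sub, mul_sub, inv_mul_cancel_left₀ hp.ne']
  have hcont : Continuous fun x => w1 (x + t) - w1 x := (hL.cont.comp (continuous_add_const t)).sub hL.cont
  rw [e]
  refine (avg_sq z hh (hcont.continuousOn.integrableOn_compact (isCompact_closedBall _ _)) ((hcont.pow 2).continuousOn.integrableOn_compact (isCompact_closedBall _ _))).trans ?_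
  rw [mul_assoc]
  refine mul_le_mul_of_nonneg_left ?_ (by positivity)
  have key := trans_sq hL (cb_nice z h) (cb_nice z (3 * h)) t (fun x => indicator_nonneg (fun _ _ => zero_le_one) _) (fun x => indicator_nonneg (fun _ _ => zero_le_one) _)
    (fun x s hs0 hs1 => by
      by_cases hx : x - s • t ∈ closedBall z h
      · have : x ∈ closedBall z (3 * h) := by
          rw [mem_closedBall, dist_eq_norm] at hx ⊢
          have h1 : ‖s • t‖ ≤ h := by
            rw [norm_smul, Real.norm_of_nonneg hs0]; nlinarith [norm_nonneg t]
          have := norm_add_le (x - s • t - z) (s • t)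
          rw [show x - s • t - z + s • t = x - z by abel] at this
          linarith
        simp [hx, this]
      · rw [indicator_of_notMem hx]; exact indicator_nonneg (fun _ _ => zero_le_one) _)
  rw [cb_int, cb_int] at key
  refine key.trans ?_
  rw [← integral_const_mul]
  have hg : ∀ᵐ x, gradient w1 x = gradient w x - g := by
    filter_upwards [hw.1.ae] with x hx
    rw [hw1, grad_sub (w := fun x => ⟪g, x⟫) hx ((innerSL ℝ g).differentiableAt), grad_inner_const]
  have hbm : BM (fun x => gradient w x - g) := hw.grad.bm.sub (bm_const g)
  have hI : IntegrableOn (fun x => ‖gradient w x - g‖ ^ 2) (closedBall z (3 * h)) := by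
    obtain ⟨C, hC⟩ := hbm.norm.sq.2
    exact Measure.integrableOn_of_bounded (M := C) measure_closedBall_lt_top.ne hbm.norm.sq.1.aestronglyMeasurable (Filter.Eventually.of_forall hC)
  refine integral_mono_of_nonneg (Filter.Eventually.of_forall fun x => by positivity) (hI.const_mul _) ?_
  filter_upwards [ae_restrict_of_ae hg] with x hx
  rw [hx]
  have := abs_real_inner_le_norm (gradient w x - g) t
  calc _ = |⟪gradient w x - g, t⟫| ^ 2 := (sq_abs _).symm
    _ ≤ (‖gradient w x - g‖ * ‖t‖) ^ 2 := by gcongr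
    _ ≤ (‖gradient w x - g‖ * h) ^ 2 := by gcongr
    _ = _ := by ring

end Geo

/-! ### The interpolant -/

lemma grad_congr_int {u p : E3 → ℝ} {S : Set E3} (h : ∀ x ∈ S, u x = p x) {x : E3} (hx : x ∈ interior S) : gradient u x = gradient p x := by
  have : u =ᶠ[nhds x] p := by
    filter_upwards [isOpen_interior.mem_nhds hx] with y hy using h y (interior_subset hy)
  unfold gradient; rw [this.fderiv_eq]

namespace Geo

variable {Ω : Set E3} (G : Geo Ω)

lemma interp {T : Finset (Fin 4 → E3)} {h c : ℝ} (M : Mesh Ω T h c) {r : ℕ} (hr : 1 ≤ r) {N : E3 → ℝ}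
    (hN : ∀ z ∈ closure Ω, ∀ a, G.l a z = 0 → N z = 0) :
    ∃ (I : E3 → ℝ) (al : (Fin 4 → E3) → ℝ) (g : (Fin 4 → E3) → E3), MemSh0 Ω T r I ∧
      (∀ v ∈ T, ∀ x ∈ tet v, I x = al v + ⟪g v, x⟫) ∧ ∀ v ∈ T, ∀ k, al v + ⟪g v, v k⟫ = N (v k) := by
  classical
  have h1 : ∀ v ∈ T, ∃ (al : ℝ) (g : E3), ∀ k, al + ⟪g, v k⟫ = N (v k) := fun v hv => aff_exists (M.ai v hv) _
  choose! al g hg using h1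
  have hcomp : ∀ v ∈ T, ∀ w ∈ T, ∀ x ∈ tet v, x ∈ tet w → al v + ⟪g v, x⟫ = al w + ⟪g w, x⟫ := fun v hv w hw x hxv hxw => by
    have hx := M.conf v hv w hw x hxv hxw
    have : convexHull ℝ (range v ∩ range w) ⊆ {y | al v + ⟪g v, y⟫ = al w + ⟪g w, y⟫} := by
      refine convexHull_min ?_ ?_
      · rintro y ⟨⟨k, rfl⟩, ⟨j, hj⟩⟩
        simp only [mem_ofPred_eq]
        rw [hg v hv k, ← hj, hg w hw j]
      · intro y hy z hz a b ha hb hab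
        simp only [mem_ofPred_eq, inner_add_right, inner_smul_right] at *
        have e : a = 1 - b := by linarith
        subst e
        linear_combination (1 - b) * hy + b * hz
    exact this hx
  let I : E3 → ℝ := fun x => if hx : ∃ v ∈ T, x ∈ tet v then al hx.choose + ⟪g hx.choose, x⟫ else 0
  have hI : ∀ v ∈ T, ∀ x ∈ tet v, I x = al v + ⟪g v, x⟫ := fun v hv x hx => by
    have hex : ∃ v ∈ T, x ∈ tet v := ⟨v, hv, hx⟩
    simp only [I, dif_pos hex]
    exact hcomp _ hex.choose_spec.1 v hv x hex.choose_spec.2 hx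
  refine ⟨I, al, g, ⟨⟨?_, fun v hv => ?_⟩, fun x hx => ?_⟩, hI, hg⟩
  · have e : closure Ω = ⋃ v : {v // v ∈ T}, tet v.1 := by rw [← M.cov, iUnion_subtype]
    rw [e]
    refine LocallyFinite.continuousOn_iUnion (locallyFinite_of_finite _) (fun v => tet_closed v.1) fun v => ?_
    have : ContinuousOn (fun x => al v.1 + ⟪g v.1, x⟫) (tet v.1) := by fun_prop
    exact this.congr fun x hx => hI _ v.2 x hx
  · obtain ⟨q, hq, hq'⟩ := pe_lin (al v) (g v)
    exact ⟨q, hq.trans hr, fun x hx => (hI v hv x hx).trans (hq' x).symm⟩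
  · have hxc : x ∈ closure Ω := frontier_subset_closure hx
    obtain ⟨v, hv, hxv⟩ := M.ex_tet hxc
    obtain ⟨a, ha⟩ := G.d_ex x
    rw [G.frontier_d hx] at ha
    rw [hI v hv x hxv]
    obtain ⟨lam, h0, h1, rfl⟩ := tet_repr hxv
    rw [aff_sum h1]
    refine Finset.sum_eq_zero fun k _ => ?_
    have hl : ∀ k, 0 ≤ lam k * G.l a (v k) := fun k =>
      mul_nonneg (h0 k) (G.l_nonneg (M.sub_closure hv (tet_vert v k)) a)
    have hs : ∑ k, lam k * G.l a (v k) = 0 := by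
      rw [← ha]; unfold Geo.l
      have := aff_sum h1 v (G.a a) (G.n a)
      simp only [add_comm (G.a a)] at this
      exact this.symm
    have h2 := (Finset.sum_eq_zero_iff_of_nonneg fun k _ => hl k).1 hs k (Finset.mem_univ k)
    rw [hg v hv k]
    rcases mul_eq_zero.1 h2 with h3 | h3
    · simp [h3]
    · rw [hN _ (M.sub_closure hv (tet_vert v k)) a h3, mul_zero]

/-- The constant. -/
def C0 (c : ℝ) : ℝ := 64 / c ^ 3 * (8 + 313 ^ 2 + 313 ^ 4)

lemma interp_err {T : Finset (Fin 4 → E3)} {h c : ℝ} (M : Mesh Ω T h c) (hc : 0 < c) (hh : 0 < h) {r : ℕ} (hr : 1 ≤ r) {φ : E3 → ℝ}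
    (hφ : Lip0 Ω φ) {Q : ℝ}
    (H1 : ∫ x, (G.P h x)⁻¹ ^ 2 * ‖gradient (G.hat φ) x‖ ^ 2 ≤ Q / h ^ 2) (H2 : ∫ x, (G.P h x)⁻¹ ^ 4 * G.hat φ x ^ 2 ≤ Q / h ^ 2)
    (H3 : ∀ t : E3, ‖t‖ ≤ 6 * h → ∫ x, G.eta h x ^ 2 * ‖gradient (G.hat φ) (x + t) - gradient (G.hat φ) x‖ ^ 2 ≤ Q) :
    ∃ (I : E3 → ℝ) (g : (Fin 4 → E3) → E3), MemSh0 Ω T r I ∧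
      DD (fun x => φ x - Ω.indicator I x) (fun x => φ x - Ω.indicator I x) ≤ (2 + 8 / c ^ 2) * (C0 c * Q) ∧
      ∑ v ∈ T, (∫ x in closedBall (v 0) (3 * h), ‖gradient (G.hat φ) x - g v‖ ^ 2) ≤ C0 c * Q := by
  have hφL := hφ.lc G.dom
  set w := G.hat φ with hwdef
  have hw : LC w := G.hat_lc hφL
  obtain ⟨g, b, hb, hbad, hsum⟩ := G.gv_sum M hc hh hw H1 H2 H3
  obtain ⟨I, al, gI, hI0, hI, hnod⟩ := G.interp M hr (N := G.nod h w) fun z hz a ha => G.nod_frontier hh hφ hz ha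
  set R : (Fin 4 → E3) → ℝ := fun v => ∫ x in closedBall (v 0) (3 * h), ‖gradient w x - g v‖ ^ 2 with hR
  have hR0 : ∀ v, 0 ≤ R v := fun v => integral_nonneg fun x => by positivity
  have hp : 0 < h ^ 3 * om := mul_pos (by positivity) om_pos
  have hvk : ∀ v ∈ T, ∀ k, ‖v k - v 0‖ ≤ h := fun v hv k => M.dist_le hv (tet_vert v k) (tet_vert v 0)
  have hk : ∀ v ∈ T, ∀ k, (G.nod h w (v k) - G.nod h w (v 0) - ⟪g v, v k - v 0⟫) ^ 2 ≤ (h ^ 3 * om)⁻¹ * h ^ 2 * (4 * (R v + b v)) := fun v hv k => by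
    have hpi : 0 < (h ^ 3 * om)⁻¹ * h ^ 2 := by positivity
    rcases lt_or_ge (G.q (v 0)) (202 * h) with hq | hq
    · obtain ⟨hg0, hw2⟩ := hbad v hv hq
      have h1 := G.nod_sq hh hw (hvk v hv k)
      have h2 := G.nod_sq hh hw (hvk v hv 0)
      have h3 := mul_le_mul_of_nonneg_left hw2 (inv_pos.2 hp).le
      rw [hg0, inner_zero_left, sub_zero]
      have h4 := mul_nonneg hpi.le (hR0 v)
      nlinarith [sq_nonneg (G.nod h w (v k) + G.nod h w (v 0))]
    · have := G.nod_good hh hw (hvk v hv k) hq (g v)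
      rw [add_sub_cancel] at this
      refine this.trans (mul_le_mul_of_nonneg_left ?_ hpi.le)
      have := hR0 v; have := hb v
      change R v ≤ _
      linarith
  have hG : ∀ v ∈ T, ‖g v - gI v‖ ^ 2 * (h ^ 3 * om) ≤ 4 / c ^ 2 * (R v + b v) := fun v hv => by
    obtain ⟨x0, hx0⟩ := M.inb v hv
    have hA : 0 ≤ (h ^ 3 * om)⁻¹ * h ^ 2 * (4 * (R v + b v)) := (sq_nonneg _).trans (hk v hv 0)
    have := aff_grad (v := v) (al := al v - G.nod h w (v 0) + ⟪g v, v 0⟫) (g := gI v - g v) (ρ := √((h ^ 3 * om)⁻¹ * h ^ 2 * (4 * (R v + b v))))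
      (fun k => by
        refine Real.abs_le_sqrt (le_trans (le_of_eq ?_) (hk v hv k))
        rw [← hnod v hv k, inner_sub_left, inner_sub_right]; ring) (mul_pos hc hh) hx0
    have h2 := pow_le_pow_left₀ (by positivity) this 2
    rw [Real.sq_sqrt hA, mul_pow, mul_pow, norm_sub_rev] at h2
    have h3 : (h ^ 3 * om) * ((h ^ 3 * om)⁻¹ * h ^ 2 * (4 * (R v + b v))) = h ^ 2 * (4 * (R v + b v)) := by
      rw [mul_assoc _⁻¹, mul_inv_cancel_left₀ hp.ne']
    have h4 := mul_le_mul_of_nonneg_left h2 hp.le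
    rw [h3] at h4
    have h5 : 0 < h ^ 2 := by positivity
    rw [div_mul_eq_mul_div, le_div_iff₀ (by positivity)]
    refine le_of_mul_le_mul_left ?_ h5
    nlinarith
  refine ⟨I, g, hI0, ?_, (Finset.sum_le_sum fun v _ => le_add_of_nonneg_right (hb v)).trans hsum⟩
  have hIL := memsh_lip0 G.dom M hI0
  have hd : Lip0 Ω (fun x => φ x - Ω.indicator I x) := hφ.sub hIL
  have hbm : ∀ v, BM (fun x => gradient w x - g v) := fun v => hw.grad.bm.sub (bm_const _)
  have i1 : ∀ v, Integrable (fun x => (closedBall (v 0) (3 * h)).indicator (fun _ => (1 : ℝ)) x * ‖gradient w x - g v‖ ^ 2) := fun v =>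
    (Nice.mul (cb_nice _ _) (hbm v).norm.sq).integrable
  have i2 : ∀ v : Fin 4 → E3, Integrable (fun x => (closedBall (v 0) h).indicator (fun _ => (1 : ℝ)) x * ‖g v - gI v‖ ^ 2) := fun v =>
    (Nice.mul (cb_nice _ _) (bm_const _)).integrable
  have hpt : ∀ᵐ x, ‖gradient (fun x => φ x - Ω.indicator I x) x‖ ^ 2 ≤ ∑ v ∈ T,
      (2 * ((closedBall (v 0) (3 * h)).indicator (fun _ => (1 : ℝ)) x * ‖gradient w x - g v‖ ^ 2) +
        2 * ((closedBall (v 0) h).indicator (fun _ => (1 : ℝ)) x * ‖g v - gI v‖ ^ 2)) := by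
    filter_upwards [hφ.1.ae, hIL.1.ae, M.ae_interior, G.dom.ae_grad hd.2] with x hx1 hx2 hx3 hx4
    have hn : ∀ v, 0 ≤ (2 * ((closedBall (v 0) (3 * h)).indicator (fun _ => (1 : ℝ)) x * ‖gradient w x - g v‖ ^ 2) +
        2 * ((closedBall (v 0) h).indicator (fun _ => (1 : ℝ)) x * ‖g v - gI v‖ ^ 2)) := fun v => by
      have hi : ∀ S : Set E3, 0 ≤ S.indicator (fun _ => (1 : ℝ)) x := fun S => indicator_nonneg (fun _ _ => zero_le_one) _
      have := hi (closedBall (v 0) (3 * h)); have := hi (closedBall (v 0) h)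
      positivity
    by_cases hx : x ∈ Ω
    swap
    · rw [hx4 hx, norm_zero]; simpa using Finset.sum_nonneg fun v _ => hn v
    obtain ⟨v, hv, hxv⟩ := M.ex_tet (subset_closure hx)
    refine le_trans ?_ (Finset.single_le_sum (fun v _ => hn v) hv)
    have hxb : x ∈ closedBall (v 0) h := by
      rw [mem_closedBall, dist_eq_norm]; exact M.dist_le hv hxv (tet_vert v 0)
    have hxb' : x ∈ closedBall (v 0) (3 * h) := closedBall_subset_closedBall (by linarith) hxb
    rw [indicator_of_mem hxb, indicator_of_mem hxb', one_mul, one_mul, grad_sub hx1 hx2, Geo.grad_ind G.dom.1 hx,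
      grad_congr_int (hI v hv) (hx3 v hv hxv)]
    have e1 : gradient φ x = gradient w x := grad_congr_int (S := Ω) (fun y hy => (G.hat_eq hφ.2 (subset_closure hy)).symm) (by rwa [G.dom.1.interior_eq])
    have e2 : gradient (fun x => al v + ⟪gI v, x⟫) x = gI v := by
      refine grad_ext fun t => ?_
      have : HasFDerivAt (fun x => al v + ⟪gI v, x⟫) (innerSL ℝ (gI v)) x := ((innerSL ℝ (gI v)).hasFDerivAt).const_add _
      rw [this.fderiv]; rfl
    rw [e1, e2]
    have h1 : ‖gradient w x - gI v‖ ≤ ‖gradient w x - g v‖ + ‖g v - gI v‖ := norm_sub_le_norm_sub_add_norm_sub _ _ _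
    have h2 := pow_le_pow_left₀ (norm_nonneg _) h1 2
    nlinarith [sq_nonneg (‖gradient w x - g v‖ - ‖g v - gI v‖)]
  rw [DD_self]
  refine (integral_mono_ae (hd.lc G.dom).grad.norm.sq.integrable (integrable_finsetSum _ fun v _ => ((i1 v).const_mul 2).fun_add ((i2 v).const_mul 2)) hpt).trans ?_
  rw [integral_finsetSum _ fun v _ => ((i1 v).const_mul 2).fun_add ((i2 v).const_mul 2)]
  calc _ ≤ ∑ v ∈ T, (2 + 8 / c ^ 2) * (R v + b v) := Finset.sum_le_sum fun v hv => by
        rw [integral_add ((i1 v).const_mul 2) ((i2 v).const_mul 2), integral_const_mul, integral_const_mul, cb_int, cb_int, setIntegral_const, vol_cb _ hh.le, smul_eq_mul]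
        have := hG v hv
        have := hb v
        change 2 * R v + _ ≤ _
        have e : (2 + 8 / c ^ 2) * (R v + b v) = 2 * R v + 2 * b v + 2 * (4 / c ^ 2 * (R v + b v)) := by ring
        rw [e]; nlinarith
    _ ≤ _ := by
        rw [← Finset.mul_sum]
        exact mul_le_mul_of_nonneg_left hsum (by positivity)

end Geo

/-! ### The discrete space -/

/-- Finite element functions extended by zero. -/
def Vh (Ω : Set E3) (T : Finset (Fin 4 → E3)) (r : ℕ) (v : E3 → ℝ) : Prop := MemSh0 Ω T r v ∧ ∀ x, x ∉ Ω → v x = 0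

lemma ind_closure {Ω : Set E3} (hO : IsOpen Ω) {u : E3 → ℝ} (h0 : ∀ x ∈ frontier Ω, u x = 0) {x : E3} (hx : x ∈ closure Ω) : Ω.indicator u x = u x := by
  by_cases h : x ∈ Ω
  · simp [h]
  · rw [indicator_of_notMem h, h0 x ⟨hx, by rwa [hO.interior_eq]⟩]

lemma vh_ind {Ω : Set E3} (hO : IsOpen Ω) {T : Finset (Fin 4 → E3)} {h c : ℝ} (M : Mesh Ω T h c) {r : ℕ} {u : E3 → ℝ} (hu : MemSh0 Ω T r u) :
    Vh Ω T r (Ω.indicator u) := by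
  have e : ∀ x ∈ closure Ω, Ω.indicator u x = u x := fun x hx => ind_closure hO hu.2 hx
  refine ⟨⟨⟨hu.1.1.congr e, fun v hv => ?_⟩, fun x hx => (e x (frontier_subset_closure hx)).trans (hu.2 x hx)⟩, fun x hx => indicator_of_notMem hx _⟩
  obtain ⟨p, hp, hp'⟩ := hu.1.2 v hv
  exact ⟨p, hp, fun x hx => (e x (M.sub_closure hv hx)).trans (hp' x hx)⟩

lemma Vh.lip0 {Ω : Set E3} (hΩ : Dom Ω) {T : Finset (Fin 4 → E3)} {h c : ℝ} (M : Mesh Ω T h c) {r : ℕ} {u : E3 → ℝ} (hu : Vh Ω T r u) : Lip0 Ω u := by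
  have := memsh_lip0 hΩ M hu.1
  have e : Ω.indicator u = u := indicator_eq_self.2 fun x hx => by
    by_contra h; exact hx (hu.2 x h)
  rwa [e] at this

lemma vh_zero (Ω : Set E3) (T : Finset (Fin 4 → E3)) (r : ℕ) : Vh Ω T r (fun _ => 0) :=
  ⟨⟨⟨continuousOn_const, fun v _ => ⟨0, by simp, fun x _ => by simp⟩⟩, fun _ _ => rfl⟩, fun _ _ => rfl⟩

lemma Vh.add {Ω : Set E3} {T : Finset (Fin 4 → E3)} {r : ℕ} {u w : E3 → ℝ} (s : ℝ) (hu : Vh Ω T r u) (hw : Vh Ω T r w) :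
    Vh Ω T r (fun x => u x + s * w x) := by
  refine ⟨⟨⟨hu.1.1.1.add (continuousOn_const.mul hw.1.1.1), fun v hv => ?_⟩, fun x hx => by simp [hu.1.2 x hx, hw.1.2 x hx]⟩,
    fun x hx => by simp [hu.2 x hx, hw.2 x hx]⟩
  obtain ⟨p, hp, hp'⟩ := hu.1.1.2 v hv
  obtain ⟨q, hq, hq'⟩ := hw.1.1.2 v hv
  refine ⟨p + MvPolynomial.C s * q, (MvPolynomial.totalDegree_add _ _).trans (max_le hp ((MvPolynomial.totalDegree_mul _ _).trans (by simpa using hq))), fun x hx => ?_⟩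
  simp [hp' x hx, hq' x hx]

lemma galerkin {Ω : Set E3} (hΩ : Dom Ω) {T : Finset (Fin 4 → E3)} {h c : ℝ} (M : Mesh Ω T h c) {r : ℕ} {f φ I : E3 → ℝ} (hf : Nice f) {ε : ℝ}
    (hε : 0 < ε) (hε' : ε ≤ 1 / 8) (hφ : AppSol Ω f ε φ) (hI : Vh Ω T r I) :
    ∃ ψ, Vh Ω T r ψ ∧ (∀ χ, Vh Ω T r χ → |DD ψ χ - ∫ x, f x * χ x| ≤ ε * (1 + DD χ χ)) ∧
      DD (fun x => φ x - ψ x) (fun x => φ x - ψ x) ≤ DD (fun x => φ x - I x) (fun x => φ x - I x) + 4 * ε := by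
  obtain ⟨R, hR, hRb⟩ := hΩ.ball
  obtain ⟨ψ, hψ, -, hψ'⟩ := approx_sol (Vh Ω T r) hR (fun v hv => ⟨(hv.lip0 hΩ M).1, fun x hx => hv.2 x fun h =>
    absurd (hRb x (subset_closure h)) (not_le.2 hx)⟩) (vh_zero Ω T r) (fun v w s hv hw => hv.add s hw) hf hε
  refine ⟨ψ, hψ, hψ', ?_⟩
  have hφ0 := hφ.1
  have hψ0 := hψ.lip0 hΩ M
  set θ : E3 → ℝ := fun x => φ x - ψ x with hθ
  set χ : E3 → ℝ := fun x => ψ x + (-1) * I x with hχ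
  have hχV : Vh Ω T r χ := hψ.add (-1) hI
  have hχ0 := hχV.lip0 hΩ M
  have hθ0 : Lip0 Ω θ := hφ0.sub hψ0
  have e : (fun x => φ x - I x) = fun x => θ x + χ x := by ext x; simp [hθ, hχ]; ring
  have hθL := hθ0.lc hΩ; have hχL := hχ0.lc hΩ
  have hs := hθ0.add hχ0
  rw [e, DD_add_right (hs.lc hΩ) hθL hχL, DD_comm (fun x => θ x + χ x) θ, DD_comm (fun x => θ x + χ x) χ, DD_add_right hθL hθL hχL, DD_add_right hχL hθL hχL, DD_comm χ θ]
  have h1 : DD θ χ = DD φ χ - DD ψ χ := by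
    rw [DD_comm, hθ, DD_sub_right hχL (hφ0.lc hΩ) (hψ0.lc hΩ), DD_comm χ, DD_comm χ]
  have h2 := abs_le.1 (hφ.2 χ hχ0)
  have h3 := abs_le.1 (hψ' χ hχV)
  have h4 := DD_self_nonneg χ
  nlinarith

/-! ### Boundary layers of convex sets -/

lemma layer {K : Set E3} (hK : Convex ℝ K) (hm : MeasurableSet K) (hb : Bornology.IsBounded K) {x0 : E3} {ρ s : ℝ} (hρ : 0 < ρ) (hs : 0 < s) (hsρ : s < ρ)
    (hx0 : closedBall x0 ρ ⊆ K) :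
    ∃ S, MeasurableSet S ∧ S ⊆ K ∧ volume.real S ≤ 3 * (s / ρ) * volume.real K ∧ ∀ x ∈ K, x ∉ S → closedBall x s ⊆ K := by
  have hl : 0 < 1 - s / ρ := by rw [sub_pos, div_lt_one hρ]; exact hsρ
  have hl1 : 0 < s / ρ := by positivity
  set l := s / ρ with hldef
  set A := AffineMap.homothety x0 (1 - l) '' K with hA
  have hx0K : x0 ∈ K := hx0 (mem_closedBall_self hρ.le)
  have hAe : A = (fun x => x0 + (1 - l)⁻¹ • (x - x0)) ⁻¹' K := by
    ext x
    simp only [hA, mem_image, mem_preimage, AffineMap.homothety_apply, vsub_eq_sub, vadd_eq_add]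
    constructor
    · rintro ⟨y, hy, rfl⟩
      rwa [add_sub_cancel_right, smul_smul, inv_mul_cancel₀ hl.ne', one_smul, add_sub_cancel]
    · intro h
      exact ⟨_, h, by rw [add_sub_cancel_left, smul_smul, mul_inv_cancel₀ hl.ne', one_smul, sub_add_cancel]⟩
  have hAm : MeasurableSet A := by rw [hAe]; exact (by fun_prop : Measurable fun x => x0 + (1 - l)⁻¹ • (x - x0)) hm
  have hAK : A ⊆ K := by
    rintro _ ⟨y, hy, rfl⟩
    rw [AffineMap.homothety_eq_lineMap]
    exact hK.lineMap_mem hx0K hy ⟨hl.le, by linarith⟩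
  have hfin : volume K ≠ ⊤ := hb.measure_lt_top.ne
  have hv : volume.real A = (1 - l) ^ 3 * volume.real K := by
    rw [hA, measureReal_def, Measure.addHaar_image_homothety, ENNReal.toReal_mul, ENNReal.toReal_ofReal (abs_nonneg _), abs_of_pos (by positivity), measureReal_def]
    simp
  refine ⟨K \ A, hm.diff hAm, sdiff_subset, ?_, fun x hx hxS y hy => ?_⟩
  · rw [measureReal_sdiff hAK hAm hfin, hv]
    have h0 : 0 ≤ volume.real K := measureReal_nonneg
    have h1 : 0 ≤ l ^ 2 * (3 - l) := mul_nonneg (by positivity) (by linarith)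
    nlinarith [mul_nonneg h1 h0]
  · have hxA : x ∈ A := by by_contra h; exact hxS ⟨hx, h⟩
    obtain ⟨z, hz, rfl⟩ := hxA
    rw [AffineMap.homothety_apply, vsub_eq_sub, vadd_eq_add, mem_closedBall, dist_eq_norm] at hy
    have hq : x0 + l⁻¹ • (y - ((1 - l) • (z - x0) + x0)) ∈ K := hx0 (by
      rw [mem_closedBall, dist_eq_norm, add_sub_cancel_left, norm_smul, norm_inv, Real.norm_of_nonneg hl1.le, inv_mul_le_iff₀ hl1, hldef, div_mul_cancel₀ _ hρ.ne']
      exact hy)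
    have := hK hz hq hl.le hl1.le (by ring)
    convert this using 1
    rw [smul_add, smul_smul, mul_inv_cancel₀ hl1.ne']
    module

/-! ### Difference quotients -/

lemma dq_limit {u w : E3 → ℝ} (hu : LC u) (hw : LC w) {e : E3} (he : ‖e‖ = 1) :
    Filter.Tendsto (fun s : ℝ => ∫ x, (s⁻¹ * (u (x + s • e) - u x)) * (s⁻¹ * (w (x + s • e) - w x))) (nhdsWithin 0 (Ioi 0))
      (nhds (∫ x, ⟪gradient u x, e⟫ * ⟪gradient w x, e⟫)) := by
  obtain ⟨Ku, hKu, hu1⟩ := hu.1.le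
  obtain ⟨Kw, hKw, hw1⟩ := hw.1.le
  obtain ⟨R, hR⟩ := hu.2
  have hq : ∀ {f : E3 → ℝ} {K : ℝ}, (∀ x y, |f x - f y| ≤ K * ‖x - y‖) → ∀ s : ℝ, 0 < s → ∀ x, |s⁻¹ * (f (x + s • e) - f x)| ≤ K := fun {f K} hf s hs x => by
    have := hf (x + s • e) x
    rw [add_sub_cancel_left, norm_smul, he, Real.norm_of_nonneg hs.le, mul_one] at this
    rw [abs_mul, abs_of_pos (inv_pos.2 hs), inv_mul_le_iff₀ hs, mul_comm]; exact this
  have h1 : ∀ᶠ s : ℝ in nhdsWithin 0 (Ioi 0), 0 < s ∧ s < 1 := Ioo_mem_nhdsGT zero_lt_one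
  refine tendsto_integral_filter_of_dominated_convergence (fun x => (closedBall (0 : E3) (|R| + 1)).indicator (fun _ => Ku * Kw) x) ?_ ?_ ?_ ?_
  · refine Filter.Eventually.of_forall fun s => ?_
    have h1 := hu.1.cont; have h2 := hw.1.cont
    exact (by fun_prop : Continuous fun x => (s⁻¹ * (u (x + s • e) - u x)) * (s⁻¹ * (w (x + s • e) - w x))).aestronglyMeasurable
  · filter_upwards [h1] with s hs
    refine Filter.Eventually.of_forall fun x => ?_
    by_cases hx : x ∈ closedBall (0 : E3) (|R| + 1)
    · rw [indicator_of_mem hx, norm_mul]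
      exact mul_le_mul (hq hu1 s hs.1 x) (hq hw1 s hs.1 x) (abs_nonneg _) hKu
    · rw [indicator_of_notMem hx]
      rw [mem_closedBall_zero_iff, not_le] at hx
      have h2 : ‖x‖ ≤ ‖x + s • e‖ + s := by
        have := norm_sub_le (x + s • e) (s • e)
        rwa [add_sub_cancel_right, norm_smul, he, mul_one, Real.norm_of_nonneg hs.1.le] at this
      have := le_abs_self R
      rw [hR x (by linarith), hR (x + s • e) (by linarith [hs.2])]; simp
  · exact (integrable_indicator_iff measurableSet_closedBall).2 (integrableOn_const measure_closedBall_lt_top.ne)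
  · filter_upwards [hu.1.ae, hw.1.ae] with x hx1 hx2
    have h2 : ∀ {f : E3 → ℝ}, DifferentiableAt ℝ f x → Filter.Tendsto (fun s : ℝ => s⁻¹ * (f (x + s • e) - f x)) (nhdsWithin 0 (Ioi 0)) (nhds ⟪gradient f x, e⟫) := fun {f} hf => by
      rw [grad_inner]
      exact (hf.hasFDerivAt.hasLineDerivAt e).tendsto_slope_zero_right
    exact (h2 hx1).mul (h2 hx2)

lemma dq_second {u w : E3 → ℝ} (hu : LC u) (hw : LC w) (t : E3) :
    ∫ x, (u (x + t) - u x) * (w (x + t) - w x) = - ∫ x, u x * (w (x + t) + w (x - t) - 2 * w x) := by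
  have n1 : ∀ t, Nice (fun x => w (x + t)) := fun t => (hw.trans t).nice
  have n0 : Nice (fun x => w (x - t)) := by simpa [sub_eq_add_neg] using n1 (-t)
  have nu := (hu.trans t).nice
  have i1 : Integrable (fun x => u (x + t) * (w (x + t) - w x)) := (Nice.mul nu ((n1 t).sub hw.nice).bm).integrable
  have i2 : Integrable (fun x => u x * (w (x + t) - w x)) := (Nice.mul hu.nice ((n1 t).sub hw.nice).bm).integrable
  have i3 : Integrable (fun x => u x * (w x - w (x - t))) := (Nice.mul hu.nice (hw.nice.sub n0).bm).integrable
  have e1 : ∫ x, u (x + t) * (w (x + t) - w x) = ∫ x, u x * (w x - w (x - t)) := by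
    rw [← integral_add_right_eq_self (fun x => u x * (w x - w (x - t))) t]
    simp
  simp only [sub_mul (u _)]
  rw [integral_sub i1 i2, e1, ← integral_sub i3 i2, ← integral_neg]
  congr 1; ext x; ring

lemma DD_le_second {u w : E3 → ℝ} (hu : LC u) (hw : LC w) {A B : ℝ}
    (H : ∀ᶠ s : ℝ in nhdsWithin 0 (Ioi 0), ∀ e : E3, ‖e‖ = 1 → ∫ x, |u x| * |w (x + s • e) + w (x - s • e) - 2 * w x| ≤ s ^ 2 * (B + A * s)) :
    |DD u w| ≤ 3 * B := by
  have h1 : ∀ e : E3, ‖e‖ = 1 → |∫ x, ⟪gradient u x, e⟫ * ⟪gradient w x, e⟫| ≤ B := fun e he => by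
    have hB : Filter.Tendsto (fun s : ℝ => B + A * s) (nhdsWithin 0 (Ioi 0)) (nhds B) := by
      have : Filter.Tendsto (fun s : ℝ => B + A * s) (nhds 0) (nhds (B + A * 0)) := (by fun_prop : Continuous fun s : ℝ => B + A * s).tendsto 0
      rw [mul_zero, add_zero] at this
      exact this.mono_left nhdsWithin_le_nhds
    refine le_of_tendsto_of_tendsto (dq_limit hu hw he).abs hB ?_
    filter_upwards [H, self_mem_nhdsWithin] with s hs hs0
    have hs0' : 0 < s := hs0
    have e1 : ∀ x, (s⁻¹ * (u (x + s • e) - u x)) * (s⁻¹ * (w (x + s • e) - w x)) = (s ^ 2)⁻¹ * ((u (x + s • e) - u x) * (w (x + s • e) - w x)) := fun x => by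
      rw [← inv_pow]; ring
    simp only [e1]
    rw [integral_const_mul, dq_second hu hw, abs_mul, abs_neg, abs_of_pos (by positivity), inv_mul_le_iff₀ (by positivity)]
    refine le_trans ?_ (hs e he)
    refine (abs_integral_le_integral_abs).trans (le_of_eq ?_)
    simp only [abs_mul]
  have b := EuclideanSpace.basisFun (Fin 3) ℝ
  have e1 : DD u w = ∑ k, ∫ x, ⟪gradient u x, b k⟫ * ⟪gradient w x, b k⟫ := by
    rw [← integral_finsetSum]
    · unfold DD
      congr 1; ext x
      rw [← b.sum_inner_mul_inner]
      exact Finset.sum_congr rfl fun k _ => by rw [real_inner_comm (gradient w x)]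
    · intro k _
      exact (Nice.mul (hu.grad.inner (bm_const (b k))) (hw.grad.inner (bm_const (b k))).bm).integrable
  rw [e1]
  refine (Finset.abs_sum_le_sum_abs _ _).trans ((Finset.sum_le_sum fun k _ => h1 (b k) (b.norm_eq_one k)).trans ?_)
  simp

/-! ### The total variation bound -/

lemma tv_bound {Ω : Set E3} (hΩ : Dom Ω) (hne : Ω.Nonempty) {T : Finset (Fin 4 → E3)} {h c : ℝ} (M : Mesh Ω T h c) (hc : 0 < c) (hh : 0 < h)
    {u : E3 → ℝ} (hu : Lip0 Ω u) {U : ℝ} (hU : ∀ x, |u x| ≤ U) {w : E3 → ℝ} (hw : Lip0 Ω w)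
    {p : (Fin 4 → E3) → E3 → ℝ} (hpd : ∀ v, Differentiable ℝ (p v)) (hp : ∀ v ∈ T, ∀ x ∈ tet v, w x = p v x)
    {g : (Fin 4 → E3) → E3} {Λ L : (Fin 4 → E3) → ℝ} (hΛ0 : ∀ v, 0 ≤ Λ v) (hL0 : ∀ v, 0 ≤ L v)
    (hΛ : ∀ v ∈ T, ∀ x ∈ tet v, ∀ s : ℝ, 0 ≤ s → s ≤ h → ∀ e : E3, ‖e‖ ≤ 1 → |p v (x + s • e) + p v (x - s • e) - 2 * p v x| ≤ Λ v * s ^ 2)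
    (hL : ∀ v ∈ T, ∀ v' ∈ T, ∀ z ∈ tet v', ‖z - v 0‖ ≤ 2 * h → ‖gradient (p v') z - g v‖ ≤ L v) :
    |DD u w| ≤ 3 * ∑ v ∈ T, U * (volume.real (tet v) * (Λ v + 6 * L v / (c * h))) := by
  obtain ⟨Ku, hKu, hu1⟩ := hu.1.le
  obtain ⟨Kw, hKw, hw1⟩ := hw.1.le
  obtain ⟨x1, hx1⟩ := hne
  obtain ⟨ρ, hρ, hρΩ⟩ := Metric.isOpen_iff.1 hΩ.1 x1 hx1
  have hρΩ' : closedBall x1 (ρ / 2) ⊆ Ω := (closedBall_subset_ball (by linarith)).trans hρΩ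
  have hU0 : 0 ≤ U := (abs_nonneg _).trans (hU x1)
  have hch : 0 < c * h := mul_pos hc hh
  refine DD_le_second (A := 2 * Ku * Kw * (3 * volume.real Ω / (ρ / 2))) (hu.lc hΩ) (hw.lc hΩ) ?_
  have hm : 0 < min h (min (c * h) (ρ / 2)) := by positivity
  filter_upwards [Ioo_mem_nhdsGT hm] with s hs e he
  obtain ⟨hs0, hs1⟩ := hs
  obtain ⟨hsh, hs1⟩ := lt_min_iff.1 hs1
  obtain ⟨hsc, hsρ⟩ := lt_min_iff.1 hs1
  have hlay : ∀ v ∈ T, ∃ S, MeasurableSet S ∧ S ⊆ tet v ∧ volume.real S ≤ 3 * (s / (c * h)) * volume.real (tet v) ∧ ∀ x ∈ tet v, x ∉ S → closedBall x s ⊆ tet v := fun v hv => by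
    obtain ⟨x0, hx0⟩ := M.inb v hv
    exact layer (tet_convex v) (tet_closed v).measurableSet (tet_compact v).isBounded hch hs0 hsc hx0
  choose! S hSm hSt hSv hSb using hlay
  obtain ⟨S0, hS0m, hS0t, hS0v, hS0b⟩ := layer hΩ.2.2 hΩ.meas hΩ.2.1 (by positivity) hs0 hsρ hρΩ'
  have hfin : ∀ v, volume (tet v) ≠ ⊤ := fun v => (tet_compact v).measure_lt_top.ne
  have hint : ∀ {A B : Set E3} (a : ℝ), MeasurableSet A → A ⊆ B → volume B ≠ ⊤ → Integrable (A.indicator fun _ => a) := fun {A B} a hA hAB hB =>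
    (integrable_indicator_iff hA).2 (integrableOn_const (measure_ne_top_of_subset hAB hB))
  have i1 : ∀ v, Integrable ((tet v).indicator fun _ => U * (Λ v * s ^ 2)) := fun v => hint _ (tet_closed v).measurableSet subset_rfl (hfin v)
  have i2 : ∀ v ∈ T, Integrable ((S v).indicator fun _ => U * (2 * L v * s)) := fun v hv => hint _ (hSm v hv) (hSt v hv) (hfin v)
  have i3 : Integrable (S0.indicator fun _ => Ku * s * (2 * Kw * s)) := hint _ hS0m hS0t hΩ.2.1.measure_lt_top.ne
  have hse : ‖s • e‖ = s := by rw [norm_smul, he, mul_one, Real.norm_of_nonneg hs0.le]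
  have hpt : ∀ x, |u x| * |w (x + s • e) + w (x - s • e) - 2 * w x| ≤
      (∑ v ∈ T, ((tet v).indicator (fun _ => U * (Λ v * s ^ 2)) x + (S v).indicator (fun _ => U * (2 * L v * s)) x)) + S0.indicator (fun _ => Ku * s * (2 * Kw * s)) x := fun x => by
    have n1 : ∀ v, 0 ≤ (tet v).indicator (fun _ => U * (Λ v * s ^ 2)) x := fun v => indicator_nonneg (fun _ _ => by have := hΛ0 v; positivity) _
    have n2 : ∀ v, 0 ≤ (S v).indicator (fun _ => U * (2 * L v * s)) x := fun v => indicator_nonneg (fun _ _ => by have := hL0 v; positivity) _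
    have n3 : 0 ≤ S0.indicator (fun _ => Ku * s * (2 * Kw * s)) x := indicator_nonneg (fun _ _ => by positivity) _
    have n4 := Finset.sum_nonneg fun v (_ : v ∈ T) => add_nonneg (n1 v) (n2 v)
    by_cases hx : x ∈ Ω
    swap
    · rw [hu.2 x hx, abs_zero, zero_mul]; exact add_nonneg n4 n3
    by_cases hb : closedBall x s ⊆ Ω
    swap
    · have hxS : x ∈ S0 := by by_contra hn; exact hb (hS0b x hx hn)
      refine le_trans ?_ (le_add_of_nonneg_left n4)
      rw [indicator_of_mem hxS]
      obtain ⟨y, hy, hyΩ⟩ := not_subset.1 hb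
      have h1 : |u x| ≤ Ku * s := by
        have := hu1 x y
        rw [hu.2 y hyΩ, sub_zero] at this
        refine this.trans (mul_le_mul_of_nonneg_left ?_ hKu)
        rwa [mem_closedBall, dist_eq_norm, norm_sub_rev] at hy
      have h2 : |w (x + s • e) + w (x - s • e) - 2 * w x| ≤ 2 * Kw * s := by
        have a1 := hw1 (x + s • e) x
        have a2 := hw1 (x - s • e) x
        rw [add_sub_cancel_left, hse] at a1
        rw [sub_sub_cancel_left, norm_neg, hse] at a2
        rw [abs_le] at *
        constructor <;> linarith [a1.1, a1.2, a2.1, a2.2]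
      exact mul_le_mul h1 h2 (abs_nonneg _) (by positivity)
    obtain ⟨v, hv, hxv⟩ := M.ex_tet (subset_closure hx)
    refine le_trans ?_ (le_add_of_nonneg_right n3)
    refine le_trans ?_ (Finset.single_le_sum (fun v _ => add_nonneg (n1 v) (n2 v)) hv)
    have m1 : x + s • e ∈ closedBall x s := by rw [mem_closedBall, dist_eq_norm, add_sub_cancel_left, hse]
    have m2 : x - s • e ∈ closedBall x s := by rw [mem_closedBall, dist_eq_norm, sub_sub_cancel_left, norm_neg, hse]
    by_cases ht : closedBall x s ⊆ tet v
    · refine le_trans ?_ (le_add_of_nonneg_right (n2 v))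
      rw [indicator_of_mem hxv, hp v hv _ (ht m1), hp v hv _ (ht m2), hp v hv x hxv]
      exact mul_le_mul (hU x) (hΛ v hv x hxv s hs0.le hsh.le e he.le) (abs_nonneg _) hU0
    · have hxS : x ∈ S v := by by_contra hn; exact ht (hSb v hv x hxv hn)
      refine le_trans ?_ (le_add_of_nonneg_left (n1 v))
      rw [indicator_of_mem hxS]
      refine mul_le_mul (hU x) ?_ (abs_nonneg _) hU0
      have key : ∀ a ∈ closedBall x s, ∀ b ∈ closedBall x s, w b - w a - ⟪g v, b - a⟫ ≤ L v * ‖b - a‖ := fun a ha b hb' => by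
        have hseg : segment ℝ a b ⊆ closedBall x s := (convex_closedBall x s).segment_subset ha hb'
        refine seg_lip T tet (fun v _ => tet_closed v) (fun v _ => hpd v) hp (fun z hz => M.ex_tet (subset_closure (hb (hseg hz)))) hw.1.cont.continuousOn
          fun z hz v' hv' hzv => hL v hv v' hv' z hzv ?_
        have h1 := hseg hz
        rw [mem_closedBall, dist_eq_norm] at h1
        have h2 := M.dist_le hv hxv (tet_vert v 0)
        have := norm_sub_le_norm_sub_add_norm_sub z x (v 0)
        linarith
      have m0 : x ∈ closedBall x s := mem_closedBall_self hs0.le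
      have k1 := key _ m0 _ m1
      have k2 := key _ m1 _ m0
      have k3 := key _ m0 _ m2
      have k4 := key _ m2 _ m0
      rw [add_sub_cancel_left, hse] at k1
      rw [sub_add_cancel_left, norm_neg, hse, inner_neg_right] at k2
      rw [sub_sub_cancel_left, norm_neg, hse, inner_neg_right] at k3
      rw [sub_sub_cancel, hse] at k4
      rw [abs_le]; constructor <;> linarith
  refine (integral_mono_of_nonneg (Filter.Eventually.of_forall fun x => by positivity)
    ((integrable_finsetSum T fun v hv => (i1 v).fun_add (i2 v hv)).fun_add i3) (Filter.Eventually.of_forall hpt)).trans ?_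
  rw [integral_add (integrable_finsetSum T fun v hv => (i1 v).fun_add (i2 v hv)) i3, integral_finsetSum T fun v hv => (i1 v).fun_add (i2 v hv),
    integral_indicator_const _ hS0m, mul_add, Finset.mul_sum]
  refine add_le_add (Finset.sum_le_sum fun v hv => ?_) ?_
  · rw [integral_add (i1 v) (i2 v hv), integral_indicator_const _ (tet_closed v).measurableSet, integral_indicator_const _ (hSm v hv), smul_eq_mul, smul_eq_mul]
    have := mul_le_mul_of_nonneg_right (hSv v hv) (by have := hL0 v; positivity : 0 ≤ U * (2 * L v * s))
    refine (add_le_add_right this _).trans (le_of_eq ?_)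
    field_simp; ring
  · rw [smul_eq_mul]
    refine (mul_le_mul_of_nonneg_right hS0v (by positivity)).trans (le_of_eq ?_)
    field_simp

lemma tv_fem {Ω : Set E3} (G : Geo Ω) {r : ℕ} (hr : 1 ≤ r) {c : ℝ} (hc : 0 < c) : ∃ C : ℝ, 0 < C ∧ ∀ h : ℝ, 0 < h → ∀ T, Mesh Ω T h c →
    ∀ φ, Lip0 Ω φ → ∀ w, Vh Ω T r w → ∀ g : (Fin 4 → E3) → E3, ∀ u, Lip0 Ω u → ∀ U, (∀ x, |u x| ≤ U) →
    (DD u w) ^ 2 ≤ C * U ^ 2 * ((∑ v ∈ T, (∫ x in closedBall (v 0) (3 * h), ‖gradient (G.hat φ) x - g v‖ ^ 2) +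
      DD (fun x => φ x - w x) (fun x => φ x - w x)) / h ^ 2) := by
  obtain ⟨Cp, hCp, HP⟩ := poly_inv hr hc
  have homp := om_pos
  set V := volume.real (closure Ω) with hV
  have hV0 : 0 ≤ V := measureReal_nonneg
  refine ⟨9 * (1 + 6 / c) ^ 2 * (om * (V + 1) * Cp / c ^ 3) * (2 + 2 * (64 / c ^ 3)), by positivity, fun h hh T M φ hφ w hwV g u hu U hU => ?_⟩
  have hw := hwV.lip0 G.dom M
  have hwL := hw.lc G.dom
  set X := ∑ v ∈ T, (∫ x in closedBall (v 0) (3 * h), ‖gradient (G.hat φ) x - g v‖ ^ 2)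
  set θ : E3 → ℝ := fun x => φ x - w x with hθ
  have hθL : LC θ := (hφ.sub hw).lc G.dom
  have hX0 : 0 ≤ X := Finset.sum_nonneg fun v _ => integral_nonneg fun x => by positivity
  have hchoice : ∀ v ∈ T, ∃ p : MvPolynomial (Fin 3) ℝ, p.totalDegree ≤ r ∧ ∀ x ∈ tet v, w x = pe p x := hwV.1.1.2
  choose! p hpr hp using hchoice
  have hgb : ∀ {f : E3 → ℝ}, Lip f → ∀ v, BM (fun x => gradient f x - g v) := fun hf v => hf.grad_bm.sub (bm_const _)
  have hib : ∀ {a : E3 → ℝ}, BM a → ∀ z : E3, IntegrableOn a (closedBall z (3 * h)) := fun {a} ha z => by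
    obtain ⟨C, hC⟩ := ha.2
    exact Measure.integrableOn_of_bounded (M := C) measure_closedBall_lt_top.ne ha.1.aestronglyMeasurable (Filter.Eventually.of_forall hC)
  set W : (Fin 4 → E3) → ℝ := fun v => ∫ x in closedBall (v 0) (3 * h), Ω.indicator (fun x => ‖gradient w x - g v‖ ^ 2) x with hW
  have hn : ∀ v x, 0 ≤ Ω.indicator (fun x => ‖gradient w x - g v‖ ^ 2) x := fun v x => indicator_nonneg (fun _ _ => by positivity) _
  have hW0 : ∀ v, 0 ≤ W v := fun v => integral_nonneg (hn v)
  have hiW : ∀ v : Fin 4 → E3, IntegrableOn (Ω.indicator (fun x => ‖gradient w x - g v‖ ^ 2)) (closedBall (v 0) (3 * h)) := fun v =>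
    (hib (hgb hw.1 v).norm.sq (v 0)).indicator G.dom.meas
  -- sum of the local quantities
  have hWs : ∑ v ∈ T, W v ≤ (2 + 2 * (64 / c ^ 3)) * (X + DD θ θ) := by
    have h1 : ∀ v ∈ T, W v ≤ 2 * (∫ x in closedBall (v 0) (3 * h), ‖gradient (G.hat φ) x - g v‖ ^ 2) + 2 * ∫ x in closedBall (v 0) (3 * h), ‖gradient θ x‖ ^ 2 := fun v hv => by
      have j1 := hib (hgb (G.hat_lc (hφ.lc G.dom)).1 v).norm.sq (v 0)
      have j2 := hib hθL.grad.bm.norm.sq (v 0)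
      rw [← integral_const_mul, ← integral_const_mul, ← integral_add (j1.const_mul 2) (j2.const_mul 2)]
      refine integral_mono_ae (hiW v) ((j1.const_mul 2).add (j2.const_mul 2)) ?_
      refine ae_restrict_of_ae ?_
      filter_upwards [hφ.1.ae, hw.1.ae] with x a1 a2
      by_cases hx : x ∈ Ω
      · rw [indicator_of_mem hx]
        have e1 : gradient φ x = gradient (G.hat φ) x := grad_congr_int (S := Ω) (fun y hy => (G.hat_eq hφ.2 (subset_closure hy)).symm) (by rwa [G.dom.1.interior_eq])
        have e2 : gradient w x - g v = (gradient (G.hat φ) x - g v) - gradient θ x := by rw [hθ, grad_sub a1 a2, e1]; abel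
        rw [e2]
        have h2 := pow_le_pow_left₀ (norm_nonneg _) (norm_sub_le (gradient (G.hat φ) x - g v) (gradient θ x)) 2
        refine h2.trans ?_
        nlinarith [sq_nonneg (‖gradient (G.hat φ) x - g v‖ - ‖gradient θ x‖)]
      · rw [indicator_of_notMem hx]; positivity
    have h2 := M.sum_ball hc hh hθL.grad.norm.sq.integrable fun x => by positivity
    rw [← DD_self] at h2
    have h3 := Finset.sum_le_sum h1
    rw [Finset.sum_add_distrib, ← Finset.mul_sum, ← Finset.mul_sum] at h3
    have h4 := DD_self_nonneg θ
    have h5 : 0 ≤ 64 / c ^ 3 * X := by positivity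
    change _ ≤ 2 * X + _ at h3
    nlinarith
  have hloc : ∀ v ∈ T, ∀ v' ∈ T, ∀ z ∈ tet v', ‖z - v 0‖ ≤ 2 * h → ∀ x0, closedBall x0 (c * h) ⊆ tet v' →
      ∫ x in closedBall x0 (c * h), ‖gradient (pe (p v')) x - g v‖ ^ 2 ≤ W v := fun v hv v' hv' z hz hzv x0 hx0 => by
    have hsub : closedBall x0 (c * h) ⊆ closedBall (v 0) (3 * h) := fun y hy => by
      have h1 := M.dist_le hv' (hx0 hy) hz
      rw [mem_closedBall, dist_eq_norm]
      have := norm_sub_le_norm_sub_add_norm_sub y z (v 0)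
      linarith
    refine le_trans (le_of_eq ?_) (setIntegral_mono_set (hiW v) (Filter.Eventually.of_forall (hn v)) hsub.eventuallyLE)
    refine setIntegral_congr_ae measurableSet_closedBall ?_
    filter_upwards [M.ae_interior, G.dom.ae_frontier] with x hx1 hx2 hx3
    have hxt := hx0 hx3
    have hxΩ : x ∈ Ω := by
      by_contra hn
      exact hx2 ⟨M.sub_closure hv' hxt, by rwa [G.dom.1.interior_eq]⟩
    rw [indicator_of_mem hxΩ, grad_congr_int (hp v' hv') (hx1 v' hv' hxt)]
  set Λ : (Fin 4 → E3) → ℝ := fun v => √(Cp * (h ^ 5)⁻¹ * W v) with hΛ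
  have hΛ0 : ∀ v, 0 ≤ Λ v := fun v => Real.sqrt_nonneg _
  have hΛ2 : ∀ v, Λ v ^ 2 = Cp * (h ^ 5)⁻¹ * W v := fun v => Real.sq_sqrt (by have := hW0 v; positivity)
  have key := tv_bound G.dom G.ne M hc hh hu hU hw (p := fun v => pe (p v)) (fun v => pe_diff _) hp (g := g) (Λ := Λ) (L := fun v => h * Λ v) hΛ0
    (fun v => mul_nonneg hh.le (hΛ0 v))
    (fun v hv x hx s hs hsh e he => by
      obtain ⟨x0, hx0⟩ := M.inb v hv
      have h1 := (HP h hh x0 (p v) (hpr v hv) (g v)).2 x (M.dist_le hv hx (hx0 (mem_closedBall_self (by positivity)))) s hs hsh e he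
      have h2 := hloc v hv v hv (v 0) (tet_vert v 0) (by rw [sub_self, norm_zero]; positivity) x0 hx0
      refine abs_le_of_sq_le_sq (h1.trans ?_) (mul_nonneg (hΛ0 v) (sq_nonneg _))
      rw [mul_pow, hΛ2]
      calc _ ≤ Cp * s ^ 4 * (h ^ 5)⁻¹ * W v := by gcongr
        _ = _ := by ring)
    (fun v hv v' hv' z hz hzv => by
      obtain ⟨x0, hx0⟩ := M.inb v' hv'
      have h1 := (HP h hh x0 (p v') (hpr v' hv') (g v)).1 z (M.dist_le hv' hz (hx0 (mem_closedBall_self (by positivity))))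
      have h2 := hloc v hv v' hv' z hz hzv x0 hx0
      refine le_of_sq_le_sq (h1.trans ?_) (mul_nonneg hh.le (hΛ0 v))
      rw [mul_pow, hΛ2]
      calc _ ≤ Cp * (h ^ 3)⁻¹ * W v := by gcongr
        _ = _ := by field_simp)
  have hU0 : 0 ≤ U := (abs_nonneg _).trans (hU 0)
  have hvol : ∀ v ∈ T, volume.real (tet v) ≤ h ^ 3 * om := fun v hv => by
    rw [← vol_cb (v 0) hh.le]
    exact measureReal_mono (fun x hx => by rw [mem_closedBall, dist_eq_norm]; exact M.dist_le hv hx (tet_vert v 0)) measure_closedBall_lt_top.ne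
  have h1 : |DD u w| ≤ 3 * U * (1 + 6 / c) * (h ^ 3 * om) * ∑ v ∈ T, Λ v := by
    refine key.trans ?_
    rw [Finset.mul_sum, Finset.mul_sum]
    refine Finset.sum_le_sum fun v hv => ?_
    have e : Λ v + 6 * (h * Λ v) / (c * h) = (1 + 6 / c) * Λ v := by field_simp
    rw [e]
    have := mul_le_mul_of_nonneg_right (hvol v hv) (by have := hΛ0 v; positivity : 0 ≤ (1 + 6 / c) * Λ v)
    have := mul_le_mul_of_nonneg_left this hU0
    nlinarith
  have h2 : (∑ v ∈ T, Λ v) ^ 2 ≤ T.card * (Cp * (h ^ 5)⁻¹ * ∑ v ∈ T, W v) := by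
    refine sq_sum_le_card_mul_sum_sq.trans (le_of_eq ?_)
    simp only [hΛ2, Finset.mul_sum]
  have h3 := M.card_le G.dom hc hh
  have h4 : T.card * h ^ 3 * om ≤ (V + 1) / c ^ 3 := by
    rw [le_div_iff₀ (by positivity)]
    calc _ = T.card * ((c * h) ^ 3 * om) := by ring
      _ ≤ _ := by linarith
  have hWs0 : 0 ≤ ∑ v ∈ T, W v := Finset.sum_nonneg fun v _ => hW0 v
  calc (DD u w) ^ 2 = |DD u w| ^ 2 := (sq_abs _).symm
    _ ≤ (3 * U * (1 + 6 / c) * (h ^ 3 * om) * ∑ v ∈ T, Λ v) ^ 2 := by gcongr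
    _ = 9 * U ^ 2 * (1 + 6 / c) ^ 2 * (h ^ 3 * om) ^ 2 * (∑ v ∈ T, Λ v) ^ 2 := by ring
    _ ≤ 9 * U ^ 2 * (1 + 6 / c) ^ 2 * (h ^ 3 * om) ^ 2 * (T.card * (Cp * (h ^ 5)⁻¹ * ∑ v ∈ T, W v)) := by gcongr
    _ = 9 * U ^ 2 * (1 + 6 / c) ^ 2 * om * (T.card * h ^ 3 * om) * (Cp * ((∑ v ∈ T, W v) / h ^ 2)) := by field_simp
    _ ≤ 9 * U ^ 2 * (1 + 6 / c) ^ 2 * om * ((V + 1) / c ^ 3) * (Cp * (((2 + 2 * (64 / c ^ 3)) * (X + DD θ θ)) / h ^ 2)) := by gcongr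
    _ = _ := by ring

/-! ### Duality -/

lemma int_mul_le {Ω : Set E3} (hΩ : Dom Ω) {u e : E3 → ℝ} (hu : Lip0 Ω u) {U : ℝ} (hU : ∀ x, |u x| ≤ U) (he : Nice e) :
    ∫ x, e x * u x ≤ 1 / 4 * (∫ x, e x ^ 2) + volume.real Ω * U ^ 2 := by
    have i1 := he.sq.integrable; have i2 := (hu.lc hΩ).nice.sq.integrable
    have h3 : ∫ x, u x ^ 2 ≤ volume.real Ω * U ^ 2 := by
      rw [← setint_eq hΩ.meas (Filter.Eventually.of_forall fun x hx => by simp [hu.2 x hx])]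
      have h4 : ∫ x in Ω, u x ^ 2 ≤ ∫ x in Ω, U ^ 2 := setIntegral_mono i2.integrableOn (integrableOn_const hΩ.2.1.measure_lt_top.ne) fun x => by
        have := hU x
        calc u x ^ 2 = |u x| ^ 2 := (sq_abs _).symm
          _ ≤ U ^ 2 := by gcongr
      rwa [setIntegral_const, smul_eq_mul] at h4
    have h5 : ∫ x, e x * u x ≤ ∫ x, (1 / 4 * e x ^ 2 + u x ^ 2) := integral_mono (Nice.mul he (hu.lc hΩ).nice.bm).integrable ((i1.const_mul _).add i2) fun x => by
      change e x * u x ≤ 1 / 4 * e x ^ 2 + u x ^ 2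
      nlinarith [sq_nonneg (e x / 2 - u x)]
    rw [integral_add (i1.const_mul _) i2, integral_const_mul] at h5
    linarith

lemma neg_le_aux {a F B : ℝ} (hF : 0 ≤ F) (hB : 0 ≤ B) (h : a ^ 2 ≤ B * F) : -a ≤ 1 / 4 * F + B := by
  by_contra hn
  push Not at hn
  have h4 : (1 / 4 * F + B) ^ 2 < (-a) ^ 2 := pow_lt_pow_left₀ hn (by positivity) two_ne_zero
  linarith [sq_nonneg (1 / 4 * F - B)]

set_option maxHeartbeats 800000 in
lemma ritz_core {Ω : Set E3} (G : Geo Ω) {r : ℕ} (hr : 1 ≤ r) {c : ℝ} (hc : 0 < c) : ∃ C : ℝ, 0 ≤ C ∧ ∀ h : ℝ, 0 < h → ∀ T, Mesh Ω T h c →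
    ∀ u, Lip0 Ω u → ∀ U, (∀ x, |u x| ≤ U) → ∀ uh, Vh Ω T r uh → (∀ χ, Vh Ω T r χ → DD (fun x => u x - uh x) χ = 0) →
    ∫ x, (u x - uh x) ^ 2 ≤ C * U ^ 2 := by
  obtain ⟨C1, c₀, hC1, hc₀, HR⟩ := G.regularity
  obtain ⟨C3, hC3, HT⟩ := tv_fem G hr hc
  obtain ⟨R, hR, hRb⟩ := G.dom.ball
  have hC0 : 0 < Geo.C0 c := by unfold Geo.C0; positivity
  set V := volume.real Ω with hV
  have hV0 : 0 ≤ V := measureReal_nonneg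
  set C4 : ℝ := C3 * ((3 + 8 / c ^ 2) * (Geo.C0 c * (C1 * (11 + 16 * R ^ 2))) + 4) with hC4
  have hC4p : 0 < C4 := by positivity
  refine ⟨4 * (V + C4), by positivity, fun h hh T M u hu U hU uh huh hgal => ?_⟩
  have hu0 := huh.lip0 G.dom M
  set e : E3 → ℝ := fun x => u x - uh x with he
  have he0 : Lip0 Ω e := hu.sub hu0
  have heL := he0.lc G.dom; have huL := hu.lc G.dom; have huhL := hu0.lc G.dom
  set F := ∫ x, e x ^ 2 with hF
  have hF0 : 0 ≤ F := integral_nonneg fun x => by positivity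
  change F ≤ _
  rcases hF0.eq_or_lt with hF0 | hF0
  · rw [← hF0]; positivity
  have d1 := DD_self_nonneg e; have d2 := DD_self_nonneg u; have d3 := DD_self_nonneg uh
  set A := (1 + DD e e) + (1 + DD u u) + 2 * (1 + DD uh uh) with hA
  have hAp : 0 < A := by positivity
  obtain ⟨ε, hε, hε1⟩ := exists_between (show 0 < min (c₀ * h ^ 2) (min c₀ (min (1 / 8) (min F (min (F * h ^ 2) (F / (4 * A)))))) by positivity)
  simp only [lt_min_iff] at hε1
  obtain ⟨e1, e2, e3, e4, e5, e6⟩ := hε1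
  rw [lt_div_iff₀ (by positivity)] at e6
  obtain ⟨φ, hφ0, hφD, hφ⟩ := approx_sol (Lip0 Ω) hR (fun v hv => ⟨hv.1, fun x hx => hv.2 x fun h => absurd (hRb x (subset_closure h)) (not_le.2 hx)⟩)
    ⟨⟨0, LipschitzWith.const 0⟩, fun _ _ => rfl⟩ (fun v w s hv hw => hv.add (hw.const_mul s)) heL.nice hε
  have hφS : AppSol Ω e ε φ := ⟨hφ0, hφ⟩
  obtain ⟨r1, r2, r3⟩ := HR h hh e heL.nice he0.2 ε hε.le e1.le e2.le φ hφS
  have h2 : 0 < h ^ 2 := by positivity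
  set E := (∫ x, e x ^ 2) + ε + DD φ φ with hE
  have hQ : C1 * E ≤ C1 * (h ^ 2 * E + ε) / h ^ 2 := by
    rw [le_div_iff₀ h2]
    have := mul_pos hC1 hε
    linarith
  obtain ⟨I, g, hI, hID, hX⟩ := G.interp_err M hc hh hr hφ0 (r1.trans hQ) (r2.trans hQ) r3
  obtain ⟨ψ, hψ, hψ', hθ⟩ := galerkin G.dom M heL.nice hε e3.le hφS (vh_ind G.dom.1 M hI)
  have htv := HT h hh T M φ hφ0 ψ hψ g u hu U hU
  have hEb : E ≤ (10 + 16 * R ^ 2) * F := by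
    have : ε ^ 2 ≤ ε := pow_le_of_le_one hε.le (by linarith) two_ne_zero
    rw [hE, ← hF]; linarith
  have hQb : C1 * (h ^ 2 * E + ε) ≤ C1 * (11 + 16 * R ^ 2) * F * h ^ 2 := by
    have : h ^ 2 * E + ε ≤ (11 + 16 * R ^ 2) * F * h ^ 2 := by
      have := mul_le_mul_of_nonneg_left hEb h2.le
      linarith
    calc _ ≤ C1 * ((11 + 16 * R ^ 2) * F * h ^ 2) := by gcongr
      _ = _ := by ring
  have htv2 : (DD u ψ) ^ 2 ≤ C4 * U ^ 2 * F := by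
    refine htv.trans ?_
    have : (∑ v ∈ T, (∫ x in closedBall (v 0) (3 * h), ‖gradient (G.hat φ) x - g v‖ ^ 2) + DD (fun x => φ x - ψ x) (fun x => φ x - ψ x)) / h ^ 2 ≤
        ((3 + 8 / c ^ 2) * (Geo.C0 c * (C1 * (11 + 16 * R ^ 2))) + 4) * F := by
      rw [div_le_iff₀ h2]
      have h3 := mul_le_mul_of_nonneg_left hQb (by positivity : 0 ≤ (3 + 8 / c ^ 2) * Geo.C0 c)
      linarith
    calc _ ≤ C3 * U ^ 2 * (((3 + 8 / c ^ 2) * (Geo.C0 c * (C1 * (11 + 16 * R ^ 2))) + 4) * F) := by gcongr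
      _ = _ := by rw [hC4]; ring
  have f1 := abs_le.1 (hφ e he0)
  have f2 := abs_le.1 (hφ u hu)
  have f3 := abs_le.1 (hφ uh hu0)
  have f4 := abs_le.1 (hψ' uh huh)
  have f5 : DD φ e = DD φ u - DD φ uh := DD_sub_right (hφ0.lc G.dom) huL huhL
  have f6 : DD ψ u - DD ψ uh = 0 := by rw [← DD_sub_right ((hψ.lip0 G.dom M).lc G.dom) huL huhL, DD_comm]; exact hgal ψ hψ
  have f7 : ∫ x, e x * e x = F := by simp only [hF, sq]
  have f8 := int_mul_le G.dom hu hU heL.nice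
  have f9 := neg_le_aux hF0.le (by positivity : 0 ≤ C4 * U ^ 2) htv2
  rw [DD_comm u ψ] at f9
  rw [f7] at f1
  have f10 : ε * A = ε * (1 + DD e e) + ε * (1 + DD u u) + 2 * (ε * (1 + DD uh uh)) := by rw [hA]; ring
  linarith [f1.1, f2.2, f3.1, f4.2]

/-- **`L²` bound of the Ritz projection error by the maximum norm of the data
(estimate (5.8)).** -/
theorem ritz_L2_error_by_max_norm
    (Ω : Set E3) (hΩ : IsConvexPolyhedron Ω)
    (c : ℝ) (hc : 0 < c) (r : ℕ) (hr : 1 ≤ r) :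
    ∃ C : ℝ, ∀ h : ℝ, 0 < h → ∀ T : Finset (Fin 4 → E3), IsTetPartition Ω T h c →
      ∀ u : E3 → ℝ, (∃ K : ℝ≥0, LipschitzOnWith K u (closure Ω)) →
        (∀ x ∈ frontier Ω, u x = 0) →
      ∀ u_h : E3 → ℝ, MemSh0 Ω T r u_h →
        (∀ χ : E3 → ℝ, MemSh0 Ω T r χ →
          ∫ x in Ω, ⟪gradient (fun y => u y - u_h y) x, gradient χ x⟫ = 0) →
        (∫ x in Ω, |u x - u_h x| ^ 2) ^ ((1 : ℝ) / 2) ≤ C * ⨆ x ∈ Ω, |u x| := by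
  have hdom : Dom Ω := ⟨hΩ.1, hΩ.2.1, hΩ.2.2.1⟩
  rcases Ω.eq_empty_or_nonempty with rfl | hne
  · exact ⟨0, fun h _ T _ u _ _ u_h _ _ => by simp⟩
  obtain ⟨G⟩ := exists_geo hΩ hne
  obtain ⟨C, hC, H⟩ := ritz_core G hr hc
  refine ⟨√C, fun h hh T hT u hu hu0 u_h huh hgal => ?_⟩
  obtain ⟨T', M, hTT⟩ := exists_mesh hT
  obtain ⟨K, hK⟩ := hu
  have huL : Lip0 Ω (Ω.indicator u) := lip0_ext K.2 (fun x hx y hy => by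
    have := hK.dist_le_mul x hx y hy
    rwa [Real.dist_eq, dist_eq_norm] at this) hu0
  have hV := vh_ind hΩ.1 M ((hTT r u_h).2 huh)
  have hVL := hV.lip0 hdom M
  obtain ⟨B, hB⟩ := (huL.lc hdom).bdd
  set U := ⨆ x ∈ Ω, |u x| with hUdef
  have hin : ∀ x ∈ Ω, (⨆ _ : x ∈ Ω, |u x|) = |u x| := fun x hx => by
    haveI : Nonempty (x ∈ Ω) := ⟨hx⟩
    exact ciSup_const
  have hout : ∀ x ∉ Ω, (⨆ _ : x ∈ Ω, |u x|) = 0 := fun x hx => by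
    haveI : IsEmpty (x ∈ Ω) := ⟨hx⟩
    exact Real.iSup_of_isEmpty _
  have hbd : BddAbove (range fun x => ⨆ _ : x ∈ Ω, |u x|) := by
    refine ⟨B, ?_⟩
    rintro _ ⟨x, rfl⟩
    have h1 := hB x
    by_cases hx : x ∈ Ω
    · simp only [hin x hx]; rwa [indicator_of_mem hx] at h1
    · simp only [hout x hx]; exact (abs_nonneg _).trans h1
  have hU : ∀ x, |Ω.indicator u x| ≤ U := fun x => by
    have h1 : (⨆ _ : x ∈ Ω, |u x|) ≤ U := le_ciSup hbd x
    by_cases hx : x ∈ Ω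
    · rwa [indicator_of_mem hx, ← hin x hx]
    · rwa [indicator_of_notMem hx, abs_zero, ← hout x hx]
  have hz : ∀ x, x ∉ Ω → Ω.indicator u x - Ω.indicator u_h x = 0 := fun x hx => by simp [hx]
  have key := H h hh T' M _ huL U hU _ hV fun χ hχ => by
    rw [hdom.DD_eq hz, ← hgal χ ((hTT r χ).1 hχ.1)]
    refine setIntegral_congr_fun hdom.meas fun x hx => ?_
    have := grad_congr_int (S := Ω) (u := fun y => Ω.indicator u y - Ω.indicator u_h y) (p := fun y => u y - u_h y)
      (fun y hy => by simp [hy]) (by rwa [hΩ.1.interior_eq] : x ∈ interior Ω)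
    simp only [this]
  have e1 : ∫ x in Ω, |u x - u_h x| ^ 2 = ∫ x, (Ω.indicator u x - Ω.indicator u_h x) ^ 2 := by
    rw [← setint_eq hdom.meas (Filter.Eventually.of_forall fun x hx => by rw [hz x hx]; simp)]
    refine setIntegral_congr_fun hdom.meas fun x hx => ?_
    simp only [indicator_of_mem hx, sq_abs]
  have hU0 : 0 ≤ U := (abs_nonneg _).trans (hU 0)
  rw [e1, ← Real.sqrt_eq_rpow]
  refine Real.sqrt_le_iff.2 ⟨by positivity, ?_⟩
  rwa [mul_pow, Real.sq_sqrt hC]
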